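/- arXiv:1310.8102 — 2 statements merged into one kernel-verified Lean document; each statement's English description precedes it below -/
import Mathlib

section
/- For 1 ≤ m ≤ n−1, every generalized m-intersection body in ℝⁿ is an m-intersection body. -/
open MeasureTheory Metric Module
open scoped ENNReal FourierTransform RealInnerProductSpace Pointwise

noncomputable section

/-- `ℝⁿ` with its Euclidean structure. -/
abbrev Euc (n : ℕ) : Type := EuclideanSpace ℝ (Fin n)

/-- The radial function of a star body: the reciprocal of the Minkowski functional (gauge). -/
def radialFn {n : ℕ} (K : Set (Euc n)) (x : Euc n) : ℝ := (gauge K x)⁻¹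

/-- A star body: compact, the origin is interior, the Minkowski functional is continuous and
positive off the origin, and `K` is the unit ball of its Minkowski functional. -/
def IsStarBody {n : ℕ} (K : Set (Euc n)) : Prop :=
  IsCompact K ∧ (0 : Euc n) ∈ interior K ∧ Continuous (gauge K) ∧
    (∀ x : Euc n, x ≠ 0 → gauge K x ≠ 0) ∧ K = {x : Euc n | gauge K x ≤ 1}

/-- The Grassmannian of `d`-dimensional linear subspaces of `ℝⁿ`. -/
def Gr (n d : ℕ) : Type := {H : Submodule ℝ (Euc n) // finrank ℝ H = d}

/-- The spherical Radon transform `R_{d} g (H) = ∫_{S^{n-1} ∩ H} g`, the integral being with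
respect to the `(d-1)`-dimensional Hausdorff measure on the sphere of the `d`-dimensional
subspace `H`. -/
def sphRadon (n d : ℕ) (g : Euc n → ℝ) (H : Gr n d) : ℝ :=
  ∫ x in sphere (0 : Euc n) 1 ∩ (H.1 : Set (Euc n)), g x ∂μH[(d : ℝ) - 1]

/-- A generalized `m`-intersection body: an origin-symmetric star body `K` such that there is a
positive continuous (= bounded) linear functional `ν` on the range of the spherical Radon
transform `R_{n-m}` with `∫_{S^{n-1}} ‖x‖_K^{-m} g(x) dx = ν (R_{n-m} g)` for all continuous
`g`. -/
def IsGenIntBody (n m : ℕ) (K : Set (Euc n)) : Prop :=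
  IsStarBody K ∧ K = -K ∧
    ∃ ν : (Gr n (n - m) → ℝ) → ℝ,
      (∀ g₁ g₂ : Euc n → ℝ, Continuous g₁ → Continuous g₂ →
        ν (sphRadon n (n - m) (g₁ + g₂)) =
          ν (sphRadon n (n - m) g₁) + ν (sphRadon n (n - m) g₂)) ∧
      (∀ (c : ℝ) (g : Euc n → ℝ), Continuous g →
        ν (sphRadon n (n - m) (c • g)) = c * ν (sphRadon n (n - m) g)) ∧
      (∀ g : Euc n → ℝ, Continuous g → (∀ H, 0 ≤ sphRadon n (n - m) g H) →
        0 ≤ ν (sphRadon n (n - m) g)) ∧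
      (∃ C : ℝ, ∀ g : Euc n → ℝ, Continuous g →
        |ν (sphRadon n (n - m) g)| ≤ C * ⨆ H : Gr n (n - m), |sphRadon n (n - m) g H|) ∧
      (∀ g : Euc n → ℝ, Continuous g →
        (∫ x in sphere (0 : Euc n) 1, radialFn K x ^ m * g x ∂μH[(n : ℝ) - 1]) =
          ν (sphRadon n (n - m) g))

/-- `D` is the `k`-intersection body of `L`: `|D ∩ H^⊥| = |L ∩ H|` for every
`(n-k)`-dimensional subspace `H`. -/
def IsKIntBodyOf (n k : ℕ) (D L : Set (Euc n)) : Prop :=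
  ∀ H : Submodule ℝ (Euc n), finrank ℝ H = n - k →
    μH[(k : ℝ)] ((Hᗮ : Set (Euc n)) ∩ D) = μH[((n - k : ℕ) : ℝ)] ((H : Set (Euc n)) ∩ L)

/-- The class of `k`-intersection bodies: the closure in the radial metric of the class of
`k`-intersection bodies of star bodies. -/
def IsKIntBody (n k : ℕ) (D : Set (Euc n)) : Prop :=
  IsStarBody D ∧ ∀ ε : ℝ, 0 < ε → ∃ D' L : Set (Euc n),
    IsStarBody D' ∧ IsStarBody L ∧ IsKIntBodyOf n k D' L ∧
    ∀ ξ ∈ sphere (0 : Euc n) 1, |radialFn D ξ - radialFn D' ξ| ≤ ε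

/-- `K` is the intersection body of the star body `L` (Lutwak): the radius of `K` in every
direction equals the `(n-1)`-dimensional volume of the central hyperplane section of `L`
perpendicular to that direction. -/
def IsIntBodyOfStar (n : ℕ) (K L : Set (Euc n)) : Prop :=
  K = -K ∧ L = -L ∧ ∀ ξ ∈ sphere (0 : Euc n) 1,
    radialFn K ξ = (μH[((n - 1 : ℕ) : ℝ)] (((ℝ ∙ ξ)ᗮ : Set (Euc n)) ∩ L)).toReal

/-- The class of intersection bodies: the closure in the radial metric of the class of
intersection bodies of star bodies. -/
def IsIntersectionBody (n : ℕ) (K : Set (Euc n)) : Prop :=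
  IsStarBody K ∧ ∀ ε : ℝ, 0 < ε → ∃ K' L : Set (Euc n),
    IsStarBody K' ∧ IsStarBody L ∧ IsIntBodyOfStar n K' L ∧
    ∀ ξ ∈ sphere (0 : Euc n) 1, |radialFn K ξ - radialFn K' ξ| ≤ ε

/-- Geometric distance between star bodies. -/
def geomDist {n : ℕ} (K L : Set (Euc n)) : ℝ :=
  sInf {r : ℝ | 0 < r ∧ ∃ a : ℝ, 0 < a ∧ K ⊆ a • L ∧ a • L ⊆ r • K}

/-- Banach–Mazur distance. -/
def bmDist {n : ℕ} (K L : Set (Euc n)) : ℝ :=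
  ⨅ T : Euc n ≃ₗ[ℝ] Euc n, geomDist K (T '' L)

/-- Banach–Mazur distance from a body to a class of bodies. -/
def bmDistClass {n : ℕ} (L : Set (Euc n)) (P : Set (Euc n) → Prop) : ℝ :=
  sInf {r : ℝ | ∃ K, P K ∧ r = bmDist L K}

/-- Volume of the unit Euclidean ball `B_2^k` in `ℝ^k`. -/
def ballVol (k : ℕ) : ℝ := (volume (ball (0 : Euc k) 1)).toReal

/-- The constant `c_{n,m} = |B_2^n|^{(n-m)/n} / |B_2^{n-m}|`. -/
def cnm (n m : ℕ) : ℝ := ballVol n ^ (((n : ℝ) - m) / n) / ballVol (n - m)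

/-- The space `(ℝⁿ, N)` embeds in `L_{-p}`, `0 < p < n`. -/
def EmbedsInLNeg (n : ℕ) (p : ℝ) (N : Euc n → ℝ) : Prop :=
  ∃ μ : Measure (sphere (0 : Euc n) 1), IsFiniteMeasure μ ∧
    ∀ φ : SchwartzMap (Euc n) ℂ, (∀ x, φ (-x) = φ x) →
      (∫ x : Euc n, (N x ^ (-p)) • φ x) =
        ∫ θ : sphere (0 : Euc n) 1,
          (∫ t : ℝ, |t| ^ (p - 1) • 𝓕 (⇑φ) (t • (θ : Euc n))) ∂μ

/-- The space `(ℝⁿ, N)` embeds in `L_q`, `q > 0`: Lévy's representation of the norm. -/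
def EmbedsInLPos (n : ℕ) (q : ℝ) (N : Euc n → ℝ) : Prop :=
  ∃ μ : Measure (sphere (0 : Euc n) 1), IsFiniteMeasure μ ∧
    ∀ x : Euc n, N x ^ q = ∫ ξ : sphere (0 : Euc n) 1, |⟪x, (ξ : Euc n)⟫| ^ q ∂μ

/-- Embedding in `L_p` for `p ≠ 0` of either sign. -/
def EmbedsInL (n : ℕ) (p : ℝ) (N : Euc n → ℝ) : Prop :=
  if 0 < p then EmbedsInLPos n p N else EmbedsInLNeg n (-p) N

/-- `N` is a norm on `ℝⁿ`. -/
def IsNormOn (n : ℕ) (N : Euc n → ℝ) : Prop :=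
  (∀ x : Euc n, N x = 0 ↔ x = 0) ∧
  (∀ (c : ℝ) (x : Euc n), N (c • x) = |c| * N x) ∧
  (∀ x y : Euc n, N (x + y) ≤ N x + N y)

/-- The `L_p([0,1])` (quasi-)norm of an a.e.-equivalence class of functions on `[0,1]`. -/
def lpNormIcc (p : ℝ) (f : ℝ →ₘ[volume.restrict (Set.Icc (0 : ℝ) 1)] ℝ) : ℝ :=
  (eLpNorm f (ENNReal.ofReal p) (volume.restrict (Set.Icc (0 : ℝ) 1))).toReal

/-- `L` is the unit ball of an `n`-dimensional subspace of `L_p([0,1])`: there is an injective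
linear map `T` from `ℝⁿ` to (equivalence classes of) functions on `[0,1]` and `L` is the unit
ball of the norm `x ↦ ‖T x‖_p`. -/
def IsUnitBallOfLpSubspace (n : ℕ) (p : ℝ) (L : Set (Euc n)) : Prop :=
  ∃ T : Euc n →ₗ[ℝ] (ℝ →ₘ[volume.restrict (Set.Icc (0 : ℝ) 1)] ℝ),
    Function.Injective T ∧ L = {x : Euc n | lpNormIcc p (T x) ≤ 1}

/-- A radial gauge: a continuous positively homogeneous function that is positive off the
origin. These are exactly the Minkowski functionals of star bodies. -/
structure IsRadialGauge {E : Type*} [NormedAddCommGroup E] [NormedSpace ℝ E]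
    (N : E → ℝ) : Prop where
  continuous : Continuous N
  pos : ∀ x, x ≠ 0 → 0 < N x
  smul : ∀ (t : ℝ) (x : E), 0 ≤ t → N (t • x) = t * N x

namespace IsRadialGauge

variable {E F : Type*} [NormedAddCommGroup E] [NormedSpace ℝ E]
  [NormedAddCommGroup F] [NormedSpace ℝ F] {N N' : E → ℝ}

theorem map_zero (h : IsRadialGauge N) : N 0 = 0 := by
  simpa using h.smul 0 0 le_rfl

theorem nonneg (h : IsRadialGauge N) (x : E) : 0 ≤ N x := by
  rcases eq_or_ne x 0 with rfl | hx
  · exact h.map_zero.ge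
  · exact (h.pos x hx).le

theorem norm : IsRadialGauge (fun x : E ↦ ‖x‖) where
  continuous := continuous_norm
  pos x hx := norm_pos_iff.2 hx
  smul t x ht := by rw [norm_smul, Real.norm_of_nonneg ht]

theorem comp (h : IsRadialGauge N) (L : F →L[ℝ] E) (hL : ∀ x, L x = 0 → x = 0) :
    IsRadialGauge (fun x ↦ N (L x)) where
  continuous := h.continuous.comp L.continuous
  pos x hx := h.pos _ fun h0 ↦ hx (hL x h0)
  smul t x ht := by rw [map_smul, h.smul t _ ht]

theorem const_mul (h : IsRadialGauge N) {c : ℝ} (hc : 0 < c) :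
    IsRadialGauge (fun x ↦ c * N x) where
  continuous := h.continuous.const_mul c
  pos x hx := mul_pos hc (h.pos x hx)
  smul t x ht := by rw [h.smul t x ht]; ring

theorem exists_mul_norm_le [FiniteDimensional ℝ E] (h : IsRadialGauge N) :
    ∃ c > 0, ∀ x, c * ‖x‖ ≤ N x := by
  have key : ∃ c > 0, ∀ x ∈ sphere (0 : E) 1, c ≤ N x := by
    rcases (sphere (0 : E) 1).eq_empty_or_nonempty with he | hne
    · exact ⟨1, one_pos, by simp [he]⟩
    · obtain ⟨x, hx, hmin⟩ := (isCompact_sphere (0 : E) 1).exists_isMinOn hne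
        h.continuous.continuousOn
      exact ⟨N x, h.pos x (ne_zero_of_mem_unit_sphere ⟨x, hx⟩), fun y hy ↦ hmin hy⟩
  obtain ⟨c, hc, hcN⟩ := key
  refine ⟨c, hc, fun x ↦ ?_⟩
  rcases eq_or_ne x 0 with rfl | hx
  · simp [h.map_zero]
  · have hx' := norm_pos_iff.2 hx
    have h1 := hcN (‖x‖⁻¹ • x) (by simp [norm_smul, hx])
    rw [h.smul _ _ (by positivity), inv_mul_eq_div, le_div_iff₀ hx'] at h1
    exact h1

theorem mem_smul_sublevel (h : IsRadialGauge N) {r : ℝ} (hr : 0 < r) (x : E) :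
    x ∈ r • {y : E | N y ≤ 1} ↔ N x ≤ r := by
  rw [Set.mem_smul_set_iff_inv_smul_mem₀ hr.ne', Set.mem_ofPred_eq, h.smul _ _ (by positivity),
    inv_mul_le_iff₀ hr, mul_one]

theorem gauge_sublevel (h : IsRadialGauge N) : gauge {x : E | N x ≤ 1} = N := by
  ext x
  have : {r : ℝ | 0 < r ∧ x ∈ r • {y : E | N y ≤ 1}} = Set.Ioi 0 ∩ Set.Ici (N x) := by
    ext r
    simp only [Set.mem_ofPred_eq, Set.mem_inter_iff, Set.mem_Ioi, Set.mem_Ici]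
    exact and_congr_right fun hr ↦ h.mem_smul_sublevel hr x
  rw [gauge, this]
  rcases (h.nonneg x).eq_or_lt with h0 | h0
  · have : Set.Ioi (0 : ℝ) ∩ Set.Ici 0 = Set.Ioi 0 :=
      Set.inter_eq_left.2 fun _ h ↦ (Set.mem_Ioi.1 h).le
    rw [← h0, this, csInf_Ioi]
  · have : Set.Ioi (0 : ℝ) ∩ Set.Ici (N x) = Set.Ici (N x) :=
      Set.inter_eq_right.2 fun _ h ↦ h0.trans_le (Set.mem_Ici.1 h)
    rw [this, csInf_Ici]

theorem isStarBody {n : ℕ} {N : Euc n → ℝ} (h : IsRadialGauge N) :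
    IsStarBody {x : Euc n | N x ≤ 1} := by
  refine ⟨?_, ?_, ?_, ?_, ?_⟩
  · obtain ⟨c, hc, hcN⟩ := h.exists_mul_norm_le
    refine (isCompact_closedBall (0 : Euc n) c⁻¹).of_isClosed_subset
      (isClosed_le h.continuous continuous_const) fun x hx ↦ ?_
    rw [mem_closedBall_zero_iff, ← mul_le_mul_iff_right₀ hc, mul_inv_cancel₀ hc.ne']
    exact (hcN x).trans hx
  · refine mem_interior.2 ⟨{x | N x < 1}, fun x hx ↦ le_of_lt (Set.mem_ofPred_eq ▸ hx),
      isOpen_lt h.continuous continuous_const, ?_⟩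
    simp [h.map_zero]
  · rw [h.gauge_sublevel]; exact h.continuous
  · rw [h.gauge_sublevel]; exact fun x hx ↦ (h.pos x hx).ne'
  · rw [h.gauge_sublevel]

theorem radialFn_sublevel {n : ℕ} {N : Euc n → ℝ} (h : IsRadialGauge N) (x : Euc n) :
    radialFn {x : Euc n | N x ≤ 1} x = (N x)⁻¹ := by
  rw [radialFn, h.gauge_sublevel]

theorem _root_.IsStarBody.isRadialGauge {n : ℕ} {K : Set (Euc n)} (hK : IsStarBody K) :
    IsRadialGauge (gauge K) where
  continuous := hK.2.2.1
  pos x hx := (gauge_nonneg x).lt_of_ne' (hK.2.2.2.1 x hx)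
  smul t x ht := by rw [gauge_smul_of_nonneg ht, smul_eq_mul]

/-- The gauge whose radial function is the radial `k`-sum of two given ones. -/
theorem exists_radialSum (h : IsRadialGauge N) (h' : IsRadialGauge N') {k : ℕ} (hk : k ≠ 0) :
    ∃ M : E → ℝ, IsRadialGauge M ∧ ∀ x, (M x ^ k)⁻¹ = (N x ^ k)⁻¹ + (N' x ^ k)⁻¹ := by
  have hk' : (k : ℝ) ≠ 0 := Nat.cast_ne_zero.2 hk
  let s : E → ℝ := fun x ↦ (N x ^ k)⁻¹ + (N' x ^ k)⁻¹
  have hs0 : ∀ x, 0 ≤ s x := fun x ↦ by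
    have := h.nonneg x
    have := h'.nonneg x
    positivity
  have hspos : ∀ x, x ≠ 0 → 0 < s x := fun x hx ↦ by
    have := h.pos x hx
    have := h'.pos x hx
    positivity
  let M : E → ℝ := fun x ↦ s x ^ (-(1 / k : ℝ))
  have hMs : ∀ x, (M x ^ k)⁻¹ = s x := fun x ↦ by
    rw [← Real.rpow_natCast, ← Real.rpow_mul (hs0 x), neg_mul, one_div, inv_mul_cancel₀ hk',
      Real.rpow_neg_one, inv_inv]
  have hM0 : ∀ x, 0 ≤ M x := fun x ↦ Real.rpow_nonneg (hs0 x) _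
  have hMpos : ∀ x, x ≠ 0 → 0 < M x := fun x hx ↦ Real.rpow_pos_of_pos (hspos x hx) _
  have hs_zero : s 0 = 0 := by simp [s, h.map_zero, h'.map_zero, hk]
  have hM_zero : M 0 = 0 := by
    simp [M, hs_zero, hk]
  have hMle : ∀ x, M x ≤ N x := fun x ↦ by
    rcases eq_or_ne x 0 with rfl | hx
    · rw [hM_zero, h.map_zero]
    · refine le_of_pow_le_pow_left₀ hk (h.nonneg x) ?_
      have h1 : (N x ^ k)⁻¹ ≤ (M x ^ k)⁻¹ := by
        rw [hMs]
        have := h'.nonneg x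
        exact le_add_of_nonneg_right (by positivity)
      exact (inv_le_inv₀ (pow_pos (h.pos x hx) k) (pow_pos (hMpos x hx) k)).1 h1
  refine ⟨M, ⟨continuous_iff_continuousAt.2 fun x ↦ ?_, hMpos, fun t x ht ↦ ?_⟩, hMs⟩
  · rcases eq_or_ne x 0 with rfl | hx
    · rw [ContinuousAt, hM_zero]
      have := h.continuous.tendsto 0
      rw [h.map_zero] at this
      exact squeeze_zero hM0 hMle this
    · refine ContinuousAt.rpow_const ?_ (Or.inl (hspos x hx).ne')
      exact ((h.continuous.continuousAt.pow k).inv₀ (pow_pos (h.pos x hx) k).ne').add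
        ((h'.continuous.continuousAt.pow k).inv₀ (pow_pos (h'.pos x hx) k).ne')
  · have hst : s (t • x) = (t ^ k)⁻¹ * s x := by
      simp only [s, h.smul t x ht, h'.smul t x ht, mul_pow, mul_inv]
      ring
    simp only [M, hst]
    rw [Real.mul_rpow (by positivity) (hs0 x), Real.inv_rpow (by positivity),
      Real.rpow_neg (by positivity), inv_inv, one_div, Real.pow_rpow_inv_natCast ht hk]

end IsRadialGauge

theorem volumeIoiPow_Iic (n : ℕ) (x : Set.Ioi (0 : ℝ)) :
    Measure.volumeIoiPow n (Set.Iic x) = ENNReal.ofReal (x.1 ^ (n + 1) / (n + 1)) := by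
  have h0 : Measure.volumeIoiPow n {x} = 0 := by
    refine withDensity_absolutelyContinuous _ _ ?_
    rw [(MeasurableEmbedding.subtype_coe measurableSet_Ioi).comap_apply]
    simp
  rw [← Measure.volumeIoiPow_apply_Iio]
  refine le_antisymm ?_ (measure_mono Set.Iio_subset_Iic_self)
  rw [← Set.Iio_union_right]
  exact (measure_union_le _ _).trans (by rw [h0, add_zero])

section Polar

variable {F : Type*} [NormedAddCommGroup F] [NormedSpace ℝ F] [FiniteDimensional ℝ F]
  [MeasurableSpace F] [BorelSpace F]

/-- The volume of a star body in polar coordinates. -/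
theorem IsRadialGauge.finrank_mul_addHaar_sublevel [Nontrivial F] (μ : Measure F)
    [μ.IsAddHaarMeasure] {N : F → ℝ} (h : IsRadialGauge N) :
    finrank ℝ F * μ {x | N x ≤ 1} =
      ∫⁻ θ : sphere (0 : F) 1, ENNReal.ofReal ((N θ ^ finrank ℝ F)⁻¹) ∂μ.toSphere := by
  have hd : finrank ℝ F - 1 + 1 = finrank ℝ F := Nat.sub_add_cancel finrank_pos
  have hmeas : MeasurableSet {x : F | N x ≤ 1} :=
    (isClosed_le h.continuous continuous_const).measurableSet
  let A : Set (sphere (0 : F) 1 × Set.Ioi (0 : ℝ)) := {p | p.2.1 * N p.1 ≤ 1}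
  have hA : MeasurableSet A :=
    (isClosed_le ((continuous_subtype_val.comp continuous_snd).mul
      (h.continuous.comp (continuous_subtype_val.comp continuous_fst)))
      continuous_const).measurableSet
  have h1 : μ {x | N x ≤ 1} = (μ.toSphere.prod (Measure.volumeIoiPow (finrank ℝ F - 1))) A := by
    rw [← (Measure.measurePreserving_homeomorphUnitSphereProd μ).measure_preimage
      hA.nullMeasurableSet, (MeasurableEmbedding.subtype_coe
        (measurableSet_singleton (0 : F)).compl).comap_apply]
    have : (Subtype.val '' (homeomorphUnitSphereProd F ⁻¹' A) : Set F) =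
        {x | N x ≤ 1} \ {0} := by
      ext x
      constructor
      · rintro ⟨⟨y, hy⟩, hyA, rfl⟩
        refine ⟨?_, hy⟩
        have h2 : ‖y‖ * N (‖y‖⁻¹ • y) ≤ 1 := by simpa [A] using hyA
        rwa [← h.smul _ _ (norm_nonneg y), smul_smul,
          mul_inv_cancel₀ (norm_ne_zero_iff.2 hy), one_smul] at h2
      · rintro ⟨hx, hx0⟩
        refine ⟨⟨x, hx0⟩, ?_, rfl⟩
        have : ‖x‖ * N (‖x‖⁻¹ • x) ≤ 1 := by
          rwa [← h.smul _ _ (norm_nonneg x), smul_smul,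
            mul_inv_cancel₀ (norm_ne_zero_iff.2 hx0), one_smul]
        simpa [A] using this
    rw [this, measure_sdiff_null (measure_singleton _)]
  rw [h1, Measure.prod_apply hA, ← lintegral_const_mul _ (measurable_measure_prodMk_left hA)]
  refine lintegral_congr fun θ ↦ ?_
  have hN : 0 < N θ := h.pos _ (ne_zero_of_mem_unit_sphere θ)
  have h2 : Prod.mk θ ⁻¹' A = Set.Iic ⟨(N θ)⁻¹, Set.mem_Ioi.2 (inv_pos.2 hN)⟩ := by
    ext r
    simp only [A, Set.mem_preimage, Set.mem_ofPred_eq, Set.mem_Iic, ← Subtype.coe_le_coe]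
    rw [le_inv_comm₀ r.2 hN, ← one_div, le_div_iff₀' r.2]
  rw [h2, volumeIoiPow_Iic, hd, ← ENNReal.ofReal_natCast, ← ENNReal.ofReal_mul (Nat.cast_nonneg _)]
  congr 1
  have : ((finrank ℝ F - 1 : ℕ) : ℝ) + 1 = finrank ℝ F := by exact_mod_cast hd
  rw [this, inv_pow]
  have : (finrank ℝ F : ℝ) ≠ 0 := Nat.cast_ne_zero.2 finrank_pos.ne'
  field_simp

end Polar

/-- A linear isometric parametrization of a subspace. -/
theorem exists_linearIsometry_range_eq {n k : ℕ} (F : Submodule ℝ (Euc n))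
    (hF : finrank ℝ F = k) :
    ∃ ι : Euc k →ₗᵢ[ℝ] Euc n, LinearMap.range ι.toLinearMap = F := by
  subst hF
  refine ⟨F.subtypeₗᵢ.comp (stdOrthonormalBasis ℝ F).repr.symm.toLinearIsometry, ?_⟩
  ext x
  constructor
  · rintro ⟨y, rfl⟩
    exact ((stdOrthonormalBasis ℝ F).repr.symm y).2
  · intro hx
    exact ⟨(stdOrthonormalBasis ℝ F).repr ⟨x, hx⟩, by simp⟩

theorem hausdorffMeasure_range_inter {n k : ℕ} (ι : Euc k →ₗᵢ[ℝ] Euc n) {d : ℝ} (hd : 0 ≤ d)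
    (D : Set (Euc n)) :
    μH[d] ((LinearMap.range ι.toLinearMap : Set (Euc n)) ∩ D) = μH[d] (ι ⁻¹' D) := by
  rw [← ι.isometry.hausdorffMeasure_image (Or.inl hd), Set.image_preimage_eq_inter_range,
    Set.inter_comm]
  rfl

theorem IsRadialGauge.hausdorffMeasure_section {n k : ℕ} (hk : k ≠ 0) {N : Euc n → ℝ}
    (h : IsRadialGauge N) (ι : Euc k →ₗᵢ[ℝ] Euc n) :
    k * μH[(k : ℝ)] ((LinearMap.range ι.toLinearMap : Set (Euc n)) ∩ {x | N x ≤ 1}) =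
      ∫⁻ θ : sphere (0 : Euc k) 1, ENNReal.ofReal ((N (ι θ) ^ k)⁻¹)
        ∂(μH[(k : ℝ)] : Measure (Euc k)).toSphere := by
  have : NeZero k := ⟨hk⟩
  have : Nontrivial (Euc k) := Module.nontrivial_of_finrank_pos (R := ℝ) (by simp; omega)
  have h1 := (h.comp ι.toContinuousLinearMap fun x hx ↦
    (map_eq_zero_iff ι ι.injective).1 hx).finrank_mul_addHaar_sublevel μH[(k : ℝ)]
  rw [hausdorffMeasure_range_inter ι (Nat.cast_nonneg k)]
  simpa using h1

theorem hausdorffMeasure_section_radialSum {n k : ℕ} (hk : k ≠ 0) {N N' M : Euc n → ℝ}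
    (h : IsRadialGauge N) (h' : IsRadialGauge N') (hM : IsRadialGauge M)
    (hsum : ∀ x, (M x ^ k)⁻¹ = (N x ^ k)⁻¹ + (N' x ^ k)⁻¹)
    (F : Submodule ℝ (Euc n)) (hF : finrank ℝ F = k) :
    μH[(k : ℝ)] ((F : Set (Euc n)) ∩ {x | M x ≤ 1}) =
      μH[(k : ℝ)] ((F : Set (Euc n)) ∩ {x | N x ≤ 1}) +
        μH[(k : ℝ)] ((F : Set (Euc n)) ∩ {x | N' x ≤ 1}) := by
  obtain ⟨ι, rfl⟩ := exists_linearIsometry_range_eq F hF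
  have hk' : (k : ℝ≥0∞) ≠ 0 := by exact_mod_cast hk
  rw [← ENNReal.mul_right_inj hk' (ENNReal.natCast_ne_top k), mul_add,
    h.hausdorffMeasure_section hk, h'.hausdorffMeasure_section hk, hM.hausdorffMeasure_section hk,
    ← lintegral_add_left]
  · refine lintegral_congr fun θ ↦ ?_
    have := h.nonneg (ι θ)
    have := h'.nonneg (ι θ)
    rw [hsum, ENNReal.ofReal_add (by positivity) (by positivity)]
  · exact ((h.continuous.measurable.comp
      (ι.continuous.measurable.comp measurable_subtype_coe)).pow_const k).inv.ennreal_ofReal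

theorem hausdorffMeasure_section_const_mul {n k : ℕ} (hk : k ≠ 0) {N : Euc n → ℝ}
    (h : IsRadialGauge N) {c : ℝ} (hc : 0 < c)
    (F : Submodule ℝ (Euc n)) (hF : finrank ℝ F = k) :
    μH[(k : ℝ)] ((F : Set (Euc n)) ∩ {x | c * N x ≤ 1}) =
      ENNReal.ofReal ((c ^ k)⁻¹) * μH[(k : ℝ)] ((F : Set (Euc n)) ∩ {x | N x ≤ 1}) := by
  obtain ⟨ι, rfl⟩ := exists_linearIsometry_range_eq F hF
  have hk' : (k : ℝ≥0∞) ≠ 0 := by exact_mod_cast hk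
  rw [← ENNReal.mul_right_inj hk' (ENNReal.natCast_ne_top k), mul_left_comm,
    h.hausdorffMeasure_section hk, (h.const_mul hc).hausdorffMeasure_section hk,
    ← lintegral_const_mul]
  · refine lintegral_congr fun θ ↦ ?_
    rw [mul_pow, mul_inv, ENNReal.ofReal_mul (by positivity)]
  · exact ((h.continuous.measurable.comp
      (ι.continuous.measurable.comp measurable_subtype_coe)).pow_const k).inv.ennreal_ofReal

open Matrix in
theorem Matrix.det_toBlocks₁₁_of_mul_eq_one {ι κ R : Type*} [CommRing R] [Fintype ι] [Fintype κ]
    [DecidableEq ι] [DecidableEq κ] {G G' : Matrix (ι ⊕ κ) (ι ⊕ κ) R} (h : G * G' = 1) :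
    G.toBlocks₁₁.det = G.det * G'.toBlocks₂₂.det := by
  have h' := h
  rw [← fromBlocks_toBlocks G, ← fromBlocks_toBlocks G', fromBlocks_multiply,
    ← fromBlocks_one, fromBlocks_inj] at h'
  have h1 : G * fromBlocks 1 G'.toBlocks₁₂ 0 G'.toBlocks₂₂ =
      fromBlocks G.toBlocks₁₁ 0 G.toBlocks₂₁ 1 := by
    conv_lhs => rw [← fromBlocks_toBlocks G]
    rw [fromBlocks_multiply]
    simp [h'.2.1, h'.2.2.2]
  have h2 := congrArg det h1
  rw [det_mul, det_fromBlocks_zero₂₁, det_fromBlocks_zero₁₂] at h2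
  simpa using h2.symm

/-- The volume of the preimage of the unit ball under an injective linear map. -/
theorem hausdorffMeasure_preimage_closedBall {n k : ℕ} (J : Euc k →ₗ[ℝ] Euc n)
    (hJ : Function.Injective J) :
    0 < (Matrix.of fun i j ↦ ⟪J (EuclideanSpace.basisFun (Fin k) ℝ i),
        J (EuclideanSpace.basisFun (Fin k) ℝ j)⟫).det ∧
      μH[(k : ℝ)] {u | ‖J u‖ ≤ 1} =
        ENNReal.ofReal (√(Matrix.of fun i j ↦ ⟪J (EuclideanSpace.basisFun (Fin k) ℝ i),
          J (EuclideanSpace.basisFun (Fin k) ℝ j)⟫).det)⁻¹ *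
          μH[(k : ℝ)] (closedBall (0 : Euc k) 1) := by
  obtain ⟨ι, hι⟩ := exists_linearIsometry_range_eq (k := k) (LinearMap.range J)
    ((LinearMap.finrank_range_of_inj hJ).trans (by simp))
  have hmem : ∀ u, ∃ v, ι v = J u := fun u ↦ by
    have : J u ∈ LinearMap.range ι.toLinearMap := by
      rw [hι]
      exact LinearMap.mem_range_self J u
    exact this
  choose f hf using hmem
  let T : Euc k →ₗ[ℝ] Euc k :=
    { toFun := f
      map_add' := fun x y ↦ ι.injective (by simp [hf])
      map_smul' := fun c x ↦ ι.injective (by simp [hf]) }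
  have hT : ∀ u, ι (T u) = J u := hf
  have hTinj : Function.Injective T := fun x y hxy ↦ hJ (by rw [← hT, ← hT, hxy])
  have hdet : LinearMap.det T ≠ 0 := by
    rw [← isUnit_iff_ne_zero]
    exact (LinearEquiv.ofInjectiveEndo T hTinj).isUnit_det'
  let b := EuclideanSpace.basisFun (Fin k) ℝ
  have hG : (Matrix.of fun i j ↦ ⟪J (b i), J (b j)⟫) =
      (LinearMap.toMatrix b.toBasis b.toBasis T).transpose *
        LinearMap.toMatrix b.toBasis b.toBasis T := by
    ext i j
    simp only [Matrix.of_apply, ← hT, ι.inner_map_map, Matrix.mul_apply, Matrix.transpose_apply,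
      LinearMap.toMatrix_apply, OrthonormalBasis.coe_toBasis,
      OrthonormalBasis.coe_toBasis_repr_apply,
      b.repr_apply_apply]
    rw [← b.sum_inner_mul_inner]
    exact Finset.sum_congr rfl fun l _ ↦ by rw [real_inner_comm]
  have hGdet : (Matrix.of fun i j ↦ ⟪J (b i), J (b j)⟫).det = LinearMap.det T ^ 2 := by
    rw [hG, Matrix.det_mul, Matrix.det_transpose, LinearMap.det_toMatrix, sq]
  refine ⟨hGdet ▸ by positivity, ?_⟩
  have hset : {u | ‖J u‖ ≤ 1} = T ⁻¹' closedBall 0 1 := by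
    ext u
    simp [← hT]
  rw [hset, Measure.addHaar_preimage_linearMap _ hdet]
  change _ = ENNReal.ofReal (√(Matrix.of fun i j ↦ ⟪J (b i), J (b j)⟫).det)⁻¹ * _
  rw [hGdet, Real.sqrt_sq_eq_abs, abs_inv]

/-- Sections of an ellipsoid and of its polar by orthogonal subspaces have proportional volumes. -/
theorem exists_hausdorffMeasure_section_ellipsoid {n m : ℕ} (hmn : m ≤ n)
    (B B' : Euc n →ₗ[ℝ] Euc n) (hB : ∀ x y, ⟪B x, B' y⟫ = ⟪x, y⟫) :
    ∃ c : ℝ, 0 < c ∧ ∀ H : Submodule ℝ (Euc n), finrank ℝ H = n - m →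
      μH[(m : ℝ)] ((Hᗮ : Set (Euc n)) ∩ {x | ‖B x‖ ≤ 1}) =
        ENNReal.ofReal c * μH[((n - m : ℕ) : ℝ)] ((H : Set (Euc n)) ∩ {x | ‖B' x‖ ≤ 1}) := by
  have hinj : Function.Injective B := (injective_iff_map_eq_zero B).2 fun x hx ↦ by
    have := hB x x
    rwa [hx, inner_zero_left, eq_comm, inner_self_eq_zero] at this
  have hinj' : Function.Injective B' := (injective_iff_map_eq_zero B').2 fun x hx ↦ by
    have := hB x x
    rwa [hx, inner_zero_right, eq_comm, inner_self_eq_zero] at this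
  have hdet : LinearMap.det B ≠ 0 := by
    rw [← isUnit_iff_ne_zero]
    exact (LinearEquiv.ofInjectiveEndo B hinj).isUnit_det'
  let ω (k : ℕ) : ℝ := (μH[(k : ℝ)] (closedBall (0 : Euc k) 1)).toReal
  have hω (k : ℕ) : μH[(k : ℝ)] (closedBall (0 : Euc k) 1) = ENNReal.ofReal (ω k) :=
    (ENNReal.ofReal_toReal (measure_closedBall_lt_top).ne).symm
  have hω0 (k : ℕ) : 0 < ω k := ENNReal.toReal_pos
    (measure_closedBall_pos _ _ one_pos).ne' (measure_closedBall_lt_top).ne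
  refine ⟨|LinearMap.det B|⁻¹ * (ω m / ω (n - m)), by
    have := hω0 m; have := hω0 (n - m); positivity, fun H hH ↦ ?_⟩
  have hH' : finrank ℝ Hᗮ = m := by
    have := H.finrank_add_finrank_orthogonal
    simp at this
    omega
  obtain ⟨ι, hι⟩ := exists_linearIsometry_range_eq Hᗮ hH'
  obtain ⟨κ, hκ⟩ := exists_linearIsometry_range_eq H hH
  let v : Fin m ⊕ Fin (n - m) → Euc n := Sum.elim
    (fun i ↦ ι (EuclideanSpace.basisFun (Fin m) ℝ i))
    (fun i ↦ κ (EuclideanSpace.basisFun (Fin (n - m)) ℝ i))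
  have hιmem : ∀ u, ι u ∈ Hᗮ := fun u ↦ hι ▸ ⟨u, rfl⟩
  have hκmem : ∀ u, κ u ∈ H := fun u ↦ hκ ▸ ⟨u, rfl⟩
  have hv : Orthonormal ℝ v := by
    rw [orthonormal_iff_ite]
    rintro (i | i) (j | j)
    · simp only [v, Sum.elim_inl, ι.inner_map_map, Sum.inl.injEq]
      exact orthonormal_iff_ite.1 (EuclideanSpace.basisFun (Fin m) ℝ).orthonormal i j
    · simpa [v] using Submodule.inner_left_of_mem_orthogonal (hκmem _) (hιmem _)
    · simpa [v] using Submodule.inner_right_of_mem_orthogonal (hκmem _) (hιmem _)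
    · simp only [v, Sum.elim_inr, κ.inner_map_map, Sum.inr.injEq]
      exact orthonormal_iff_ite.1 (EuclideanSpace.basisFun (Fin (n - m)) ℝ).orthonormal i j
  let b : OrthonormalBasis (Fin m ⊕ Fin (n - m)) ℝ (Euc n) :=
    (basisOfLinearIndependentOfCardEqFinrank' v hv.linearIndependent
      (by simp; omega)).toOrthonormalBasis (by simpa using hv)
  have hb : ∀ i, b i = v i := fun i ↦ by simp [b]
  let G : Matrix (Fin m ⊕ Fin (n - m)) (Fin m ⊕ Fin (n - m)) ℝ :=
    Matrix.of fun i j ↦ ⟪B (b i), B (b j)⟫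
  let G' : Matrix (Fin m ⊕ Fin (n - m)) (Fin m ⊕ Fin (n - m)) ℝ :=
    Matrix.of fun i j ↦ ⟪B' (b i), B' (b j)⟫
  have hadj : LinearMap.adjoint B' ∘ₗ B = LinearMap.id := by
    refine LinearMap.ext fun x ↦ ext_inner_right ℝ fun y ↦ ?_
    simp [LinearMap.adjoint_inner_left, hB]
  have hadj' : B ∘ₗ LinearMap.adjoint B' = LinearMap.id :=
    (mul_eq_one_comm (M := Module.End ℝ (Euc n))).1 hadj
  have hGG' : G * G' = 1 := by
    ext i j
    have h1 : ∀ x y, ∑ l, ⟪x, B (b l)⟫ * ⟪B' (b l), y⟫ = ⟪x, y⟫ := fun x y ↦ by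
      simp_rw [← LinearMap.adjoint_inner_left B, ← LinearMap.adjoint_inner_right B']
      rw [b.sum_inner_mul_inner, LinearMap.adjoint_inner_left, ← LinearMap.comp_apply, hadj',
        LinearMap.id_apply]
    rw [Matrix.mul_apply, Matrix.one_apply]
    simp only [G, G', Matrix.of_apply]
    rw [h1, hB, orthonormal_iff_ite.1 b.orthonormal]
  have hG : G = (LinearMap.toMatrix b.toBasis b.toBasis B).transpose *
        LinearMap.toMatrix b.toBasis b.toBasis B := by
    ext i j
    simp only [G, Matrix.of_apply, Matrix.mul_apply, Matrix.transpose_apply,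
      LinearMap.toMatrix_apply, OrthonormalBasis.coe_toBasis,
      OrthonormalBasis.coe_toBasis_repr_apply, b.repr_apply_apply]
    rw [← b.sum_inner_mul_inner]
    exact Finset.sum_congr rfl fun l _ ↦ by rw [real_inner_comm]
  have hGdet : G.det = LinearMap.det B ^ 2 := by
    rw [hG, Matrix.det_mul, Matrix.det_transpose, LinearMap.det_toMatrix, sq]
  have hblocks := Matrix.det_toBlocks₁₁_of_mul_eq_one hGG'
  obtain ⟨p1, e1⟩ := hausdorffMeasure_preimage_closedBall (B ∘ₗ ι.toLinearMap)
    (hinj.comp ι.injective)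
  obtain ⟨p2, e2⟩ := hausdorffMeasure_preimage_closedBall (B' ∘ₗ κ.toLinearMap)
    (hinj'.comp κ.injective)
  have g1 : (Matrix.of fun i j ↦ ⟪(B ∘ₗ ι.toLinearMap) (EuclideanSpace.basisFun (Fin m) ℝ i),
      (B ∘ₗ ι.toLinearMap) (EuclideanSpace.basisFun (Fin m) ℝ j)⟫) = G.toBlocks₁₁ := by
    ext i j
    simp [G, Matrix.toBlocks₁₁, hb, v]
  have g2 : (Matrix.of fun i j ↦
      ⟪(B' ∘ₗ κ.toLinearMap) (EuclideanSpace.basisFun (Fin (n - m)) ℝ i),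
      (B' ∘ₗ κ.toLinearMap) (EuclideanSpace.basisFun (Fin (n - m)) ℝ j)⟫) = G'.toBlocks₂₂ := by
    ext i j
    simp [G', Matrix.toBlocks₂₂, hb, v]
  rw [g1] at p1 e1
  rw [g2] at p2 e2
  rw [← hι, hausdorffMeasure_range_inter ι (Nat.cast_nonneg m), ← hκ,
    hausdorffMeasure_range_inter κ (Nat.cast_nonneg _)]
  change μH[(m : ℝ)] {u | ‖(B ∘ₗ ι.toLinearMap) u‖ ≤ 1} = _ *
    μH[((n - m : ℕ) : ℝ)] {u | ‖(B' ∘ₗ κ.toLinearMap) u‖ ≤ 1}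
  have := hω0 m
  have := hω0 (n - m)
  rw [e1, e2, hω, hω, ← ENNReal.ofReal_mul (by positivity), ← ENNReal.ofReal_mul (by positivity),
    ← ENNReal.ofReal_mul (by positivity), hblocks, hGdet, Real.sqrt_mul (sq_nonneg _),
    Real.sqrt_sq_eq_abs]
  congr 1
  have := Real.sqrt_pos.2 p2
  field_simp

theorem exists_pos_inv_pow_eq {k : ℕ} (hk : k ≠ 0) {c : ℝ} (hc : 0 < c) :
    ∃ a : ℝ, 0 < a ∧ (a ^ k)⁻¹ = c := by
  refine ⟨(c ^ (k : ℝ)⁻¹)⁻¹, by positivity, ?_⟩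
  rw [inv_pow, inv_inv, Real.rpow_inv_natCast_pow hc.le hk]

theorem finrank_orthogonal_eq {n m : ℕ} (hmn : m ≤ n) {H : Submodule ℝ (Euc n)}
    (hH : finrank ℝ H = n - m) : finrank ℝ Hᗮ = m := by
  have := H.finrank_add_finrank_orthogonal
  rw [finrank_euclideanSpace_fin] at this
  omega

theorem isRadialGauge_norm_comp {n : ℕ} (B : Euc n →ₗ[ℝ] Euc n) (hB : ∀ x, B x = 0 → x = 0) :
    IsRadialGauge fun x ↦ ‖B x‖ :=
  IsRadialGauge.norm.comp (LinearMap.toContinuousLinearMap B) hB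

/-- The cone of the functions `ρ ^ m` on the sphere, where `ρ` is the radial function of an
`m`-intersection body of a star body. -/
def intersectionCone {n m : ℕ} (hm : m ≠ 0) (hmn : m < n) :
    ConvexCone ℝ C(sphere (0 : Euc n) 1, ℝ) where
  carrier := {p | ∃ N₁ N₂ : Euc n → ℝ, IsRadialGauge N₁ ∧ IsRadialGauge N₂ ∧
    (∀ θ, p θ = (N₁ θ ^ m)⁻¹) ∧ IsKIntBodyOf n m {x | N₁ x ≤ 1} {x | N₂ x ≤ 1}}
  smul_mem' := by
    rintro c hc p ⟨N₁, N₂, h₁, h₂, hp, hI⟩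
    obtain ⟨a, ha, hac⟩ := exists_pos_inv_pow_eq hm hc
    obtain ⟨b, hb, hbc⟩ := exists_pos_inv_pow_eq (k := n - m) (by omega) hc
    refine ⟨fun x ↦ a * N₁ x, fun x ↦ b * N₂ x, h₁.const_mul ha, h₂.const_mul hb,
      fun θ ↦ ?_, fun H hH ↦ ?_⟩
    · rw [ContinuousMap.smul_apply, hp, mul_pow, mul_inv, hac, smul_eq_mul]
    · rw [hausdorffMeasure_section_const_mul hm h₁ ha _ (finrank_orthogonal_eq hmn.le hH),
        hausdorffMeasure_section_const_mul (by omega) h₂ hb _ hH, hac, hbc, hI H hH]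
  add_mem' := by
    rintro p ⟨N₁, N₂, h₁, h₂, hp, hI⟩ p' ⟨N₁', N₂', h₁', h₂', hp', hI'⟩
    obtain ⟨M₁, hM₁, hs₁⟩ := h₁.exists_radialSum h₁' hm
    obtain ⟨M₂, hM₂, hs₂⟩ := h₂.exists_radialSum h₂' (k := n - m) (by omega)
    refine ⟨M₁, M₂, hM₁, hM₂, fun θ ↦ ?_, fun H hH ↦ ?_⟩
    · rw [ContinuousMap.add_apply, hp, hp', hs₁]
    · rw [hausdorffMeasure_section_radialSum hm h₁ h₁' hM₁ hs₁ _ (finrank_orthogonal_eq hmn.le hH),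
        hausdorffMeasure_section_radialSum (by omega) h₂ h₂' hM₂ hs₂ _ hH, hI H hH, hI' H hH]

/-- Ellipsoids are intersection bodies of star bodies. -/
theorem ellipsoid_mem_intersectionCone {n m : ℕ} (hm : m ≠ 0) (hmn : m < n)
    (B : Euc n →ₗ[ℝ] Euc n) (hB : ∀ x, B x = 0 → x = 0)
    (p : C(sphere (0 : Euc n) 1, ℝ)) (hp : ∀ θ, p θ = (‖B θ‖ ^ m)⁻¹) :
    p ∈ intersectionCone hm hmn := by
  have hinj : Function.Injective B := (injective_iff_map_eq_zero B).2 hB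
  let e := LinearEquiv.ofInjectiveEndo B hinj
  have he : ∀ x, e x = B x := fun x ↦ rfl
  let B' : Euc n →ₗ[ℝ] Euc n := LinearMap.adjoint e.symm.toLinearMap
  have hBB' : ∀ x y, ⟪B x, B' y⟫ = ⟪x, y⟫ := fun x y ↦ by
    rw [LinearMap.adjoint_inner_right, ← he]
    simp
  have hB' : ∀ x, B' x = 0 → x = 0 := fun x hx ↦ by
    have := hBB' x x
    rwa [hx, inner_zero_right, eq_comm, inner_self_eq_zero] at this
  obtain ⟨c, hc, hcH⟩ := exists_hausdorffMeasure_section_ellipsoid hmn.le B B' hBB'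
  obtain ⟨a, ha, hac⟩ := exists_pos_inv_pow_eq (k := n - m) (by omega) hc
  refine ⟨fun x ↦ ‖B x‖, fun x ↦ a * ‖B' x‖, isRadialGauge_norm_comp B hB,
    (isRadialGauge_norm_comp B' hB').const_mul ha, hp, fun H hH ↦ ?_⟩
  rw [hausdorffMeasure_section_const_mul (by omega) (isRadialGauge_norm_comp B' hB') ha _ hH, hac,
    hcH H hH]

/-- A point outside the closure of a nonempty convex cone is separated from it by a linear
functional. -/
theorem ConvexCone.exists_nonneg_of_notMem_closure {V : Type*} [NormedAddCommGroup V]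
    [NormedSpace ℝ V] (C : ConvexCone ℝ V) (hC : (C : Set V).Nonempty) {p : V}
    (hp : p ∉ closure (C : Set V)) :
    ∃ Λ : V →L[ℝ] ℝ, Λ p < 0 ∧ ∀ q ∈ C, 0 ≤ Λ q := by
  obtain ⟨Λ, u, h1, h2⟩ := geometric_hahn_banach_point_closed C.convex.closure isClosed_closure hp
  have h3 : ∀ q ∈ C, ∀ t : ℝ, 0 < t → u < t * Λ q := fun q hq t ht ↦ by
    simpa using h2 _ (subset_closure (C.smul_mem ht hq))
  refine ⟨Λ, ?_, fun q hq ↦ ?_⟩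
  · obtain ⟨q, hq⟩ := hC
    refine lt_of_lt_of_le h1 (le_of_forall_pos_lt_add fun ε hε ↦ ?_)
    have h4 := h3 q hq (ε / (|Λ q| + 1)) (by positivity)
    refine h4.trans ?_
    rw [zero_add, div_mul_eq_mul_div, div_lt_iff₀ (by positivity)]
    gcongr
    exact (le_abs_self _).trans_lt (lt_add_one _)
  · by_contra! hneg
    have h4 := h3 q hq ((|u| + 1) / (-Λ q)) (by have := neg_pos.2 hneg; positivity)
    have : (|u| + 1) / (-Λ q) * Λ q = -(|u| + 1) := by
      have := hneg.ne
      field_simp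
    rw [this] at h4
    linarith [neg_abs_le u]

section InvariantMeasure

variable {X : Type*} [MetricSpace X] [CompactSpace X] [MeasurableSpace X] [BorelSpace X]

/-- Two finite measures on a compact metric space which are invariant under a transitive family of
isometries are proportional. -/
theorem integral_mul_measureReal_univ_of_isometry_invariant (σ τ : Measure X) [IsFiniteMeasure σ]
    [IsFiniteMeasure τ] [τ.IsOpenPosMeasure]
    (h : ∀ x y : X, ∃ e : X ≃ᵢ X, e x = y ∧ σ.map e = σ ∧ τ.map e = τ) (f : C(X, ℝ)) :
    τ.real Set.univ * ∫ x, f x ∂σ = σ.real Set.univ * ∫ x, f x ∂τ := by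
  rcases isEmpty_or_nonempty X with hX | ⟨⟨x₀⟩⟩
  · simp [Measure.eq_zero_of_isEmpty σ, Measure.eq_zero_of_isEmpty τ]
  have hint : ∀ (μ ν : Measure X) [IsFiniteMeasure μ] [IsFiniteMeasure ν] (F : X × X → ℝ),
      Continuous F → Integrable F (μ.prod ν) := fun μ ν _ _ F hF ↦
    BoundedContinuousFunction.integrable _ (BoundedContinuousFunction.mkOfCompact ⟨F, hF⟩)
  refine eq_of_abs_sub_nonpos (le_of_forall_pos_lt_add fun ε hε ↦ ?_)
  set a := σ.real Set.univ
  set b := τ.real Set.univ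
  have ha : 0 ≤ a := measureReal_nonneg
  have hb : 0 ≤ b := measureReal_nonneg
  let η : ℝ := ε / (a * b + 1)
  have hη : 0 < η := by positivity
  obtain ⟨r, hr, hrf⟩ := Metric.uniformContinuous_iff.1
    (CompactSpace.uniformContinuous_of_continuous f.continuous) η hη
  let κ : X × X → ℝ := fun p ↦ max 0 (r - dist p.1 p.2)
  have hκ : Continuous κ := by fun_prop
  have hκ0 : ∀ p, 0 ≤ κ p := fun p ↦ le_max_left _ _
  have hconst : ∀ (μ : Measure X), (∀ x y : X, ∃ e : X ≃ᵢ X, e x = y ∧ μ.map e = μ) →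
      ∀ x, ∫ y, κ (x, y) ∂μ = ∫ y, κ (x₀, y) ∂μ := fun μ hμ x ↦ by
    obtain ⟨e, he, hmap⟩ := hμ x₀ x
    conv_lhs => rw [← hmap]
    rw [(show MeasurableEmbedding e from e.toHomeomorph.measurableEmbedding).integral_map]
    simp [κ, ← he, e.dist_eq]
  have hσ := hconst σ fun x y ↦ (h x y).imp fun e he ↦ ⟨he.1, he.2.1⟩
  have hτ := hconst τ fun x y ↦ (h x y).imp fun e he ↦ ⟨he.1, he.2.2⟩
  set s := ∫ y, κ (x₀, y) ∂σ
  set t := ∫ y, κ (x₀, y) ∂τ with ht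
  have hsymm : ∀ x y, κ (x, y) = κ (y, x) := fun x y ↦ by simp [κ, dist_comm]
  have ht0 : 0 < t := by
    have hc : Continuous fun y ↦ κ (x₀, y) := by fun_prop
    refine hc.integral_pos_of_hasCompactSupport_nonneg_nonzero
      (HasCompactSupport.of_compactSpace _) (fun y ↦ hκ0 _) (x := x₀) ?_
    simp [κ, hr.ne', max_eq_right hr.le]
  have hst : s * b = t * a := by
    have h1 : ∫ x, ∫ y, κ (x, y) ∂τ ∂σ = t * a := by simp [hτ, a, mul_comm]
    have h2 : ∫ y, ∫ x, κ (x, y) ∂σ ∂τ = s * b := by simp [hsymm _, hσ, b, mul_comm]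
    rw [← h1, ← h2, ← integral_integral_swap (hint σ τ κ hκ)]
  have hA : ∫ x, ∫ y, κ (x, y) * f x ∂τ ∂σ = t * ∫ x, f x ∂σ := by
    simp [integral_mul_const, hτ, integral_const_mul]
  have hB : ∫ x, ∫ y, κ (x, y) * f y ∂τ ∂σ = s * ∫ x, f x ∂τ := by
    rw [integral_integral_swap (hint σ τ (fun p ↦ κ p * f p.2) (by fun_prop))]
    simp [integral_mul_const, hsymm _, hσ, integral_const_mul]
  have hdiff : |t * ∫ x, f x ∂σ - s * ∫ x, f x ∂τ| ≤ η * (t * a) := by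
    rw [← hA, ← hB, integral_integral (hint σ τ (fun p ↦ κ p * f p.1) (by fun_prop)),
      integral_integral (hint σ τ (fun p ↦ κ p * f p.2) (by fun_prop)),
      ← integral_sub (hint σ τ (fun p ↦ κ p * f p.1) (by fun_prop))
        (hint σ τ (fun p ↦ κ p * f p.2) (by fun_prop))]
    have h1 : η * (t * a) = ∫ p, η * κ p ∂(σ.prod τ) := by
      rw [integral_const_mul, integral_prod _ (hint σ τ κ hκ)]
      simp [hτ, a, mul_comm]
    rw [h1]
    rw [← Real.norm_eq_abs]
    refine norm_integral_le_of_norm_le ((hint σ τ κ hκ).const_mul η) (.of_forall fun p ↦ ?_)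
    rw [← mul_sub, norm_mul, Real.norm_of_nonneg (hκ0 p), mul_comm]
    rcases lt_or_ge (dist p.1 p.2) r with hp | hp
    · exact mul_le_mul_of_nonneg_right (by simpa [Real.dist_eq] using (hrf hp).le) (hκ0 p)
    · simp [κ, max_eq_left (sub_nonpos.2 hp)]
  have hfin : |b * ∫ x, f x ∂σ - a * ∫ x, f x ∂τ| ≤ η * (a * b) := by
    have h1 : t * (b * ∫ x, f x ∂σ - a * ∫ x, f x ∂τ) =
        b * (t * ∫ x, f x ∂σ - s * ∫ x, f x ∂τ) := by
      linear_combination (∫ x, f x ∂τ) * hst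
    have h2 : t * |b * ∫ x, f x ∂σ - a * ∫ x, f x ∂τ| ≤ t * (η * (a * b)) := by
      rw [← abs_of_pos ht0, ← abs_mul, abs_of_pos ht0, h1, abs_mul, abs_of_nonneg hb]
      refine (mul_le_mul_of_nonneg_left hdiff hb).trans_eq (by ring)
    exact le_of_mul_le_mul_left h2 ht0
  refine hfin.trans_lt ?_
  rw [zero_add]
  simp only [η]
  rw [div_mul_eq_mul_div, div_lt_iff₀ (by positivity)]
  nlinarith

end InvariantMeasure

section Sphere

variable {E : Type*} [NormedAddCommGroup E] [InnerProductSpace ℝ E] [FiniteDimensional ℝ E]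
  [MeasurableSpace E] [BorelSpace E]

/-- The isometry of the unit sphere induced by a linear isometry. -/
def LinearIsometryEquiv.sphereIsometryEquiv (e : E ≃ₗᵢ[ℝ] E) :
    sphere (0 : E) 1 ≃ᵢ sphere (0 : E) 1 where
  toFun x := ⟨e x, by simp⟩
  invFun x := ⟨e.symm x, by simp⟩
  left_inv x := by simp
  right_inv x := by simp
  isometry_toFun := Isometry.of_dist_eq fun x y ↦ by simp [Subtype.dist_eq]

theorem LinearIsometryEquiv.map_toSphere (e : E ≃ₗᵢ[ℝ] E) :
    (volume : Measure E).toSphere.map e.sphereIsometryEquiv = (volume : Measure E).toSphere := by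
  have hme : Measurable e.sphereIsometryEquiv := e.sphereIsometryEquiv.continuous.measurable
  ext A hA
  rw [Measure.map_apply hme hA, Measure.toSphere_apply' _ (hme hA), Measure.toSphere_apply' _ hA]
  congr 1
  conv_rhs =>
    rw [← e.measurePreserving.measure_preimage_equiv (f := e.toHomeomorph.toMeasurableEquiv)]

  congr 1
  ext x
  simp only [Set.mem_smul, Set.mem_image, Set.mem_preimage]
  constructor
  · rintro ⟨r, hr, y, ⟨z, hz, rfl⟩, rfl⟩
    exact ⟨r, hr, _, ⟨_, hz, rfl⟩, (e.map_smul r z).symm⟩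
  · rintro ⟨r, hr, y, ⟨z, hz, rfl⟩, h⟩
    refine ⟨r, hr, e.symm z, ⟨e.sphereIsometryEquiv.symm z, by simpa using hz, rfl⟩, ?_⟩
    apply e.injective
    rw [e.map_smul, e.apply_symm_apply]
    exact h

end Sphere

theorem exists_sphereIsometryEquiv_apply_eq {E : Type*} [NormedAddCommGroup E]
    [InnerProductSpace ℝ E] (x y : sphere (0 : E) 1) :
    ∃ e : E ≃ₗᵢ[ℝ] E, e.sphereIsometryEquiv x = y :=
  ⟨Submodule.reflection (ℝ ∙ ((x : E) - y))ᗮ, Subtype.ext (Submodule.reflection_sub (by simp))⟩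

theorem norm_inv_norm_smul_sub_le {F : Type*} [NormedAddCommGroup F] [NormedSpace ℝ F] {x y : F}
    (hx : 1 ≤ ‖x‖) (hy : 1 ≤ ‖y‖) : ‖‖x‖⁻¹ • x - ‖y‖⁻¹ • y‖ ≤ 2 * ‖x - y‖ := by
  have hx0 : 0 < ‖x‖ := by linarith
  have hy0 : 0 < ‖y‖ := by linarith
  have h1 : ‖x‖⁻¹ • x - ‖y‖⁻¹ • y = ‖x‖⁻¹ • (x - y) + (‖x‖⁻¹ - ‖y‖⁻¹) • y := by module
  have h2 : |‖x‖⁻¹ - ‖y‖⁻¹| * ‖y‖ ≤ ‖x‖⁻¹ * ‖x - y‖ := by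
    have h3 : ‖x‖⁻¹ - ‖y‖⁻¹ = ‖x‖⁻¹ * ‖y‖⁻¹ * (‖y‖ - ‖x‖) := by field_simp
    rw [h3, abs_mul, abs_of_pos (by positivity : 0 < ‖x‖⁻¹ * ‖y‖⁻¹), abs_sub_comm]
    calc ‖x‖⁻¹ * ‖y‖⁻¹ * |‖x‖ - ‖y‖| * ‖y‖ = ‖x‖⁻¹ * |‖x‖ - ‖y‖| := by field_simp
      _ ≤ _ := by gcongr; exact abs_norm_sub_norm_le x y
  have h4 : ‖x‖⁻¹ * ‖x - y‖ ≤ ‖x - y‖ :=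
    mul_le_of_le_one_left (norm_nonneg _) (inv_le_one_of_one_le₀ hx)
  rw [h1]
  refine (norm_add_le _ _).trans ?_
  rw [norm_smul, norm_smul, norm_inv, norm_norm, Real.norm_eq_abs]
  linarith

theorem finrank_orthogonal_span_singleton_add_one {E : Type*} [NormedAddCommGroup E]
    [InnerProductSpace ℝ E] [FiniteDimensional ℝ E] {v : E} (hv : v ≠ 0) :
    (finrank ℝ (ℝ ∙ v)ᗮ : ℝ) = (finrank ℝ E : ℝ) - 1 := by
  have := (ℝ ∙ v).finrank_add_finrank_orthogonal
  rw [finrank_span_singleton hv] at this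
  rw [← this]
  push_cast
  ring

section SphereMeasure

variable {E : Type*} [NormedAddCommGroup E] [InnerProductSpace ℝ E] [FiniteDimensional ℝ E]
  [MeasurableSpace E] [BorelSpace E]

theorem hausdorffMeasure_sphere_lt_top :
    μH[(finrank ℝ E : ℝ) - 1] (sphere (0 : E) 1) < ∞ := by
  refine (isCompact_sphere (0 : E) 1).measure_lt_top_of_nhdsWithin fun v hv ↦ ?_
  have hv1 : ‖v‖ = 1 := by simpa using hv
  have hv0 : v ≠ 0 := norm_ne_zero_iff.1 (by rw [hv1]; exact one_ne_zero)
  let V := (ℝ ∙ v)ᗮ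
  let A : Set E := {u | 1 / 2 < ⟪v, u⟫}
  have hA : A ∈ nhds v := (isOpen_lt continuous_const (by fun_prop)).mem_nhds (by
    simp [hv1]; norm_num)
  refine ⟨A ∩ sphere 0 1, Filter.inter_mem (mem_nhdsWithin_of_mem_nhds hA) self_mem_nhdsWithin, ?_⟩
  let φ : V → E := fun y ↦ ‖v + y‖⁻¹ • (v + (y : E))
  have hvy : ∀ y : V, ⟪v, (y : E)⟫ = 0 := fun y ↦
    Submodule.mem_orthogonal_singleton_iff_inner_right.1 y.2
  have hφ1 : ∀ y : V, 1 ≤ ‖v + y‖ := fun y ↦ by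
    have h1 : ⟪v, v + (y : E)⟫ = 1 := by rw [inner_add_right, hvy]; simp [hv1]
    have h2 := real_inner_le_norm v (v + y)
    rwa [h1, hv1, one_mul] at h2
  have hφ : LipschitzOnWith 2 φ (closedBall 0 3) := LipschitzOnWith.of_dist_le_mul fun y _ z _ ↦ by
    rw [dist_eq_norm, dist_eq_norm]
    refine (norm_inv_norm_smul_sub_le (hφ1 y) (hφ1 z)).trans_eq ?_
    simp
  have hsub : A ∩ sphere 0 1 ⊆ φ '' closedBall 0 3 := by
    rintro u ⟨huA, hu⟩
    have hu1 : ‖u‖ = 1 := by simpa using hu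
    have ht : 1 / 2 < ⟪v, u⟫ := huA
    set t := ⟪v, u⟫
    have hmem : t⁻¹ • u - v ∈ V := by
      rw [Submodule.mem_orthogonal_singleton_iff_inner_right, inner_sub_right, inner_smul_right]
      rw [real_inner_self_eq_norm_sq, hv1, inv_mul_cancel₀ (by linarith : t ≠ 0)]
      norm_num
    have htu : ‖t⁻¹ • u‖ = t⁻¹ := by
      rw [norm_smul, hu1, mul_one, Real.norm_of_nonneg (by positivity)]
    refine ⟨⟨t⁻¹ • u - v, hmem⟩, ?_, ?_⟩
    · rw [mem_closedBall_zero_iff, Submodule.coe_norm]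
      refine (norm_sub_le _ _).trans ?_
      rw [htu, hv1]
      have : t⁻¹ ≤ 2 := inv_le_of_inv_le₀ (by norm_num) (by linarith)
      linarith
    · simp only [φ, add_sub_cancel]
      rw [htu, inv_inv, smul_smul, mul_inv_cancel₀ (by linarith), one_smul]
  refine (measure_mono hsub).trans_lt ?_
  rw [← finrank_orthogonal_span_singleton_add_one hv0]
  refine (hφ.hausdorffMeasure_image_le (Nat.cast_nonneg _)).trans_lt ?_
  exact ENNReal.mul_lt_top (by simp) (isCompact_closedBall _ _).measure_lt_top

theorem hausdorffMeasure_sphere_pos [Nontrivial E] :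
    0 < μH[(finrank ℝ E : ℝ) - 1] (sphere (0 : E) 1) := by
  obtain ⟨v, hv1⟩ := exists_norm_eq E zero_le_one
  have hv0 : v ≠ 0 := norm_ne_zero_iff.1 (by rw [hv1]; exact one_ne_zero)
  let V := (ℝ ∙ v)ᗮ
  rw [← finrank_orthogonal_span_singleton_add_one hv0]
  refine lt_of_lt_of_le ?_ (hausdorffMeasure_orthogonalProjectionOnto_le V _ (sphere (0 : E) 1)
    (Nat.cast_nonneg _))
  refine lt_of_lt_of_le (measure_closedBall_pos (μH[(finrank ℝ V : ℝ)]) (0 : V) one_pos)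
    (measure_mono fun y hy ↦ ?_)
  have hy1 : ‖(y : E)‖ ≤ 1 := by simpa using hy
  have hvy : ⟪(y : E), v⟫ = 0 := Submodule.mem_orthogonal_singleton_iff_inner_left.1 y.2
  refine ⟨y + √(1 - ‖(y : E)‖ ^ 2) • v, ?_, ?_⟩
  · rw [mem_sphere_zero_iff_norm, ← sq_eq_sq₀ (norm_nonneg _) zero_le_one, sq, sq,
      norm_add_sq_eq_norm_sq_add_norm_sq_of_inner_eq_zero _ _
        (by rw [inner_smul_right, hvy, mul_zero]),
      norm_smul, hv1, mul_one, Real.norm_of_nonneg (Real.sqrt_nonneg _),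
      Real.mul_self_sqrt (by nlinarith [norm_nonneg (y : E)])]
    ring
  · rw [map_add, map_smul, Submodule.orthogonalProjectionOnto_mem_subspace_eq_self]
    have : V.orthogonalProjectionOnto v = 0 :=
      Submodule.orthogonalProjectionOnto_orthogonalComplement_singleton_eq_zero v
    rw [this, smul_zero, add_zero]

end SphereMeasure

section RadialIntegral

variable {F : Type*} [NormedAddCommGroup F]

/-- Integral of `r ^ (k - 1) * h (r • x)` over the shell `1 / 2 ≤ r ≤ 3 / 2`. -/
def radialIntegral [NormedSpace ℝ F] (k : ℕ) (h : F → ℝ) (x : F) : ℝ :=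
  ∫ r in Set.Icc (1 / 2 : ℝ) (3 / 2), r ^ (k - 1) * h (r • x)

/-- The function `h` is continuous and vanishes outside of the shell `1 / 2 ≤ ‖x‖ ≤ 3 / 2`. -/
structure IsShellFunction (h : F → ℝ) : Prop where
  continuous : Continuous h
  eq_zero : ∀ x, ¬ (1 / 2 ≤ ‖x‖ ∧ ‖x‖ ≤ 3 / 2) → h x = 0

theorem continuous_radialIntegral [NormedSpace ℝ F] [FiniteDimensional ℝ F] (k : ℕ) {h : F → ℝ}
    (hh : Continuous h) : Continuous (radialIntegral k h) := by
  have := FiniteDimensional.proper_real F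
  exact continuous_parametric_integral_of_continuous
    (f := fun (x : F) (r : ℝ) ↦ r ^ (k - 1) * h (r • x)) (by fun_prop) isCompact_Icc

theorem IsShellFunction.hasCompactSupport [NormedSpace ℝ F] [FiniteDimensional ℝ F] {h : F → ℝ}
    (hh : IsShellFunction h) :
    HasCompactSupport h := by
  have := FiniteDimensional.proper_real F
  refine HasCompactSupport.intro (isCompact_closedBall (0 : F) (3 / 2)) fun x hx ↦
    hh.eq_zero x fun h1 ↦ hx (by simpa using h1.2)

variable [InnerProductSpace ℝ F] [FiniteDimensional ℝ F] [MeasurableSpace F] [BorelSpace F]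

theorem integral_eq_integral_toSphere_radialIntegral [Nontrivial F] {h : F → ℝ}
    (hh : IsShellFunction h) :
    ∫ x, h x = ∫ θ : sphere (0 : F) 1, radialIntegral (finrank ℝ F) h θ
      ∂(volume : Measure F).toSphere := by
  let P : sphere (0 : F) 1 × Set.Ioi (0 : ℝ) → ℝ := fun p ↦ h ((p.2 : ℝ) • (p.1 : F))
  have hmp := (volume : Measure F).measurePreserving_homeomorphUnitSphereProd
  have hP : ∀ x : ({0}ᶜ : Set F), P (homeomorphUnitSphereProd F x) = h x := fun x ↦ by
    have hx : ‖(x : F)‖ ≠ 0 := norm_ne_zero_iff.2 x.2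
    simp [P, smul_smul, hx]
  have hint : Integrable P
      ((volume : Measure F).toSphere.prod (.volumeIoiPow (finrank ℝ F - 1))) := by
    rw [← hmp.integrable_comp_emb (Homeomorph.measurableEmbedding _)]
    have h1 : IntegrableOn h {0}ᶜ :=
      (hh.continuous.integrable_of_hasCompactSupport hh.hasCompactSupport).integrableOn
    rw [integrableOn_iff_comap_subtypeVal (measurableSet_singleton _).compl] at h1
    exact h1.congr (.of_forall fun x ↦ (hP x).symm)
  calc ∫ x, h x = ∫ x : ({(0)}ᶜ : Set F), h x ∂((volume : Measure F).comap (↑)) := by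
        rw [integral_subtype_comap (measurableSet_singleton _).compl fun x ↦ h x,
          restrict_compl_singleton]
    _ = ∫ p, P p ∂(volume : Measure F).toSphere.prod (.volumeIoiPow (finrank ℝ F - 1)) := by
        rw [← hmp.integral_comp (Homeomorph.measurableEmbedding _) P]
        simp only [hP]
    _ = ∫ θ : sphere (0 : F) 1, (∫ r, P (θ, r) ∂.volumeIoiPow (finrank ℝ F - 1))
        ∂(volume : Measure F).toSphere := integral_prod _ hint
    _ = _ := by
        refine integral_congr_ae (.of_forall fun θ ↦ ?_)
        simp only [Measure.volumeIoiPow, ENNReal.ofReal, P]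
        rw [integral_withDensity_eq_integral_smul
          (measurable_subtype_coe.pow_const _).real_toNNReal,
          integral_subtype_comap measurableSet_Ioi
            fun r : ℝ ↦ Real.toNNReal (r ^ (finrank ℝ F - 1)) • h (r • (θ : F)),
          radialIntegral]
        have hsub : Set.Icc (1 / 2 : ℝ) (3 / 2) ⊆ Set.Ioi 0 := fun r hr ↦
          lt_of_lt_of_le (by norm_num) hr.1
        rw [← setIntegral_eq_of_subset_of_forall_sdiff_eq_zero measurableSet_Ioi hsub]
        · refine setIntegral_congr_fun measurableSet_Ioi fun r hr ↦ ?_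
          simp only [NNReal.smul_def, smul_eq_mul]
          rw [Real.coe_toNNReal _ (pow_nonneg (le_of_lt hr) _)]
        · rintro r ⟨hr0, hr⟩
          rw [hh.eq_zero, mul_zero]
          rwa [norm_smul, norm_eq_of_mem_sphere, mul_one, Real.norm_of_nonneg (le_of_lt hr0)]

theorem exists_pos_integral_eq_mul_hausdorffMeasure_sphere [Nontrivial F] :
    ∃ c : ℝ, 0 < c ∧ ∀ h : F → ℝ, IsShellFunction h →
      ∫ x, h x = c * ∫ x in sphere (0 : F) 1, radialIntegral (finrank ℝ F) h x
        ∂μH[(finrank ℝ F : ℝ) - 1] := by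
  have hd : (0 : ℝ) ≤ (finrank ℝ F : ℝ) - 1 := by
    have : 1 ≤ finrank ℝ F := finrank_pos
    have : (1 : ℝ) ≤ finrank ℝ F := by exact_mod_cast this
    linarith
  have := FiniteDimensional.proper_real F
  have hcs : CompactSpace (sphere (0 : F) 1) := inferInstance
  let σ : Measure (sphere (0 : F) 1) := μH[(finrank ℝ F : ℝ) - 1]
  let τ := (volume : Measure F).toSphere
  have hmap : σ.map Subtype.val = μH[(finrank ℝ F : ℝ) - 1].restrict (sphere (0 : F) 1) := by
    rw [isometry_subtype_coe.map_hausdorffMeasure (Or.inl hd), Subtype.range_coe]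
  have huniv : σ Set.univ = μH[(finrank ℝ F : ℝ) - 1] (sphere (0 : F) 1) := by
    have := congrArg (fun μ : Measure F ↦ μ Set.univ) hmap
    simpa [Measure.map_apply measurable_subtype_coe] using this
  have hfin : IsFiniteMeasure σ := ⟨huniv ▸ hausdorffMeasure_sphere_lt_top⟩
  have hσ : 0 < σ.real Set.univ := ENNReal.toReal_pos
    (huniv ▸ hausdorffMeasure_sphere_pos.ne') (measure_ne_top _ _)
  have hτ : 0 < τ.real Set.univ := ENNReal.toReal_pos
    (by simp [τ, -Measure.toSphere_apply_univ]) (measure_ne_top _ _)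
  refine ⟨τ.real Set.univ / σ.real Set.univ, by positivity, fun h hh ↦ ?_⟩
  rw [integral_eq_integral_toSphere_radialIntegral hh, ← hmap,
    (MeasurableEmbedding.subtype_coe isClosed_sphere.measurableSet).integral_map]
  have h1 := integral_mul_measureReal_univ_of_isometry_invariant σ τ (fun x y ↦ by
    obtain ⟨e, he⟩ := exists_sphereIsometryEquiv_apply_eq x y
    exact ⟨e.sphereIsometryEquiv, he, e.sphereIsometryEquiv.map_hausdorffMeasure _,
      e.map_toSphere⟩)
    ⟨fun θ ↦ radialIntegral (finrank ℝ F) h θ,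
      (continuous_radialIntegral _ hh.continuous).comp continuous_subtype_val⟩
  simp only [ContinuousMap.coe_mk] at h1
  rw [div_mul_eq_mul_div, h1, mul_div_cancel_left₀ _ hσ.ne']

end RadialIntegral

theorem IsShellFunction.comp_linearIsometry {n k : ℕ} {h : Euc n → ℝ} (hh : IsShellFunction h)
    (ι : Euc k →ₗᵢ[ℝ] Euc n) : IsShellFunction fun u ↦ h (ι u) :=
  ⟨hh.continuous.comp ι.continuous, fun x hx ↦ hh.eq_zero _ (by rwa [ι.norm_map])⟩

/-- The spherical Radon transform of a radial integral is an integral over a subspace. -/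
theorem exists_pos_integral_eq_mul_sphRadon (n : ℕ) {k : ℕ} (hk : k ≠ 0) :
    ∃ c : ℝ, 0 < c ∧ ∀ h : Euc n → ℝ, IsShellFunction h → ∀ (H : Gr n k)
      (ι : Euc k →ₗᵢ[ℝ] Euc n), LinearMap.range ι.toLinearMap = H.1 →
      ∫ u, h (ι u) = c * sphRadon n k (radialIntegral k h) H := by
  have : NeZero k := ⟨hk⟩
  have : Nontrivial (Euc k) := Module.nontrivial_of_finrank_pos (R := ℝ) (by simp; omega)
  have hd : (0 : ℝ) ≤ (k : ℝ) - 1 := by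
    have : (1 : ℝ) ≤ k := by exact_mod_cast Nat.one_le_iff_ne_zero.2 hk
    linarith
  obtain ⟨c, hc, hcF⟩ := exists_pos_integral_eq_mul_hausdorffMeasure_sphere (F := Euc k)
  simp only [finrank_euclideanSpace_fin] at hcF
  refine ⟨c, hc, fun h hh H ι hι ↦ ?_⟩
  rw [hcF _ (hh.comp_linearIsometry ι), sphRadon]
  have hemb : MeasurableEmbedding ι := ι.isometry.isClosedEmbedding.measurableEmbedding
  have hmap := ι.isometry.map_hausdorffMeasure (d := (k : ℝ) - 1) (Or.inl hd)
  have h1 : (μH[(k : ℝ) - 1] : Measure (Euc n)).restrict (sphere 0 1 ∩ (H.1 : Set (Euc n))) =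
      ((μH[(k : ℝ) - 1] : Measure (Euc k)).restrict (sphere 0 1)).map ι := by
    have h2 : (H.1 : Set (Euc n)) = Set.range ι := by rw [← hι]; rfl
    have h3 : ι ⁻¹' sphere 0 1 = sphere 0 1 := by ext; simp
    rw [h2, ← Measure.restrict_restrict isClosed_sphere.measurableSet, ← hmap, hemb.restrict_map,
      h3]
  rw [h1, hemb.integral_map]
  simp [radialIntegral]

section Smoothing

variable {n : ℕ}

/-- The linear map `1 + M`, where `M` is given by its columns. -/
def onePlus (M : Fin n → Euc n) : Euc n →ₗ[ℝ] Euc n where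
  toFun x := x + ∑ j, x j • M j
  map_add' x y := by
    simp only [PiLp.add_apply, add_smul, Finset.sum_add_distrib]
    abel
  map_smul' c x := by
    simp only [PiLp.smul_apply, smul_eq_mul, mul_smul, RingHom.id_apply, smul_add, Finset.smul_sum]

theorem onePlus_apply (M : Fin n → Euc n) (x : Euc n) : onePlus M x = x + ∑ j, x j • M j := rfl

theorem continuous_onePlus : Continuous fun p : (Fin n → Euc n) × Euc n ↦ onePlus p.1 p.2 := by
  simp only [onePlus_apply]
  fun_prop

/-- The columns of the rank one map `x' ↦ ⟪x, x'⟫ • v`. -/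
def rankOneColumns (x v : Euc n) : Fin n → Euc n := fun j ↦ x j • v

theorem continuous_rankOneColumns : Continuous fun p : Euc n × Euc n ↦ rankOneColumns p.1 p.2 := by
  unfold rankOneColumns
  fun_prop

theorem norm_rankOneColumns_le {x : Euc n} (hx : ‖x‖ = 1) (v : Euc n) :
    ‖rankOneColumns x v‖ ≤ ‖v‖ := by
  refine (pi_norm_le_iff_of_nonneg (norm_nonneg v)).2 fun j ↦ ?_
  rw [rankOneColumns, norm_smul]
  exact mul_le_of_le_one_left (norm_nonneg v) ((PiLp.norm_apply_le x j).trans hx.le)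

theorem onePlus_add_rankOneColumns {x : Euc n} (hx : ‖x‖ = 1) (M : Fin n → Euc n) (v : Euc n) :
    onePlus (M + rankOneColumns x v) x = onePlus M x + v := by
  have h1 : ∑ j, x j * x j = 1 := by
    have := EuclideanSpace.real_norm_sq_eq x
    rw [hx, one_pow] at this
    simp only [← sq]
    exact this.symm
  simp only [onePlus_apply, rankOneColumns, Pi.add_apply, smul_add, Finset.sum_add_distrib,
    smul_smul]
  rw [← Finset.sum_smul, h1, one_smul, add_assoc]

theorem norm_onePlus_sub_le {δ : ℝ} (hδ : n * δ ≤ 1 / 2) {M : Fin n → Euc n} (hM : ‖M‖ ≤ δ)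
    (x : Euc n) : ‖onePlus M x - x‖ ≤ ‖x‖ / 2 := by
  rw [onePlus_apply, add_sub_cancel_left]
  calc ‖∑ j, x j • M j‖ ≤ ∑ _j : Fin n, ‖x‖ * δ := by
        refine norm_sum_le_of_le _ fun j _ ↦ ?_
        rw [norm_smul]
        exact mul_le_mul (PiLp.norm_apply_le x j) ((norm_le_pi_norm M j).trans hM)
          (norm_nonneg _) (norm_nonneg _)
    _ = n * δ * ‖x‖ := by simp; ring
    _ ≤ 1 / 2 * ‖x‖ := by gcongr
    _ = ‖x‖ / 2 := by ring

theorem norm_onePlus_mem {δ : ℝ} (hδ : n * δ ≤ 1 / 2) {M : Fin n → Euc n} (hM : ‖M‖ ≤ δ)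
    {x : Euc n} (hx : ‖x‖ = 1) : 1 / 2 ≤ ‖onePlus M x‖ ∧ ‖onePlus M x‖ ≤ 3 / 2 := by
  have h1 := norm_onePlus_sub_le hδ hM x
  have h2 := abs_le.1 ((abs_norm_sub_norm_le (onePlus M x) x).trans h1)
  rw [hx] at h2
  constructor <;> linarith [h2.1, h2.2]

theorem eq_zero_of_onePlus_eq_zero {δ : ℝ} (hδ : n * δ ≤ 1 / 2) {M : Fin n → Euc n} (hM : ‖M‖ ≤ δ)
    {x : Euc n} (hx : onePlus M x = 0) : x = 0 := by
  have h1 := norm_onePlus_sub_le hδ hM x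
  rw [hx, zero_sub, norm_neg] at h1
  exact norm_le_zero_iff.1 (by linarith)

theorem continuous_onePlus_sphere :
    Continuous fun p : (Fin n → Euc n) × sphere (0 : Euc n) 1 ↦ onePlus p.1 (p.2 : Euc n) := by
  simp only [onePlus_apply]
  fun_prop

/-- The map `(M, x) ↦ (1 + M) x` on the product with the sphere. -/
def onePlusSphere (n : ℕ) : C((Fin n → Euc n) × sphere (0 : Euc n) 1, Euc n) :=
  ContinuousMap.mk _ (continuous_onePlus_sphere (n := n))

/-- The function `x ↦ h ((1 + M) x)` on the sphere, as a function of `M`. -/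
def sphereComp (h : C(Euc n, ℝ)) : C(Fin n → Euc n, C(sphere (0 : Euc n) 1, ℝ)) :=
  (h.comp (onePlusSphere n)).curry

theorem sphereComp_apply (h : C(Euc n, ℝ)) (M : Fin n → Euc n) (x : sphere (0 : Euc n) 1) :
    sphereComp h M x = h (onePlus M x) := rfl

/-- Translating the matrix by a rank one map, the mean of `h ((1 + M) x)` over `M` becomes the
integral of `h` against a continuous kernel. -/
theorem integral_bump_mul_onePlus {δ : ℝ} (χ : Euc n → ℝ) (hχ : Continuous χ)
    (hχ0 : ∀ v, 1 < ‖v‖ → χ v = 0) (hχ1 : ∫ v, χ v = 1) (h : C(Euc n, ℝ)) {x : Euc n}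
    (hx : ‖x‖ = 1) :
    ∫ y, h y * ∫ M in closedBall (0 : Fin n → Euc n) (δ + 1), χ (y - onePlus M x) *
        max 0 (δ - ‖M + rankOneColumns x (y - onePlus M x)‖) =
      ∫ M : Fin n → Euc n, max 0 (δ - ‖M‖) * h (onePlus M x) := by
  have hL : Continuous fun M ↦ onePlus M x :=
    continuous_onePlus.comp (continuous_id.prodMk continuous_const)
  have hR : Continuous fun v ↦ rankOneColumns x v :=
    continuous_rankOneColumns.comp (continuous_const.prodMk continuous_id)
  have hbound : ∀ (M : Fin n → Euc n) (v : Euc n), ‖v‖ ≤ 1 → δ + 1 < ‖M‖ →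
      max 0 (δ - ‖M + rankOneColumns x v‖) = 0 := fun M v hv hM ↦ by
    refine max_eq_left ?_
    have h1 := norm_sub_le (M + rankOneColumns x v) (rankOneColumns x v)
    rw [add_sub_cancel_right] at h1
    linarith [norm_rankOneColumns_le hx v]
  let F : Euc n → (Fin n → Euc n) → ℝ := fun y M ↦ h y * (χ (y - onePlus M x) *
    max 0 (δ - ‖M + rankOneColumns x (y - onePlus M x)‖))
  let G : (Fin n → Euc n) → Euc n → ℝ := fun M v ↦ χ v *
    (max 0 (δ - ‖M + rankOneColumns x v‖) * h (onePlus (M + rankOneColumns x v) x))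
  have hFG : ∀ M v, F (onePlus M x + v) M = G M v := fun M v ↦ by
    simp only [F, G, add_sub_cancel_left, onePlus_add_rankOneColumns hx]
    ring
  have hFz : ∀ M y, ¬ (‖y - onePlus M x‖ ≤ 1 ∧ ‖M‖ ≤ δ + 1) → F y M = 0 := fun M y hMy ↦ by
    simp only [F]
    by_cases hy : ‖y - onePlus M x‖ ≤ 1
    · rw [hbound M _ hy (not_le.1 fun h1 ↦ hMy ⟨hy, h1⟩), mul_zero, mul_zero]
    · rw [hχ0 _ (not_le.1 hy), zero_mul, mul_zero]
  have hGcont : Continuous (Function.uncurry G) := by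
    have h1 : Continuous fun p : (Fin n → Euc n) × Euc n ↦ p.1 + rankOneColumns x p.2 :=
      continuous_fst.add (hR.comp continuous_snd)
    have h2 := hL.comp h1
    simp only [Function.comp_def] at h2
    change Continuous fun p : (Fin n → Euc n) × Euc n ↦ χ p.2 *
      (max 0 (δ - ‖p.1 + rankOneColumns x p.2‖) * h (onePlus (p.1 + rankOneColumns x p.2) x))
    fun_prop
  have hFcont : Continuous (Function.uncurry F) := by
    have h2 : Continuous fun p : Euc n × (Fin n → Euc n) ↦ onePlus p.2 x := hL.comp continuous_snd
    have h1 : Continuous fun p : Euc n × (Fin n → Euc n) ↦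
        p.2 + rankOneColumns x (p.1 - onePlus p.2 x) :=
      continuous_snd.add (hR.comp (continuous_fst.sub h2))
    change Continuous fun p : Euc n × (Fin n → Euc n) ↦ h p.1 * (χ (p.1 - onePlus p.2 x) *
      max 0 (δ - ‖p.2 + rankOneColumns x (p.1 - onePlus p.2 x)‖))
    fun_prop
  have hGint : Integrable (Function.uncurry G) (volume.prod volume) := by
    refine hGcont.integrable_of_hasCompactSupport (HasCompactSupport.intro
      ((isCompact_closedBall (0 : Fin n → Euc n) (δ + 1)).prod
        (isCompact_closedBall (0 : Euc n) 1)) ?_)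
    rintro ⟨M, v⟩ hMv
    rw [Function.uncurry_apply_pair, ← hFG]
    refine hFz _ _ fun h1 ↦ hMv ?_
    rw [add_sub_cancel_left] at h1
    exact ⟨by simpa using h1.2, by simpa using h1.1⟩
  have hFint : Integrable (Function.uncurry F) (volume.prod volume) := by
    have hK : IsCompact ((fun p : (Fin n → Euc n) × Euc n ↦ (onePlus p.1 x + p.2, p.1)) ''
        (closedBall 0 (δ + 1) ×ˢ closedBall 0 1)) :=
      ((isCompact_closedBall _ _).prod (isCompact_closedBall _ _)).image
        (((hL.comp continuous_fst).add continuous_snd).prodMk continuous_fst)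
    refine hFcont.integrable_of_hasCompactSupport (HasCompactSupport.intro hK ?_)
    rintro ⟨y, M⟩ hMy
    refine hFz _ _ fun h1 ↦ hMy ⟨(M, y - onePlus M x), ⟨by simpa using h1.2, by simpa using h1.1⟩,
      by simp⟩
  calc _ = ∫ y, ∫ M, F y M := by
        refine integral_congr_ae (.of_forall fun y ↦ ?_)
        simp only
        rw [← integral_const_mul]
        refine setIntegral_eq_integral_of_forall_compl_eq_zero fun M hM ↦ ?_
        exact hFz M y fun h1 ↦ hM (by simpa using h1.2)
    _ = ∫ M, ∫ y, F y M := integral_integral_swap hFint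
    _ = ∫ M, ∫ v, G M v := by
        refine integral_congr_ae (.of_forall fun M ↦ ?_)
        simp only [← hFG]
        rw [integral_add_left_eq_self (fun y ↦ F y M)]
    _ = ∫ v, ∫ M, G M v := integral_integral_swap hGint
    _ = ∫ v, χ v * ∫ M : Fin n → Euc n, max 0 (δ - ‖M‖) * h (onePlus M x) := by
        refine integral_congr_ae (.of_forall fun v ↦ ?_)
        simp only [G]
        rw [integral_const_mul, integral_add_right_eq_self
          (fun M : Fin n → Euc n ↦ max 0 (δ - ‖M‖) * h (onePlus M x))]
    _ = _ := by rw [integral_mul_const, hχ1, one_mul]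

end Smoothing

section ShellDensity

variable {n : ℕ}

theorem exists_normalized_bump (n : ℕ) : ∃ χ : Euc n → ℝ, Continuous χ ∧
    (∀ v, 1 < ‖v‖ → χ v = 0) ∧ ∫ v, χ v = 1 := by
  let b : Euc n → ℝ := fun v ↦ max 0 (1 - ‖v‖)
  have hb : Continuous b := by fun_prop
  have hb0 : ∀ v, 1 < ‖v‖ → b v = 0 := fun v hv ↦ max_eq_left (by linarith)
  have hI : 0 < ∫ v, b v :=
    hb.integral_pos_of_hasCompactSupport_nonneg_nonzero
      (HasCompactSupport.intro (isCompact_closedBall (0 : Euc n) 1) fun v hv ↦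
        hb0 v (by simpa using hv)) (fun v ↦ le_max_left _ _) (x := 0) (by simp [b])
  refine ⟨fun v ↦ (∫ v, b v)⁻¹ * b v, by fun_prop, fun v hv ↦ by simp [hb0 v hv], ?_⟩
  rw [integral_const_mul, inv_mul_cancel₀ hI.ne']

/-- The mean of a functional over small perturbations of the identity has a continuous density. -/
theorem exists_shell_density (Λ : C(sphere (0 : Euc n) 1, ℝ) →L[ℝ] ℝ) {δ : ℝ}
    (hnδ : n * δ ≤ 1 / 2) : ∃ g : Euc n → ℝ, IsShellFunction g ∧ ∀ h : C(Euc n, ℝ),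
      ∫ M : Fin n → Euc n, max 0 (δ - ‖M‖) * Λ (sphereComp h M) = ∫ y, h y * g y := by
  obtain ⟨χ, hχ, hχ0, hχ1⟩ := exists_normalized_bump n
  let k : Euc n → Euc n → ℝ := fun y x ↦
    ∫ M in closedBall (0 : Fin n → Euc n) (δ + 1), χ (y - onePlus M x) *
        max 0 (δ - ‖M + rankOneColumns x (y - onePlus M x)‖)
  have hk : Continuous fun p : Euc n × Euc n ↦ k p.1 p.2 := by
    refine continuous_parametric_integral_of_continuous (f := fun (p : Euc n × Euc n)
      (M : Fin n → Euc n) ↦ χ (p.1 - onePlus M p.2) *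
        max 0 (δ - ‖M + rankOneColumns p.2 (p.1 - onePlus M p.2)‖)) ?_ (isCompact_closedBall _ _)
    unfold Function.uncurry rankOneColumns
    simp only [onePlus_apply]
    fun_prop
  have hkS : Continuous fun p : Euc n × sphere (0 : Euc n) 1 ↦ k p.1 p.2 := by
    have h1 : Continuous fun p : Euc n × sphere (0 : Euc n) 1 ↦ (p.1, (p.2 : Euc n)) := by
      fun_prop
    exact hk.comp h1
  let κ : C(Euc n, C(sphere (0 : Euc n) 1, ℝ)) := ContinuousMap.curry ⟨_, hkS⟩
  have hκ : ∀ y x, κ y x = k y x := fun y x ↦ rfl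
  have hk0 : ∀ y, ¬ (1 / 2 ≤ ‖y‖ ∧ ‖y‖ ≤ 3 / 2) → κ y = 0 := fun y hy ↦ by
    ext x
    have hx : ‖(x : Euc n)‖ = 1 := by simp
    rw [hκ, ContinuousMap.zero_apply]
    refine integral_eq_zero_of_ae (.of_forall fun M ↦ ?_)
    simp only [Pi.zero_apply]
    rw [max_eq_left, mul_zero]
    by_contra! hM
    refine hy ?_
    have h1 := norm_onePlus_mem hnδ (sub_pos.1 hM).le hx
    rwa [onePlus_add_rankOneColumns hx, add_sub_cancel] at h1
  refine ⟨fun y ↦ Λ (κ y), ⟨Λ.continuous.comp κ.continuous, fun y hy ↦ by rw [hk0 y hy, map_zero]⟩,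
    fun h ↦ ?_⟩
  have hcont1 : Continuous fun M : Fin n → Euc n ↦ max 0 (δ - ‖M‖) • sphereComp h M := by
    fun_prop
  have hint1 : Integrable fun M : Fin n → Euc n ↦ max 0 (δ - ‖M‖) • sphereComp h M := by
    refine hcont1.integrable_of_hasCompactSupport (HasCompactSupport.intro
      (isCompact_closedBall (0 : Fin n → Euc n) δ) fun M hM ↦ ?_)
    have : δ < ‖M‖ := by simpa using hM
    rw [max_eq_left (by linarith), zero_smul]
  have hint2 : Integrable fun y ↦ h y • κ y := by
    refine Continuous.integrable_of_hasCompactSupport (by fun_prop) (HasCompactSupport.intro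
      (isCompact_closedBall (0 : Euc n) (3 / 2)) fun y hy ↦ ?_)
    rw [hk0 y fun h1 ↦ hy (by simpa using h1.2), smul_zero]
  have heq : ∫ M : Fin n → Euc n, max 0 (δ - ‖M‖) • sphereComp h M = ∫ y, h y • κ y := by
    ext x
    rw [ContinuousMap.integral_apply hint1, ContinuousMap.integral_apply hint2]
    exact (integral_bump_mul_onePlus χ hχ hχ0 hχ1 h (by simp : ‖(x : Euc n)‖ = 1)).symm
  have := congrArg Λ heq
  rw [← Λ.integral_comp_comm hint1, ← Λ.integral_comp_comm hint2] at this
  simpa using this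

end ShellDensity

/-- A radial gauge, truncated near the origin. -/
theorem IsRadialGauge.exists_continuousMap_eq_inv_pow {n m : ℕ} {N : Euc n → ℝ}
    (hN : IsRadialGauge N) :
    ∃ h : C(Euc n, ℝ), ∀ y, 1 / 2 ≤ ‖y‖ → h y = (N y ^ m)⁻¹ := by
  obtain ⟨c, hc, hcN⟩ := hN.exists_mul_norm_le
  refine ⟨⟨fun y ↦ (max (N y) (c / 2) ^ m)⁻¹, ?_⟩, fun y hy ↦ ?_⟩
  · refine ((hN.continuous.max continuous_const).pow m).inv₀ fun y ↦ ?_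
    have : 0 < max (N y) (c / 2) := lt_max_of_lt_right (by positivity)
    exact (pow_pos this m).ne'
  · have : c / 2 ≤ N y := le_trans (by nlinarith) (hcN y)
    simp [max_eq_left this]

/-- Restriction of `N ^ (-m)` to the sphere. -/
def IsRadialGauge.sphereInvPow {n : ℕ} {N : Euc n → ℝ} (hN : IsRadialGauge N) (m : ℕ) :
    C(sphere (0 : Euc n) 1, ℝ) where
  toFun θ := (N θ ^ m)⁻¹
  continuous_toFun := by
    have h1 := hN.continuous
    refine Continuous.inv₀ (by fun_prop) fun θ ↦ ?_
    have := hN.pos _ (ne_zero_of_mem_unit_sphere θ)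
    positivity

/-- Replacing a functional on the sphere by a continuous density on a shell. -/
theorem exists_shell_density_separating {n m : ℕ} {N₀ : Euc n → ℝ} (hN₀ : IsRadialGauge N₀)
    (Λ : C(sphere (0 : Euc n) 1, ℝ) →L[ℝ] ℝ) (hneg : Λ (hN₀.sphereInvPow m) < 0)
    (hpos : ∀ (B : Euc n →ₗ[ℝ] Euc n) (hB : ∀ x, B x = 0 → x = 0),
      0 ≤ Λ ((isRadialGauge_norm_comp B hB).sphereInvPow m)) :
    ∃ g : Euc n → ℝ, IsShellFunction g ∧ ∫ y, (N₀ y ^ m)⁻¹ * g y < 0 ∧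
      ∀ B : Euc n →ₗ[ℝ] Euc n, (∀ x, B x = 0 → x = 0) → 0 ≤ ∫ y, (‖B y‖ ^ m)⁻¹ * g y := by
  obtain ⟨h₀, hh₀⟩ := hN₀.exists_continuousMap_eq_inv_pow (m := m)
  have hcont : Continuous fun M : Fin n → Euc n ↦ Λ (sphereComp h₀ M) := by fun_prop
  have h00 : Λ (sphereComp h₀ 0) < 0 := by
    convert hneg using 2
    ext x
    rw [sphereComp_apply]
    have : onePlus 0 (x : Euc n) = x := by simp [onePlus_apply]
    rw [this, hh₀ _ (by rw [norm_eq_of_mem_sphere]; norm_num)]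
    rfl
  obtain ⟨δ₀, hδ₀, hball⟩ := Metric.isOpen_iff.1 (isOpen_lt hcont continuous_const) 0 h00
  let δ : ℝ := min δ₀ (1 / (2 * (n + 1)))
  have hδ : 0 < δ := lt_min hδ₀ (by positivity)
  have hnδ : n * δ ≤ 1 / 2 := by
    calc (n : ℝ) * δ ≤ n * (1 / (2 * (n + 1))) := by gcongr; exact min_le_right _ _
      _ ≤ 1 / 2 := by
        rw [mul_one_div, div_le_div_iff₀ (by positivity) (by norm_num)]
        linarith
  obtain ⟨g, hg, hgh⟩ := exists_shell_density Λ hnδ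
  have hgN : ∀ (N : Euc n → ℝ) (h : C(Euc n, ℝ)), (∀ y, 1 / 2 ≤ ‖y‖ → h y = (N y ^ m)⁻¹) →
      ∫ y, (N y ^ m)⁻¹ * g y = ∫ M : Fin n → Euc n, max 0 (δ - ‖M‖) * Λ (sphereComp h M) := by
    intro N h hN
    rw [hgh]
    refine integral_congr_ae (.of_forall fun y ↦ ?_)
    by_cases hy : 1 / 2 ≤ ‖y‖
    · simp [hN y hy]
    · simp [hg.eq_zero y fun h1 ↦ hy h1.1]
  refine ⟨g, hg, ?_, fun B hB ↦ ?_⟩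
  · rw [hgN N₀ h₀ hh₀, ← neg_pos, ← integral_neg]
    refine Continuous.integral_pos_of_hasCompactSupport_nonneg_nonzero (by fun_prop)
      (HasCompactSupport.intro (isCompact_closedBall (0 : Fin n → Euc n) δ) fun M hM ↦ ?_)
      (fun M ↦ ?_) (x := 0) ?_
    · have : δ < ‖M‖ := by simpa using hM
      rw [max_eq_left (by linarith), zero_mul, neg_zero]
    · rw [Pi.zero_apply, neg_nonneg]
      rcases lt_or_ge ‖M‖ δ with hM | hM
      · have : Λ (sphereComp h₀ M) < 0 := hball (by simpa using hM.trans_le (min_le_left _ _))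
        exact mul_nonpos_of_nonneg_of_nonpos (le_max_left _ _) this.le
      · rw [max_eq_left (by linarith), zero_mul]
    · simp only [norm_zero, sub_zero, max_eq_right hδ.le]
      exact neg_ne_zero.2 (mul_ne_zero hδ.ne' h00.ne)
  · obtain ⟨h, hh⟩ := (isRadialGauge_norm_comp B hB).exists_continuousMap_eq_inv_pow (m := m)
    rw [hgN (fun y ↦ ‖B y‖) h hh]
    refine integral_nonneg fun M ↦ ?_
    rcases le_or_gt δ ‖M‖ with hM | hM
    · rw [max_eq_left (by linarith), zero_mul, Pi.zero_apply]
    refine mul_nonneg (le_max_left _ _) ?_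
    have hBM : ∀ x, (B ∘ₗ onePlus M) x = 0 → x = 0 := fun x hx ↦
      eq_zero_of_onePlus_eq_zero hnδ hM.le (hB _ hx)
    have he : sphereComp h M =
        (isRadialGauge_norm_comp (B ∘ₗ onePlus M) hBM).sphereInvPow m := by
      ext x
      rw [sphereComp_apply, hh _ (norm_onePlus_mem hnδ hM.le (by simp)).1]
      rfl
    rw [he]
    exact hpos _ hBM

section SingularLimit

theorem exists_le_setIntegral_inv_pow_norm {m : ℕ} (hm : m ≠ 0) {δ : ℝ} (hδ : 0 < δ) (C : ℝ) :
    ∃ ε : ℝ, 0 < ε ∧ C ≤ ∫ v in ball (0 : Euc m) δ, (√(‖v‖ ^ 2 + ε ^ 2) ^ m)⁻¹ := by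
  have : NeZero m := ⟨hm⟩
  have : Nontrivial (Euc m) := Module.nontrivial_of_finrank_pos (R := ℝ) (by simp; omega)
  set a : ℝ := m * volume.real (ball (0 : Euc m) 1) * (2 ^ m)⁻¹ with ha
  have ha0 : 0 < a := by
    have h1 : 0 < volume.real (ball (0 : Euc m) 1) :=
      ENNReal.toReal_pos (measure_ball_pos _ _ one_pos).ne' measure_ball_lt_top.ne
    have h2 : (0 : ℝ) < m := by exact_mod_cast Nat.pos_of_ne_zero hm
    positivity
  have key : ∀ ε : ℝ, 0 < ε → ε < δ →
      a * Real.log (δ / ε) ≤ ∫ v in ball (0 : Euc m) δ, (√(‖v‖ ^ 2 + ε ^ 2) ^ m)⁻¹ := by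
    intro ε hε hεδ
    have hpos : ∀ v : Euc m, 0 < √(‖v‖ ^ 2 + ε ^ 2) := fun v ↦ by positivity
    have h1 : ∫ v : Euc m, (Set.Ioo ε δ).indicator (fun r ↦ ((2 * r) ^ m)⁻¹) ‖v‖ =
        a * Real.log (δ / ε) := by
      rw [integral_fun_norm_addHaar, ← integral_inv_of_pos hε hδ,
        intervalIntegral.integral_of_le hεδ.le, integral_Ioc_eq_integral_Ioo]
      have h2 : ∀ r : ℝ, r ^ (finrank ℝ (Euc m) - 1) •
          (Set.Ioo ε δ).indicator (fun r ↦ ((2 * r) ^ m)⁻¹) r =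
          (Set.Ioo ε δ).indicator (fun r ↦ (2 ^ m)⁻¹ * r⁻¹) r := fun r ↦ by
        by_cases hr : r ∈ Set.Ioo ε δ
        · have hr0 : 0 < r := hε.trans hr.1
          obtain ⟨k, rfl⟩ := Nat.exists_eq_succ_of_ne_zero hm
          simp only [Set.indicator_of_mem hr, finrank_euclideanSpace_fin, smul_eq_mul,
            Nat.succ_eq_add_one, Nat.add_sub_cancel]
          field_simp
          ring
        · simp [Set.indicator_of_notMem hr]
      simp_rw [h2]
      rw [setIntegral_indicator measurableSet_Ioo,
        Set.inter_eq_right.2 (Set.Ioo_subset_Ioi_self.trans (Set.Ioi_subset_Ioi hε.le)),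
        integral_const_mul]
      simp [a]
      ring
    rw [← h1, ← integral_indicator measurableSet_ball]
    have hint : IntegrableOn (fun v : Euc m ↦ (√(‖v‖ ^ 2 + ε ^ 2) ^ m)⁻¹) (ball 0 δ) := by
      have hc : Continuous fun v : Euc m ↦ (√(‖v‖ ^ 2 + ε ^ 2) ^ m)⁻¹ :=
        Continuous.inv₀ (by fun_prop) fun v ↦ (pow_pos (hpos v) m).ne'
      exact (hc.continuousOn.integrableOn_compact (isCompact_closedBall 0 δ)).mono_set
        ball_subset_closedBall
    refine integral_mono_of_nonneg (.of_forall fun v ↦ ?_)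
      (hint.integrable_indicator measurableSet_ball) (.of_forall fun v ↦ ?_)
    · exact Set.indicator_nonneg (fun r hr ↦ by have := hε.trans hr.1; positivity) _
    · by_cases hv : ‖v‖ ∈ Set.Ioo ε δ
      · have hv' : v ∈ ball (0 : Euc m) δ := by simpa using hv.2
        simp only [Set.indicator_of_mem hv, Set.indicator_of_mem hv']
        have h3 : √(‖v‖ ^ 2 + ε ^ 2) ≤ 2 * ‖v‖ :=
          Real.sqrt_le_iff.2 ⟨by positivity, by nlinarith [hv.1]⟩
        gcongr
      · simp only [Set.indicator_of_notMem hv]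
        exact Set.indicator_nonneg (fun _ _ ↦ by positivity) _
  refine ⟨δ * Real.exp (-(|C| / a + 1)), by positivity, ?_⟩
  refine le_trans ?_ (key _ (by positivity) ?_)
  · rw [div_mul_cancel_left₀ hδ.ne', ← Real.exp_neg, Real.log_exp, neg_neg, mul_add,
      mul_div_cancel₀ _ ha0.ne']
    linarith [le_abs_self C]
  · have : Real.exp (-(|C| / a + 1)) < 1 := Real.exp_lt_one_iff.2 (by
      have : 0 ≤ |C| / a := by positivity
      linarith)
    nlinarith

theorem setIntegral_ball_scaled {m : ℕ} {δ ε r : ℝ} (hr : 0 < r) :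
    ∫ v in ball (0 : Euc m) (δ * r), (√(‖v‖ ^ 2 + ε ^ 2 * r ^ 2) ^ m)⁻¹ =
      ∫ v in ball (0 : Euc m) δ, (√(‖v‖ ^ 2 + ε ^ 2) ^ m)⁻¹ := by
  have h := Measure.setIntegral_comp_smul_of_pos (volume : Measure (Euc m))
    (fun v ↦ (√(‖v‖ ^ 2 + ε ^ 2 * r ^ 2) ^ m)⁻¹) (ball 0 δ) hr
  have h2 : ∀ v : Euc m, (√(‖r • v‖ ^ 2 + ε ^ 2 * r ^ 2) ^ m)⁻¹ =
      (r ^ m)⁻¹ * (√(‖v‖ ^ 2 + ε ^ 2) ^ m)⁻¹ := fun v ↦ by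
    rw [norm_smul, mul_pow, Real.norm_of_nonneg hr.le, mul_comm (ε ^ 2), ← mul_add,
      Real.sqrt_mul (by positivity), Real.sqrt_sq hr.le, mul_pow, mul_inv]
  simp_rw [h2] at h
  rw [integral_const_mul, _root_.smul_ball hr.ne', smul_zero, Real.norm_of_nonneg hr.le,
    mul_comm r δ,
    finrank_euclideanSpace_fin, smul_eq_mul] at h
  exact (mul_left_cancel₀ (by positivity) h).symm

/-- Singular kernels which concentrate along a coordinate subspace. -/
theorem integral_nonneg_of_forall_kernel_nonneg {k m : ℕ} (hm : m ≠ 0) {f : Euc k × Euc m → ℝ}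
    (hf : Continuous f)
    (hf0 : ∀ p : Euc k × Euc m, ‖p.1‖ ^ 2 + ‖p.2‖ ^ 2 < (1 / 2) ^ 2 → f p = 0)
    (hf1 : ∀ p : Euc k × Euc m, 3 / 2 < ‖p.1‖ ∨ 3 / 2 < ‖p.2‖ → f p = 0)
    (hpos : ∀ ε : ℝ, 0 < ε → 0 ≤ ∫ p : Euc k × Euc m,
      (√(‖p.2‖ ^ 2 + ε ^ 2 * ‖p.1‖ ^ 2) ^ m)⁻¹ * f p) :
    0 ≤ ∫ u, f (u, 0) := by
  by_contra! hI
  have hsupp : HasCompactSupport f := by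
    refine HasCompactSupport.intro (K := closedBall 0 (3 / 2) ×ˢ closedBall 0 (3 / 2))
      ((isCompact_closedBall _ _).prod (isCompact_closedBall _ _)) fun p hp ↦ hf1 p ?_
    by_contra! h
    exact hp (by simpa using h)
  have hfint : Integrable f := hf.integrable_of_hasCompactSupport hsupp
  set I := ∫ u, f (u, 0) with hIdef
  set V := volume.real (closedBall (0 : Euc k) (3 / 2)) with hV
  have hV0 : 0 ≤ V := measureReal_nonneg
  set η := -I / (2 * (V + 1)) with hη
  have hη0 : 0 < η := div_pos (by linarith) (by positivity)
  have hIη : I + η * V < 0 := by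
    have : η * (2 * (V + 1)) = -I := div_mul_cancel₀ _ (by positivity)
    nlinarith
  obtain ⟨δ₀, hδ₀, huc⟩ := Metric.uniformContinuous_iff.1
    (hsupp.uniformContinuous_of_continuous hf) η hη0
  set δ := min 1 (δ₀ / 2) with hδdef
  have hδ : 0 < δ := lt_min one_pos (by positivity)
  have hδ1 : δ ≤ 1 := min_le_left _ _
  have hδ2 : δ ≤ δ₀ / 2 := min_le_right _ _
  let S : Euc k → ℝ := fun u ↦ f (u, 0) + (closedBall (0 : Euc k) (3 / 2)).indicator (fun _ ↦ η) u
  have hfu : Integrable fun u : Euc k ↦ f (u, 0) := by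
    refine Continuous.integrable_of_hasCompactSupport (by fun_prop)
      (HasCompactSupport.intro (isCompact_closedBall (0 : Euc k) (3 / 2)) fun u hu ↦ hf1 _ ?_)
    exact Or.inl (by simpa using hu)
  have hηint : Integrable ((closedBall (0 : Euc k) (3 / 2)).indicator fun _ ↦ η) :=
    ((integrableOn_const_iff).2 (Or.inr measure_closedBall_lt_top)).integrable_indicator
      measurableSet_closedBall
  have hSint : Integrable S := hfu.add hηint
  have hSI : ∫ u, S u = I + η * V := by
    rw [integral_add hfu hηint, integral_indicator measurableSet_closedBall, setIntegral_const,
      smul_eq_mul, mul_comm]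
  have hfS : ∀ u v, ‖v‖ < δ * ‖u‖ → f (u, v) ≤ S u := fun u v huv ↦ by
    by_cases hu : ‖u‖ ≤ 3 / 2
    · have h1 : dist (u, v) (u, 0) < δ₀ := by
        rw [Prod.dist_eq, dist_self, dist_zero_right, max_eq_right (norm_nonneg _)]
        nlinarith
      have h2 := (abs_lt.1 (huc h1)).2
      have h3 : u ∈ closedBall (0 : Euc k) (3 / 2) := by simpa using hu
      simp only [S, Set.indicator_of_mem h3]
      linarith
    · have h3 : u ∉ closedBall (0 : Euc k) (3 / 2) := by simpa using hu
      simp only [S, Set.indicator_of_notMem h3, hf1 (u, v) (Or.inl (not_le.1 hu)),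
        hf1 (u, 0) (Or.inl (not_le.1 hu)), add_zero, le_refl]
  set C₀ := ((δ / 4) ^ m)⁻¹ with hC₀
  set A : Set (Euc k × Euc m) := {p | ‖p.2‖ < δ * ‖p.1‖} with hA
  have hAmeas : MeasurableSet A := (isOpen_lt (by fun_prop) (by fun_prop)).measurableSet
  obtain ⟨ε, hε, hεC⟩ := exists_le_setIntegral_inv_pow_norm hm hδ
    ((C₀ * ∫ p, |f p|) / -(I + η * V) + 1)
  set κ := ∫ v in ball (0 : Euc m) δ, (√(‖v‖ ^ 2 + ε ^ 2) ^ m)⁻¹ with hκ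
  let w : Euc k × Euc m → ℝ := fun p ↦ (√(‖p.2‖ ^ 2 + ε ^ 2 * ‖p.1‖ ^ 2) ^ m)⁻¹
  have hw0 : ∀ p, 0 ≤ w p := fun p ↦ by positivity
  have hwmeas : Measurable w := by fun_prop
  have hwf : Integrable fun p ↦ w p * f p := by
    refine (hfint.norm.const_mul (((min 1 ε / 2) ^ m)⁻¹)).mono'
      (hwmeas.aestronglyMeasurable.mul hf.aestronglyMeasurable) (.of_forall fun p ↦ ?_)
    rw [norm_mul, Real.norm_of_nonneg (hw0 p)]
    by_cases hp : ‖p.1‖ ^ 2 + ‖p.2‖ ^ 2 < (1 / 2) ^ 2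
    · simp [hf0 p hp]
    simp only [w]
    gcongr
    refine Real.le_sqrt_of_sq_le ?_
    have h1 : min 1 ε ^ 2 ≤ 1 := by
      rw [sq_le_one_iff₀ (by positivity)]
      exact min_le_left _ _
    have h2 : min 1 ε ^ 2 ≤ ε ^ 2 := by gcongr; exact min_le_right _ _
    nlinarith [mul_le_mul_of_nonneg_right h1 (sq_nonneg ‖p.2‖),
      mul_le_mul_of_nonneg_right h2 (sq_nonneg ‖p.1‖),
      mul_le_mul_of_nonneg_left (not_lt.1 hp) (sq_nonneg (min 1 ε))]
  have hfar : ∫ p in Aᶜ, w p * f p ≤ C₀ * ∫ p, |f p| := by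
    rw [← integral_const_mul]
    refine (setIntegral_mono_on hwf.integrableOn (hfint.abs.const_mul C₀).integrableOn
      hAmeas.compl fun p hp ↦ ?_).trans
      (setIntegral_le_integral (hfint.abs.const_mul C₀) (.of_forall fun p ↦ by positivity))
    have hp' : δ * ‖p.1‖ ≤ ‖p.2‖ := not_lt.1 hp
    by_cases hp0 : ‖p.1‖ ^ 2 + ‖p.2‖ ^ 2 < (1 / 2) ^ 2
    · simp [hf0 p hp0]
    have hp2 : δ / 4 ≤ √(‖p.2‖ ^ 2 + ε ^ 2 * ‖p.1‖ ^ 2) := by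
      refine Real.le_sqrt_of_sq_le ?_
      have h1 : (δ * ‖p.1‖) ^ 2 ≤ ‖p.2‖ ^ 2 := by gcongr
      have h2 : δ ^ 2 ≤ 1 := by rwa [sq_le_one_iff₀ hδ.le]
      nlinarith [mul_le_mul_of_nonneg_right h2 (sq_nonneg ‖p.2‖),
        mul_le_mul_of_nonneg_left (not_lt.1 hp0) (sq_nonneg δ), sq_nonneg (ε * ‖p.1‖)]
    calc w p * f p ≤ w p * |f p| :=
          mul_le_mul_of_nonneg_left (le_abs_self _) (hw0 p)
      _ ≤ C₀ * |f p| := by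
        have : w p ≤ C₀ := by
          simp only [w, C₀]
          gcongr
        gcongr
  have hnear : ∫ p in A, w p * f p ≤ κ * (I + η * V) := by
    have hAint : Integrable (A.indicator fun p ↦ w p * f p) := hwf.indicator hAmeas
    rw [← integral_indicator hAmeas, Measure.volume_eq_prod, integral_prod _ hAint, ← hSI,
      ← integral_const_mul]
    refine integral_mono hAint.integral_prod_left (hSint.const_mul κ) fun u ↦ ?_
    have h1 : ∀ v, A.indicator (fun p ↦ w p * f p) (u, v) =
        (ball (0 : Euc m) (δ * ‖u‖)).indicator (fun v ↦ w (u, v) * f (u, v)) v := fun v ↦ by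
      simp [Set.indicator, A]
    simp_rw [h1]
    rw [integral_indicator measurableSet_ball]
    rcases eq_or_ne u 0 with rfl | hu
    · have h2 : S 0 = η := by
        have h3 : f ((0 : Euc k), (0 : Euc m)) = 0 := hf0 _ (by norm_num)
        have h4 : (0 : Euc k) ∈ closedBall (0 : Euc k) (3 / 2) := by simp; norm_num
        simp only [S, h3, Set.indicator_of_mem h4, zero_add]
      have hκ0 : 0 ≤ κ := integral_nonneg fun v ↦ by positivity
      simp only [norm_zero, mul_zero, ball_zero, Measure.restrict_empty, integral_zero_measure, h2]
      positivity
    have hu0 : 0 < ‖u‖ := norm_pos_iff.2 hu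
    rw [hκ, ← setIntegral_ball_scaled (ε := ε) hu0, ← integral_mul_const]
    have hcw : Continuous fun v ↦ w (u, v) := by
      refine Continuous.inv₀ (by fun_prop) fun v ↦ ?_
      have : 0 < √(‖v‖ ^ 2 + ε ^ 2 * ‖u‖ ^ 2) := by positivity
      positivity
    have hio : ∀ {F : Euc m → ℝ}, Continuous F → IntegrableOn F (ball 0 (δ * ‖u‖)) := fun hF ↦
      (hF.continuousOn.integrableOn_compact (isCompact_closedBall 0 _)).mono_set
        ball_subset_closedBall
    refine setIntegral_mono_on (hio (hcw.mul (by fun_prop))) (hio (hcw.mul_const _))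
      measurableSet_ball fun v hv ↦ mul_le_mul_of_nonneg_left (hfS u v (by simpa using hv)) (hw0 _)
  have htot := hpos ε hε
  rw [← integral_add_compl hAmeas hwf] at htot
  have h1 : κ * (I + η * V) ≤ ((C₀ * ∫ p, |f p|) / -(I + η * V) + 1) * (I + η * V) :=
    mul_le_mul_of_nonpos_right hεC hIη.le
  have h2 : ((C₀ * ∫ p, |f p|) / -(I + η * V) + 1) * (I + η * V) =
      -(C₀ * ∫ p, |f p|) + (I + η * V) := by
    field_simp [hIη.ne]
  linarith

end SingularLimit

/-- A shell function which has nonnegative integrals against all kernels `‖B y‖ ^ (-m)` has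
nonnegative integrals over all subspaces of codimension `m`. -/
theorem IsShellFunction.integral_comp_nonneg {n m : ℕ} (hm : m ≠ 0) (hmn : m ≤ n) {g : Euc n → ℝ}
    (hg : IsShellFunction g)
    (hpos : ∀ B : Euc n →ₗ[ℝ] Euc n, (∀ x, B x = 0 → x = 0) → 0 ≤ ∫ y, (‖B y‖ ^ m)⁻¹ * g y)
    {H : Submodule ℝ (Euc n)} (hH : finrank ℝ H = n - m) (ι : Euc (n - m) →ₗᵢ[ℝ] Euc n)
    (hι : LinearMap.range ι.toLinearMap = H) : 0 ≤ ∫ u, g (ι u) := by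
  obtain ⟨j, hj⟩ := exists_linearIsometry_range_eq Hᗮ (finrank_orthogonal_eq hmn hH)
  have horth : ∀ u v, ⟪ι u, j v⟫ = 0 := fun u v ↦
    Submodule.inner_right_of_mem_orthogonal (K := H) (hι ▸ LinearMap.mem_range_self _ u)
      (hj ▸ LinearMap.mem_range_self _ v)
  have hnorm : ∀ u v, ‖ι u + j v‖ ^ 2 = ‖u‖ ^ 2 + ‖v‖ ^ 2 := fun u v ↦ by
    have := norm_add_sq_eq_norm_sq_add_norm_sq_real (horth u v)
    simpa only [← sq, LinearIsometry.norm_map] using this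
  let T : WithLp 2 (Euc (n - m) × Euc m) →ₗᵢ[ℝ] Euc n :=
    { toLinearMap := ι.toLinearMap ∘ₗ WithLp.fstₗ 2 ℝ _ _ + j.toLinearMap ∘ₗ WithLp.sndₗ 2 ℝ _ _
      norm_map' := fun p ↦ by
        rw [← sq_eq_sq₀ (norm_nonneg _) (norm_nonneg _), WithLp.prod_norm_sq_eq_of_L2]
        exact hnorm _ _ }
  let e := T.toLinearIsometryEquiv (by
    rw [(WithLp.linearEquiv 2 ℝ (Euc (n - m) × Euc m)).finrank_eq]
    simp [hmn])
  have he : ∀ p : Euc (n - m) × Euc m, e (WithLp.toLp 2 p) = ι p.1 + j p.2 := fun p ↦ rfl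
  have hmp : MeasurePreserving fun p : Euc (n - m) × Euc m ↦ ι p.1 + j p.2 :=
    e.measurePreserving.comp (WithLp.volume_preserving_toLp (Euc (n - m)) (Euc m))
  refine (integral_nonneg_of_forall_kernel_nonneg hm (f := fun p ↦ g (ι p.1 + j p.2))
    ?_ (fun p hp ↦ ?_) (fun p hp ↦ ?_) fun ε hε ↦ ?_).trans_eq (by simp)
  · have := hg.continuous
    have := ι.continuous
    have := j.continuous
    fun_prop
  · refine hg.eq_zero _ fun h ↦ hp.not_ge ?_
    rw [← hnorm]
    gcongr
    exact h.1
  · refine hg.eq_zero _ fun h ↦ ?_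
    have h1 : ‖ι p.1 + j p.2‖ ^ 2 ≤ (3 / 2) ^ 2 := by gcongr; exact h.2
    rw [hnorm] at h1
    rcases hp with hp | hp <;> nlinarith [sq_nonneg ‖p.1‖, sq_nonneg ‖p.2‖]
  · let B : Euc n →ₗ[ℝ] Euc n := ((ε • ι.toLinearMap) ∘ₗ WithLp.fstₗ 2 ℝ _ _ +
      j.toLinearMap ∘ₗ WithLp.sndₗ 2 ℝ _ _) ∘ₗ e.symm.toLinearEquiv.toLinearMap
    have hB : ∀ p : Euc (n - m) × Euc m, ‖B (ι p.1 + j p.2)‖ ^ 2 =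
        ‖p.2‖ ^ 2 + ε ^ 2 * ‖p.1‖ ^ 2 := fun p ↦ by
      have h1 : B (ι p.1 + j p.2) = ι (ε • p.1) + j p.2 := by
        rw [← he, map_smul]
        simp [B]
      rw [h1, hnorm, norm_smul, mul_pow, Real.norm_of_nonneg hε.le, add_comm]
    have hB0 : ∀ x, B x = 0 → x = 0 := fun x hx ↦ by
      obtain ⟨q, rfl⟩ := e.surjective x
      have h1 := hB q.ofLp
      rw [← he, WithLp.toLp_ofLp, hx, norm_zero] at h1
      have h2 : ‖q.ofLp.1‖ = 0 := by
        by_contra h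
        have : 0 < ‖q.ofLp.1‖ := lt_of_le_of_ne (norm_nonneg _) (Ne.symm h)
        have : 0 < ε ^ 2 * ‖q.ofLp.1‖ ^ 2 := by positivity
        nlinarith [sq_nonneg ‖q.ofLp.2‖]
      have h3 : ‖q.ofLp.2‖ = 0 := by
        rw [h2] at h1
        nlinarith [sq_nonneg ‖q.ofLp.2‖]
      rw [← WithLp.toLp_ofLp 2 q, he, norm_eq_zero.1 h2, norm_eq_zero.1 h3, map_zero, map_zero,
        add_zero]
    have h1 := hpos B hB0
    have hBc : Continuous B := B.continuous_of_finiteDimensional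
    have hmeas : Measurable fun y ↦ (‖B y‖ ^ m)⁻¹ * g y :=
      ((hBc.norm.pow m).measurable.inv).mul hg.continuous.measurable
    rw [← hmp.map_eq, integral_map hmp.measurable.aemeasurable hmeas.aestronglyMeasurable] at h1
    refine h1.trans_eq (integral_congr_ae (.of_forall fun p ↦ ?_))
    simp only [← hB p, Real.sqrt_sq (norm_nonneg _)]

theorem abs_sub_pow_le_abs_pow_sub {a b : ℝ} (ha : 0 ≤ a) (hb : 0 ≤ b) {m : ℕ} (hm : m ≠ 0) :
    |a - b| ^ m ≤ |a ^ m - b ^ m| := by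
  wlog hab : b ≤ a generalizing a b
  · rw [abs_sub_comm, abs_sub_comm (a ^ m)]
    exact this hb ha (le_of_not_ge hab)
  have h1 := pow_add_pow_le (sub_nonneg.2 hab) hb hm
  rw [sub_add_cancel] at h1
  rw [abs_of_nonneg (sub_nonneg.2 hab)]
  exact le_trans (by linarith) (le_abs_self _)

theorem IsGenIntBody.sphereInvPow_mem_closure {n m : ℕ} (hm : m ≠ 0) (hmn : m < n) {K : Set (Euc n)}
    (hK : IsGenIntBody n m K) : hK.1.isRadialGauge.sphereInvPow m ∈
      closure (intersectionCone hm hmn : Set C(sphere (0 : Euc n) 1, ℝ)) := by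
  obtain ⟨hKs, -, ν, -, -, hνpos, -, hνK⟩ := hK
  have hN := hKs.isRadialGauge
  by_contra hnot
  obtain ⟨Λ, hneg, hΛ⟩ := ConvexCone.exists_nonneg_of_notMem_closure (intersectionCone hm hmn)
    ⟨_, ellipsoid_mem_intersectionCone hm hmn LinearMap.id (fun _ h ↦ h)
      ((isRadialGauge_norm_comp LinearMap.id fun _ h ↦ h).sphereInvPow m) fun _ ↦ rfl⟩ hnot
  obtain ⟨g, hg, hgK, hgB⟩ := exists_shell_density_separating hN Λ hneg fun B hB ↦
    hΛ _ (ellipsoid_mem_intersectionCone hm hmn B hB _ fun _ ↦ rfl)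
  obtain ⟨c, hc, hcR⟩ := exists_pos_integral_eq_mul_sphRadon n (k := n - m) (by omega)
  have h1 := hνpos (radialIntegral (n - m) g) (continuous_radialIntegral _ hg.continuous)
    fun H ↦ by
      obtain ⟨ι, hι⟩ := exists_linearIsometry_range_eq H.1 H.2
      have h2 := hg.integral_comp_nonneg hm hmn.le hgB H.2 ι hι
      rw [hcR g hg H ι hι] at h2
      exact nonneg_of_mul_nonneg_right h2 hc
  rw [← hνK _ (continuous_radialIntegral _ hg.continuous)] at h1
  obtain ⟨h, hh⟩ := hN.exists_continuousMap_eq_inv_pow (m := m)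
  have hshell : IsShellFunction fun y ↦ h y * g y :=
    ⟨h.continuous.mul hg.continuous, fun y hy ↦ by rw [hg.eq_zero y hy, mul_zero]⟩
  have : Nontrivial (Euc n) := Module.nontrivial_of_finrank_pos (R := ℝ) (by simp; omega)
  obtain ⟨c', hc', hcS⟩ := exists_pos_integral_eq_mul_hausdorffMeasure_sphere (F := Euc n)
  rw [finrank_euclideanSpace_fin] at hcS
  have h3 : ∫ y, (gauge K y ^ m)⁻¹ * g y = ∫ y, h y * g y := by
    refine integral_congr_ae (.of_forall fun y ↦ ?_)
    by_cases hy : 1 / 2 ≤ ‖y‖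
    · simp [hh y hy]
    · simp [hg.eq_zero y fun h1 ↦ hy h1.1]
  have h4 : ∀ x ∈ sphere (0 : Euc n) 1, radialIntegral n (fun y ↦ h y * g y) x =
      radialFn K x ^ m * radialIntegral (n - m) g x := fun x hx ↦ by
    rw [radialIntegral, radialIntegral, ← integral_const_mul]
    refine setIntegral_congr_fun measurableSet_Icc fun r hr ↦ ?_
    have hr0 : 0 < r := lt_of_lt_of_le (by norm_num) hr.1
    have hx1 : ‖x‖ = 1 := by simpa using hx
    have h5 : n - 1 = (n - m - 1) + m := by omega
    rw [hh (r • x) (by rw [norm_smul, hx1, mul_one, Real.norm_of_nonneg hr0.le]; exact hr.1),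
      hN.smul _ _ hr0.le, radialFn, h5, pow_add, mul_pow,
      inv_pow]
    field_simp
  rw [h3, hcS _ hshell, setIntegral_congr_fun isClosed_sphere.measurableSet h4] at hgK
  nlinarith

/-- **Every generalized m-intersection body is an m-intersection body.** -/
theorem genIntBody_isKIntBody (n m : ℕ) (hm : 1 ≤ m) (hmn : m ≤ n - 1)
    (K : Set (Euc n)) (hK : IsGenIntBody n m K) : IsKIntBody n m K := by
  have hm0 : m ≠ 0 := by omega
  have hmn' : m < n := by omega
  refine ⟨hK.1, fun ε hε ↦ ?_⟩
  obtain ⟨p, ⟨N₁, N₂, h₁, h₂, hp, hI⟩, hdist⟩ :=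
    Metric.mem_closure_iff.1 (hK.sphereInvPow_mem_closure hm0 hmn') (ε ^ m) (by positivity)
  refine ⟨_, _, h₁.isStarBody, h₂.isStarBody, hI, fun ξ hξ ↦ ?_⟩
  refine le_of_pow_le_pow_left₀ hm0 hε.le ((abs_sub_pow_le_abs_pow_sub ?_ ?_ hm0).trans ?_)
  · exact inv_nonneg.2 (gauge_nonneg _)
  · exact inv_nonneg.2 (gauge_nonneg _)
  · have h3 := (ContinuousMap.dist_apply_le_dist (⟨ξ, hξ⟩ : sphere (0 : Euc n) 1)).trans hdist.le
    rw [hp, Real.dist_eq] at h3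
    rw [h₁.radialFn_sublevel, radialFn, inv_pow, inv_pow]
    exact h3

end
end

section
/- For every 1 ≤ m ≤ n−1, every intersection body in ℝⁿ is a generalized m-intersection body. -/
open MeasureTheory Metric Module
open scoped ENNReal FourierTransform RealInnerProductSpace Pointwise

noncomputable section

lemma measurePreserving_orthogonal_add_smul {E : Type*} [NormedAddCommGroup E]
    [InnerProductSpace ℝ E] [FiniteDimensional ℝ E] [MeasurableSpace E] [BorelSpace E]
    (u : E) (hu : ‖u‖ = 1) :
    MeasurePreserving (fun p : ↥((ℝ ∙ u)ᗮ) × ℝ => (p.1 : E) + p.2 • u)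
      ((volume : Measure ↥((ℝ ∙ u)ᗮ)).prod (volume : Measure ℝ)) volume := by
  have h1 := ((LinearIsometryEquiv.toSpanUnitSingleton (𝕜 := ℝ) u hu).measurePreserving).prod
    (MeasurePreserving.id (volume : Measure ↥((ℝ ∙ u)ᗮ)))
  have h2 := (WithLp.volume_preserving_toLp (↥(ℝ ∙ u)) (↥((ℝ ∙ u)ᗮ)))
  have h3 := ((ℝ ∙ u).orthogonalDecomposition.symm).measurePreserving
  have h0 := Measure.measurePreserving_swap (μ := (volume : Measure ↥((ℝ ∙ u)ᗮ)))
    (ν := (volume : Measure ℝ))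
  have := h3.comp (h2.comp (h1.comp h0))
  have heq : (fun p : ↥((ℝ ∙ u)ᗮ) × ℝ => (p.1 : E) + p.2 • u) =
      (ℝ ∙ u).orthogonalDecomposition.symm ∘ WithLp.toLp 2 ∘
        Prod.map (LinearIsometryEquiv.toSpanUnitSingleton (𝕜 := ℝ) u hu) id ∘ Prod.swap := by
    ext p
    simp [add_comm]
  rw [heq]
  exact this

lemma volume_oblique_cylinder {E : Type*} [NormedAddCommGroup E]
    [InnerProductSpace ℝ E] [FiniteDimensional ℝ E] [MeasurableSpace E] [BorelSpace E]
    (u e : E) (hu : ‖u‖ = 1) (he : ‖e‖ = 1) (hue : ⟪u, e⟫ ≠ 0) (L : Set E)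
    (hL : MeasurableSet L) :
    volume {z : E | z - (⟪u, z⟫ / ⟪u, e⟫) • e ∈ L ∧ ⟪e, z⟫ ∈ Set.Icc (0 : ℝ) 1} =
      ENNReal.ofReal |⟪u, e⟫| * volume ((↑) ⁻¹' L : Set ↥((ℝ ∙ u)ᗮ)) := by
  set a := ⟪u, e⟫ with ha
  have huu : ⟪u, u⟫ = 1 := by rw [real_inner_self_eq_norm_sq, hu]; norm_num
  have hee : ⟪e, e⟫ = 1 := by rw [real_inner_self_eq_norm_sq, he]; norm_num
  have hq : u - a⁻¹ • e ∈ (ℝ ∙ u)ᗮ := by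
    rw [Submodule.mem_orthogonal_singleton_iff_inner_right, inner_sub_right, inner_smul_right,
      huu, ← ha, inv_mul_cancel₀ hue, sub_self]
  set q : ↥((ℝ ∙ u)ᗮ) := ⟨u - a⁻¹ • e, hq⟩ with hqdef
  have hmA : MeasurableSet
      {z : E | z - (⟪u, z⟫ / a) • e ∈ L ∧ ⟪e, z⟫ ∈ Set.Icc (0 : ℝ) 1} := by
    apply MeasurableSet.inter
    · exact (by fun_prop : Measurable fun z : E => z - (⟪u, z⟫ / a) • e) hL
    · exact (by fun_prop : Measurable fun z : E => ⟪e, z⟫) measurableSet_Icc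
  rw [← (measurePreserving_orthogonal_add_smul u hu).measure_preimage hmA.nullMeasurableSet]
  have hset : ((fun p : ↥((ℝ ∙ u)ᗮ) × ℝ => (p.1 : E) + p.2 • u) ⁻¹'
      {z : E | z - (⟪u, z⟫ / a) • e ∈ L ∧ ⟪e, z⟫ ∈ Set.Icc (0 : ℝ) 1}) =
      {p | ((p.1 + p.2 • q : ↥((ℝ ∙ u)ᗮ)) : E) ∈ L ∧
        ⟪e, ((p.1 + p.2 • q : ↥((ℝ ∙ u)ᗮ)) : E)⟫ + p.2 / a ∈ Set.Icc (0 : ℝ) 1} := by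
    ext ⟨w, s⟩
    have hw : ⟪u, (w : E)⟫ = 0 := Submodule.mem_orthogonal_singleton_iff_inner_right.1 w.2
    have h1 : (w : E) + s • u - (⟪u, (w : E) + s • u⟫ / a) • e
        = ((w + s • q : ↥((ℝ ∙ u)ᗮ)) : E) := by
      simp only [hqdef, Submodule.coe_add, Submodule.coe_smul, inner_add_right, inner_smul_right,
        hw, huu]
      module
    have h2 : ⟪e, (w : E) + s • u⟫ = ⟪e, ((w + s • q : ↥((ℝ ∙ u)ᗮ)) : E)⟫ + s / a := by
      simp only [hqdef, Submodule.coe_add, Submodule.coe_smul, inner_add_right, inner_sub_right,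
        inner_smul_right, hee]
      field_simp
      ring
    simp only [Set.mem_preimage, Set.mem_ofPred_eq, h1, h2]
  rw [hset]
  have hm1 : MeasurableSet {p : ↥((ℝ ∙ u)ᗮ) × ℝ | (p.1 : E) ∈ L ∧
      ⟪e, (p.1 : E)⟫ + p.2 / a ∈ Set.Icc (0 : ℝ) 1} := by
    apply MeasurableSet.inter
    · exact (by fun_prop : Measurable fun p : ↥((ℝ ∙ u)ᗮ) × ℝ => (p.1 : E)) hL
    · exact (by fun_prop : Measurable fun p : ↥((ℝ ∙ u)ᗮ) × ℝ => ⟪e, (p.1 : E)⟫ + p.2 / a)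
        measurableSet_Icc
  have hm2 : MeasurableSet {p : ↥((ℝ ∙ u)ᗮ) × ℝ | ((p.1 + p.2 • q : ↥((ℝ ∙ u)ᗮ)) : E) ∈ L ∧
        ⟪e, ((p.1 + p.2 • q : ↥((ℝ ∙ u)ᗮ)) : E)⟫ + p.2 / a ∈ Set.Icc (0 : ℝ) 1} :=
    (by fun_prop : Measurable fun p : ↥((ℝ ∙ u)ᗮ) × ℝ => (p.1 + p.2 • q, p.2)) hm1
  rw [Measure.prod_apply_symm hm2]
  have hshift : ∀ s : ℝ, volume ((fun w : ↥((ℝ ∙ u)ᗮ) => (w, s)) ⁻¹'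
      {p | ((p.1 + p.2 • q : ↥((ℝ ∙ u)ᗮ)) : E) ∈ L ∧
        ⟪e, ((p.1 + p.2 • q : ↥((ℝ ∙ u)ᗮ)) : E)⟫ + p.2 / a ∈ Set.Icc (0 : ℝ) 1}) =
      volume ((fun w : ↥((ℝ ∙ u)ᗮ) => (w, s)) ⁻¹' {p | (p.1 : E) ∈ L ∧
        ⟪e, (p.1 : E)⟫ + p.2 / a ∈ Set.Icc (0 : ℝ) 1}) := by
    intro s
    exact measure_preimage_add_right volume (s • q)
      ((fun w : ↥((ℝ ∙ u)ᗮ) => (w, s)) ⁻¹' {p | (p.1 : E) ∈ L ∧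
        ⟪e, (p.1 : E)⟫ + p.2 / a ∈ Set.Icc (0 : ℝ) 1})
  simp_rw [hshift]
  rw [← Measure.prod_apply_symm hm1, Measure.prod_apply hm1]
  have hfib : ∀ w : ↥((ℝ ∙ u)ᗮ), volume (Prod.mk w ⁻¹' {p : ↥((ℝ ∙ u)ᗮ) × ℝ | (p.1 : E) ∈ L ∧
      ⟪e, (p.1 : E)⟫ + p.2 / a ∈ Set.Icc (0 : ℝ) 1}) =
      Set.indicator ((↑) ⁻¹' L) (fun _ => ENNReal.ofReal |a|) w := by
    intro w
    by_cases hw : (w : E) ∈ L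
    · rw [Set.indicator_of_mem (by exact hw)]
      have : (Prod.mk w ⁻¹' {p : ↥((ℝ ∙ u)ᗮ) × ℝ | (p.1 : E) ∈ L ∧
          ⟪e, (p.1 : E)⟫ + p.2 / a ∈ Set.Icc (0 : ℝ) 1}) =
          (fun s : ℝ => s * a⁻¹) ⁻¹' ((fun s => ⟪e, (w : E)⟫ + s) ⁻¹' Set.Icc (0 : ℝ) 1) := by
        ext s
        simp only [Set.mem_preimage, Set.mem_ofPred_eq, hw, true_and, div_eq_mul_inv]
      rw [this, Real.volume_preimage_mul_right (inv_ne_zero hue), measure_preimage_add]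
      simp
    · rw [Set.indicator_of_notMem (by exact hw)]
      convert measure_empty (μ := (volume : Measure ℝ))
      ext s
      simp [hw]
  simp_rw [hfib]
  rw [lintegral_indicator (measurable_subtype_coe hL), setLIntegral_const]

lemma exists_integral_eq_mul_integral_comp {E F : Type*} [NormedAddCommGroup E] [NormedSpace ℝ E]
    [FiniteDimensional ℝ E] [MeasurableSpace E] [BorelSpace E] [NormedAddCommGroup F]
    [NormedSpace ℝ F] [MeasurableSpace F] [BorelSpace F]
    (μ : Measure E) [μ.IsAddHaarMeasure] (ν : Measure F) [ν.IsAddHaarMeasure] (e : E ≃ₗ[ℝ] F) :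
    ∃ c : ℝ, 0 < c ∧ ∀ f : F → ℝ, ∫ y, f y ∂ν = c * ∫ x, f (e x) ∂μ := by
  have : FiniteDimensional ℝ F := e.finiteDimensional
  have he : ν = Measure.addHaarScalarFactor ν (μ.map e) • μ.map e :=
    Measure.isAddLeftInvariant_eq_smul ν (μ.map e)
  refine ⟨Measure.addHaarScalarFactor ν (μ.map e), ?_, fun f => ?_⟩
  · exact_mod_cast Measure.addHaarScalarFactor_pos_of_isAddHaarMeasure ν (μ.map e)
  · conv_lhs => rw [he]
    rw [integral_smul_nnreal_measure]
    have : MeasurableEmbedding e :=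
      (e.toContinuousLinearEquiv.toHomeomorph).measurableEmbedding
    rw [this.integral_map]
    rfl

lemma integral_section_weight_nonneg {E : Type*} [NormedAddCommGroup E]
    [InnerProductSpace ℝ E] [FiniteDimensional ℝ E] [MeasurableSpace E] [BorelSpace E]
    (Q : E → ℝ) (hQ : Measurable Q) (χ : ℝ → ℝ) (hχ : Measurable χ) (hχ0 : ∀ t, 0 ≤ χ t)
    (H : Submodule ℝ E)
    (hyp : ∀ H' : Submodule ℝ E, finrank ℝ H' + 1 = finrank ℝ H →
      0 ≤ ∫ x : H', ‖(x : E)‖ * Q x)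
    (e p z : E) (heH : e ∈ H) (hpH : p ∈ H) (he : ‖e‖ = 1) (hpe : ⟪p, e⟫ = 0)
    (hpz : ⟪p, z⟫ = 1) :
    0 ≤ ∫ x : H, Q x * (‖(x : E)‖ / |⟪(x : E), e⟫|) * χ (⟪(x : E), z⟫ / ⟪(x : E), e⟫) := by
  have hee : ⟪e, e⟫ = 1 := by rw [real_inner_self_eq_norm_sq, he]; norm_num
  set V : Submodule ℝ E := H ⊓ (ℝ ∙ e)ᗮ ⊓ (ℝ ∙ z)ᗮ with hV
  set b := ⟪e, z⟫ with hb
  have hVH : ∀ v : V, (v : E) ∈ H := fun v => v.2.1.1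
  have hVe : ∀ v : V, ⟪(v : E), e⟫ = 0 := fun v =>
    Submodule.mem_orthogonal_singleton_iff_inner_left.1 v.2.1.2
  have hVz : ∀ v : V, ⟪(v : E), z⟫ = 0 := fun v =>
    Submodule.mem_orthogonal_singleton_iff_inner_left.1 v.2.2
  let ψ : ((V × ℝ) × ℝ) ≃ₗ[ℝ] H :=
    { toFun := fun y => ⟨(y.1.1 : E) + y.1.2 • e + y.2 • p,
        H.add_mem (H.add_mem (hVH _) (H.smul_mem _ heH)) (H.smul_mem _ hpH)⟩
      map_add' := fun y y' => by
        apply Subtype.ext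
        simp only [Prod.fst_add, Prod.snd_add, Submodule.coe_add]
        module
      map_smul' := fun r y => by
        apply Subtype.ext
        simp only [Prod.smul_fst, Prod.smul_snd, Submodule.coe_smul, RingHom.id_apply, smul_eq_mul]
        module
      invFun := fun x => ((⟨(x : E) - ⟪(x : E), e⟫ • e - (⟪(x : E), z⟫ - ⟪(x : E), e⟫ * b) • p, by
        refine ⟨⟨?_, ?_⟩, ?_⟩
        · exact H.sub_mem (H.sub_mem x.2 (H.smul_mem _ heH)) (H.smul_mem _ hpH)
        · apply Submodule.mem_orthogonal_singleton_iff_inner_left.2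
          simp only [inner_sub_left, real_inner_smul_left, hee, hpe]
          ring
        · apply Submodule.mem_orthogonal_singleton_iff_inner_left.2
          simp only [inner_sub_left, real_inner_smul_left, hpz, ← hb]
          ring⟩, ⟪(x : E), e⟫), ⟪(x : E), z⟫ - ⟪(x : E), e⟫ * b)
      left_inv := fun y => by
        have h1 : ⟪(y.1.1 : E) + y.1.2 • e + y.2 • p, e⟫ = y.1.2 := by
          simp only [inner_add_left, real_inner_smul_left, hee, hpe, hVe]
          ring
        have h2 : ⟪(y.1.1 : E) + y.1.2 • e + y.2 • p, z⟫ - y.1.2 * b = y.2 := by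
          simp only [inner_add_left, real_inner_smul_left, hpz, hVz, ← hb]
          ring
        refine Prod.ext (Prod.ext (Subtype.ext ?_) ?_) ?_
        · simp only [h1, h2]
          module
        · exact h1
        · simp only [h1, h2]
      right_inv := fun x => by
        apply Subtype.ext
        simp only
        module }
  have hψ : ∀ y, ((ψ y : H) : E) = (y.1.1 : E) + y.1.2 • e + y.2 • p := fun y => rfl
  have hi1 : ((volume : Measure V).prod (volume : Measure ℝ)).IsAddHaarMeasure := inferInstance
  have hi2 : (((volume : Measure V).prod (volume : Measure ℝ)).prod
      (volume : Measure ℝ)).IsAddHaarMeasure := Measure.prod.instIsAddHaarMeasure _ _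
  obtain ⟨c, hc, hcint⟩ := exists_integral_eq_mul_integral_comp
    (((volume : Measure V).prod (volume : Measure ℝ)).prod (volume : Measure ℝ))
    (volume : Measure H) ψ
  rw [hcint]
  refine mul_nonneg hc.le ?_
  set F : (V × ℝ) × ℝ → ℝ := fun y => Q (ψ y) * (‖(ψ y : E)‖ / |⟪(ψ y : E), e⟫|) *
    χ (⟪(ψ y : E), z⟫ / ⟪(ψ y : E), e⟫) with hF
  set q : (V × ℝ) × ℝ → ℝ := fun y => χ (b + y.2) *
    (‖(y.1.1 : E) + y.1.2 • (e + y.2 • p)‖ * Q ((y.1.1 : E) + y.1.2 • (e + y.2 • p))) with hq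
  have hqm : Measurable q := by
    have h1 : Measurable fun y : (V × ℝ) × ℝ => (y.1.1 : E) + y.1.2 • (e + y.2 • p) := by fun_prop
    have h2 : Measurable fun y : (V × ℝ) × ℝ => b + y.2 := by fun_prop
    exact (hχ.comp h2).mul (h1.norm.mul (hQ.comp h1))
  have hFq : ∀ (w : V × ℝ) (t : ℝ), w.2 ≠ 0 → q (w, t) = |w.2| * F (w, t * w.2) := by
    rintro ⟨v, s⟩ t hs
    simp only at hs
    have h0 : ((ψ ((v, s), t * s) : H) : E) = (v : E) + s • (e + t • p) := by
      rw [hψ]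
      simp only
      module
    have h1 : ⟪(v : E) + s • (e + t • p), e⟫ = s := by
      simp only [inner_add_left, real_inner_smul_left, hee, hpe, hVe]
      ring
    have h2 : ⟪(v : E) + s • (e + t • p), z⟫ = (b + t) * s := by
      simp only [inner_add_left, real_inner_smul_left, hpz, hVz, ← hb]
      ring
    simp only [hF, hq, h0, h1, h2]
    rw [mul_div_cancel_right₀ _ hs]
    have : |s| ≠ 0 := abs_ne_zero.2 hs
    field_simp
  have hs0 : ∀ᵐ w : V × ℝ ∂((volume : Measure V).prod (volume : Measure ℝ)), w.2 ≠ 0 := by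
    have : ∀ᵐ s : ℝ, s ≠ 0 := by simp [ae_iff]
    exact Measure.quasiMeasurePreserving_snd.ae this
  by_cases hFi : Integrable F (((volume : Measure V).prod (volume : Measure ℝ)).prod volume)
  swap
  · exact (integral_undef hFi).ge
  have hsub : ∀ᵐ w : V × ℝ ∂((volume : Measure V).prod (volume : Measure ℝ)),
      ∫ t, q (w, t) = ∫ τ, F (w, τ) := by
    filter_upwards [hs0] with w hw
    simp_rw [hFq w _ hw]
    rw [integral_const_mul, Measure.integral_comp_mul_right (fun τ => F (w, τ)) w.2, abs_inv,
      smul_eq_mul, mul_inv_cancel_left₀ (abs_ne_zero.2 hw)]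
  have hsubn : ∀ᵐ w : V × ℝ ∂((volume : Measure V).prod (volume : Measure ℝ)),
      ∫ τ, ‖F (w, τ)‖ = ∫ t, ‖q (w, t)‖ := by
    filter_upwards [hs0] with w hw
    simp_rw [hFq w _ hw, norm_mul]
    rw [integral_const_mul, Measure.integral_comp_mul_right (fun τ => ‖F (w, τ)‖) w.2, abs_inv,
      smul_eq_mul, Real.norm_eq_abs, abs_abs, mul_inv_cancel_left₀ (abs_ne_zero.2 hw)]
  have hqi : Integrable q (((volume : Measure V).prod (volume : Measure ℝ)).prod volume) := by
    obtain ⟨hF1, hF2⟩ := (integrable_prod_iff hFi.aestronglyMeasurable).1 hFi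
    refine (integrable_prod_iff hqm.aestronglyMeasurable).2 ⟨?_, hF2.congr hsubn⟩
    filter_upwards [hF1, hs0] with w hw1 hw
    simp_rw [hFq w _ hw]
    exact (hw1.comp_mul_right' hw).const_mul _
  rw [integral_prod _ hFi, ← integral_congr_ae hsub, ← integral_prod _ hqi,
    integral_prod_symm _ hqi]
  refine integral_nonneg fun t => ?_
  simp only [hq]
  rw [integral_const_mul]
  refine mul_nonneg (hχ0 _) ?_
  let f : (V × ℝ) →ₗ[ℝ] E :=
    V.subtype.comp (LinearMap.fst ℝ V ℝ) +
      (LinearMap.toSpanSingleton ℝ E (e + t • p)).comp (LinearMap.snd ℝ V ℝ)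
  have hf : ∀ w, f w = (w.1 : E) + w.2 • (e + t • p) := fun w => rfl
  have hfinj : Function.Injective f := by
    rw [← LinearMap.ker_eq_bot, LinearMap.ker_eq_bot']
    intro w hw
    have h1 : ⟪f w, e⟫ = w.2 := by
      simp only [hf, inner_add_left, real_inner_smul_left, hee, hpe, hVe]
      ring
    have h2 : w.2 = 0 := by rw [← h1, hw, inner_zero_left]
    refine Prod.ext (Subtype.ext ?_) h2
    simpa [hf, h2] using hw
  obtain ⟨c', hc', hcint'⟩ := exists_integral_eq_mul_integral_comp
    ((volume : Measure V).prod (volume : Measure ℝ))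
    (volume : Measure (LinearMap.range f)) (LinearEquiv.ofInjective f hfinj)
  have hdim : finrank ℝ (LinearMap.range f) + 1 = finrank ℝ H := by
    rw [← (LinearEquiv.ofInjective f hfinj).finrank_eq, ← ψ.finrank_eq]
    simp
  have h3 := hyp _ hdim
  rw [hcint'] at h3
  exact (mul_nonneg_iff_of_pos_left hc').1 h3

lemma exists_mem_orthogonal_unit_of_two_le_finrank {E : Type*} [NormedAddCommGroup E]
    [InnerProductSpace ℝ E] [FiniteDimensional ℝ E] (H : Submodule ℝ E)
    (hH : 2 ≤ finrank ℝ H) :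
    ∃ e p : E, e ∈ H ∧ p ∈ H ∧ ‖e‖ = 1 ∧ ⟪p, e⟫ = 0 ∧ p ≠ 0 := by
  let b := stdOrthonormalBasis ℝ H
  have h01 : (⟨0, by omega⟩ : Fin (finrank ℝ H)) ≠ ⟨1, by omega⟩ := by simp
  refine ⟨b ⟨0, by omega⟩, b ⟨1, by omega⟩, Subtype.mem _, Subtype.mem _, ?_, ?_, ?_⟩
  · exact b.orthonormal.1 _
  · exact b.orthonormal.2 h01.symm
  · intro h
    have := b.orthonormal.1 ⟨1, by omega⟩
    rw [Submodule.coe_norm, h, norm_zero] at this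
    exact zero_ne_one this

lemma ae_inner_ne_zero {E : Type*} [NormedAddCommGroup E]
    [InnerProductSpace ℝ E] [FiniteDimensional ℝ E] [MeasurableSpace E] [BorelSpace E]
    (p : E) (hp : p ≠ 0) : ∀ᵐ z : E, ⟪p, z⟫ ≠ 0 := by
  have h : ((ℝ ∙ p)ᗮ : Submodule ℝ E) ≠ ⊤ := by
    intro h
    have : p ∈ (ℝ ∙ p)ᗮ := h ▸ Submodule.mem_top
    rw [Submodule.mem_orthogonal_singleton_iff_inner_right] at this
    exact hp (inner_self_eq_zero.1 this)
  have h2 := Measure.addHaar_submodule (volume : Measure E) _ h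
  rw [ae_iff]
  convert h2 using 2
  ext z
  simp [Submodule.mem_orthogonal_singleton_iff_inner_right]

lemma integral_mul_section_nonneg {E : Type*} [NormedAddCommGroup E]
    [InnerProductSpace ℝ E] [FiniteDimensional ℝ E] [MeasurableSpace E] [BorelSpace E]
    (L : Set E) (hL : MeasurableSet L) (C : ℝ) (hC : 0 ≤ C) (ρ : E → ℝ)
    (hρ : ∀ x e : E, ‖e‖ = 1 → ⟪x, e⟫ ≠ 0 →
      volume {z : E | z - (⟪x, z⟫ / ⟪x, e⟫) • e ∈ L ∧ ⟪e, z⟫ ∈ Set.Icc (0 : ℝ) 1} < ⊤ ∧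
      ρ x = C * ((‖x‖ / |⟪x, e⟫|) * volume.real
        {z : E | z - (⟪x, z⟫ / ⟪x, e⟫) • e ∈ L ∧ ⟪e, z⟫ ∈ Set.Icc (0 : ℝ) 1}))
    (Q : E → ℝ) (hQ : Measurable Q) (H : Submodule ℝ E) (hH : 2 ≤ finrank ℝ H)
    (hi : Integrable (fun x : H => Q x * ρ x))
    (hyp : ∀ H' : Submodule ℝ E, finrank ℝ H' + 1 = finrank ℝ H →
      0 ≤ ∫ x : H', ‖(x : E)‖ * Q x) :
    0 ≤ ∫ x : H, Q x * ρ x := by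
  rcases hC.eq_or_lt with rfl | hC
  · refine (integral_eq_zero_of_ae ?_).ge
    obtain ⟨e, p, heH, -, he, -⟩ := exists_mem_orthogonal_unit_of_two_le_finrank H hH
    have h1 : (⟨e, heH⟩ : H) ≠ 0 := by
      intro h
      rw [show e = 0 from congrArg Subtype.val h, norm_zero] at he
      exact zero_ne_one he
    filter_upwards [ae_inner_ne_zero (⟨e, heH⟩ : H) h1] with x hx
    have hx' : ⟪(x : E), e⟫ ≠ 0 := by rw [real_inner_comm]; exact hx
    simp [(hρ x e he hx').2]
  obtain ⟨e, p, heH, hpH, he, hpe, hp0⟩ := exists_mem_orthogonal_unit_of_two_le_finrank H hH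
  have he0 : (⟨e, heH⟩ : H) ≠ 0 := by
    intro h
    rw [show e = 0 from congrArg Subtype.val h, norm_zero] at he
    exact zero_ne_one he
  have hxe : ∀ᵐ x : H, ⟪(x : E), e⟫ ≠ 0 := by
    filter_upwards [ae_inner_ne_zero (⟨e, heH⟩ : H) he0] with x hx
    rw [real_inner_comm]
    exact hx
  set A : Set (H × E) := {y | y.2 - (⟪(y.1 : E), y.2⟫ / ⟪(y.1 : E), e⟫) • e ∈ L ∧
    ⟪e, y.2⟫ ∈ Set.Icc (0 : ℝ) 1} with hA
  have hAm : MeasurableSet A := by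
    have h1 : Measurable fun y : H × E =>
        y.2 - (⟪(y.1 : E), y.2⟫ / ⟪(y.1 : E), e⟫) • e := by
      refine measurable_snd.sub (Measurable.smul_const (Measurable.div ?_ ?_) e)
      · fun_prop
      · fun_prop
    have h2 : Measurable fun y : H × E => ⟪e, y.2⟫ := by fun_prop
    exact (h1 hL).inter (h2 measurableSet_Icc)
  set w : H → ℝ := fun x => Q x * (‖(x : E)‖ / |⟪(x : E), e⟫|) with hw
  have hwm : Measurable w := by
    refine (hQ.comp measurable_subtype_coe).mul (Measurable.div ?_ (Measurable.abs ?_))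
    · fun_prop
    · fun_prop
  set f : H × E → ℝ := fun y => w y.1 * A.indicator (fun _ => (1 : ℝ)) y with hf
  have hfm : Measurable f :=
    (hwm.comp measurable_fst).mul (measurable_const.indicator hAm)
  have hfib : ∀ x : H, (fun z => A.indicator (fun _ => (1 : ℝ)) (x, z)) =
      {z : E | z - (⟪(x : E), z⟫ / ⟪(x : E), e⟫) • e ∈ L ∧
        ⟪e, z⟫ ∈ Set.Icc (0 : ℝ) 1}.indicator (fun _ => (1 : ℝ)) := fun x => rfl
  have hfibm : ∀ x : H, MeasurableSet {z : E | z - (⟪(x : E), z⟫ / ⟪(x : E), e⟫) • e ∈ L ∧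
        ⟪e, z⟫ ∈ Set.Icc (0 : ℝ) 1} := fun x => measurable_prodMk_left (x := x) hAm
  have hval : ∀ᵐ x : H, C * ∫ z, f (x, z) = Q x * ρ x := by
    filter_upwards [hxe] with x hx
    simp only [hf]
    rw [integral_const_mul, hfib, integral_indicator_const _ (hfibm x), (hρ x e he hx).2]
    simp only [hw, smul_eq_mul]
    ring
  have hfi : Integrable f ((volume : Measure H).prod (volume : Measure E)) := by
    refine (integrable_prod_iff hfm.aestronglyMeasurable).2 ⟨?_, ?_⟩
    · filter_upwards [hxe] with x hx
      simp only [hf]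
      refine Integrable.const_mul ?_ _
      rw [hfib]
      exact (integrable_indicator_iff (hfibm x)).2
        (integrableOn_const (hρ x e he hx).1.ne)
    · refine ((hi.norm).const_mul C⁻¹).congr ?_
      filter_upwards [hval] with x hx
      have h1 : ∀ z, ‖f (x, z)‖ = |w x| * A.indicator (fun _ => (1 : ℝ)) (x, z) := by
        intro z
        simp only [hf, norm_mul, Real.norm_eq_abs]
        rw [abs_of_nonneg (Set.indicator_nonneg (fun _ _ => zero_le_one) _)]
      have h2 : ∀ z, f (x, z) = w x * A.indicator (fun _ => (1 : ℝ)) (x, z) := fun z => rfl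
      have h3 : 0 ≤ ∫ z, A.indicator (fun _ => (1 : ℝ)) (x, z) :=
        integral_nonneg fun z => Set.indicator_nonneg (fun _ _ => zero_le_one) _
      simp_rw [h1]
      rw [← hx]
      simp_rw [h2]
      rw [integral_const_mul, integral_const_mul, norm_mul, norm_mul, Real.norm_eq_abs,
        Real.norm_eq_abs, Real.norm_eq_abs, abs_of_pos hC, abs_of_nonneg h3,
        inv_mul_cancel_left₀ hC.ne']
  rw [← integral_congr_ae hval, integral_const_mul]
  refine mul_nonneg hC.le ?_
  rw [integral_integral_swap (f := fun x z => f (x, z)) hfi]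
  refine integral_nonneg_of_ae ?_
  filter_upwards [ae_inner_ne_zero p hp0] with z hz
  have key := integral_section_weight_nonneg Q hQ
    ({t : ℝ | z - t • e ∈ L ∧ ⟪e, z⟫ ∈ Set.Icc (0 : ℝ) 1}.indicator (fun _ => (1 : ℝ)))
    (measurable_const.indicator (by
      refine MeasurableSet.inter ?_ (MeasurableSet.const _)
      exact (by fun_prop : Measurable fun t : ℝ => z - t • e) hL))
    (fun t => Set.indicator_nonneg (fun _ _ => zero_le_one) _) H hyp e (⟪p, z⟫⁻¹ • p) z heH
    (H.smul_mem _ hpH) he (by rw [real_inner_smul_left, hpe, mul_zero])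
    (by rw [real_inner_smul_left, inv_mul_cancel₀ hz])
  exact key

lemma hausdorffMeasure_sphere_lt_top_s16 {E : Type*} [NormedAddCommGroup E]
    [InnerProductSpace ℝ E] [FiniteDimensional ℝ E] [MeasurableSpace E] [BorelSpace E]
    {k : ℕ} (hk : finrank ℝ E = k + 1) : μH[(k : ℝ)] (sphere (0 : E) 1) < ⊤ := by
  refine (isCompact_sphere (0 : E) 1).measure_lt_top_of_nhdsWithin fun e he => ?_
  have he1 : ‖e‖ = 1 := by simpa using he
  have he0 : e ≠ 0 := by rintro rfl; simp at he1
  have : Fact (finrank ℝ E = k + 1) := ⟨hk⟩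
  have hW : finrank ℝ ↥((ℝ ∙ e)ᗮ) = k := Submodule.finrank_orthogonal_span_singleton he0
  let φ : ↥((ℝ ∙ e)ᗮ) → E := fun y => ‖(y : E) + e‖⁻¹ • ((y : E) + e)
  have hφ : ContDiffAt ℝ 1 φ 0 := by
    have h1 : ContDiffAt ℝ 1 (fun y : ↥((ℝ ∙ e)ᗮ) => (y : E) + e) 0 :=
      (((ℝ ∙ e)ᗮ).subtypeL.contDiff.add contDiff_const).contDiffAt
    have h2 : ‖((0 : ↥((ℝ ∙ e)ᗮ)) : E) + e‖ ≠ 0 := by simp [he0]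
    exact ((h1.norm ℝ (by simpa using he0)).inv h2).smul h1
  obtain ⟨C, t, ht, hC⟩ := hφ.exists_lipschitzOnWith
  let s : Set ↥((ℝ ∙ e)ᗮ) := t ∩ closedBall 0 1
  have hs : s ∈ nhds (0 : ↥((ℝ ∙ e)ᗮ)) := Filter.inter_mem ht (closedBall_mem_nhds _ one_pos)
  refine ⟨φ '' s, ?_, ?_⟩
  · let ψ : E → ↥((ℝ ∙ e)ᗮ) := fun x => ((ℝ ∙ e)ᗮ).orthogonalProjectionOnto (⟪e, x⟫⁻¹ • x)
    have hee : ⟪e, e⟫ = 1 := by rw [real_inner_self_eq_norm_sq, he1]; norm_num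
    have hψ0 : ψ e = 0 := by
      apply Subtype.ext
      simp [ψ, Submodule.orthogonalProjectionOnto_orthogonal,
        Submodule.starProjection_unit_singleton _ he1, he1]
    have hψ : ContinuousAt ψ e := by
      refine ((ℝ ∙ e)ᗮ).orthogonalProjectionOnto.continuous.continuousAt.comp ?_
      exact ((by fun_prop : Continuous fun x : E => ⟪e, x⟫).continuousAt.inv₀
        (by simp [he0])).smul continuousAt_id
    have h1 : ψ ⁻¹' s ∈ nhds e := hψ (by rw [hψ0]; exact hs)
    have h2 : {x : E | 0 < ⟪e, x⟫} ∈ nhds e :=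
      (isOpen_lt continuous_const (by fun_prop)).mem_nhds (by simp [he0])
    filter_upwards [mem_nhdsWithin_of_mem_nhds h1, mem_nhdsWithin_of_mem_nhds h2,
      self_mem_nhdsWithin] with x hx1 hx2 hx3
    have hx2 : 0 < ⟪e, x⟫ := hx2
    refine ⟨ψ x, hx1, ?_⟩
    have hx : ((ψ x : E) + e) = ⟪e, x⟫⁻¹ • x := by
      simp [ψ, Submodule.orthogonalProjectionOnto_orthogonal,
        Submodule.starProjection_unit_singleton _ he1]
      rw [smul_sub, smul_smul, inv_mul_cancel₀ hx2.ne', one_smul, sub_add_cancel]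
    have hx4 : ‖x‖ = 1 := by simpa using hx3
    simp only [φ, hx, norm_smul, hx4, smul_smul, norm_inv, Real.norm_of_nonneg hx2.le]
    simp [hx2.ne']
  · refine ((hC.mono Set.inter_subset_left).hausdorffMeasure_image_le
      (Nat.cast_nonneg k)).trans_lt ?_
    refine ENNReal.mul_lt_top (ENNReal.rpow_lt_top_of_nonneg (Nat.cast_nonneg k) (by simp)) ?_
    refine (measure_mono Set.inter_subset_right).trans_lt ?_
    conv_lhs => rw [← hW]
    exact (isCompact_closedBall _ _).measure_lt_top

lemma hausdorffMeasure_sphere_pos_s16 {E : Type*} [NormedAddCommGroup E]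
    [InnerProductSpace ℝ E] [FiniteDimensional ℝ E] [MeasurableSpace E] [BorelSpace E]
    {k : ℕ} (hk : finrank ℝ E = k + 1) : 0 < μH[(k : ℝ)] (sphere (0 : E) 1) := by
  have : Nontrivial E := Module.nontrivial_of_finrank_pos (R := ℝ) (by lia)
  obtain ⟨e, he1⟩ := exists_norm_eq E zero_le_one
  have he0 : e ≠ 0 := by rintro rfl; simp at he1
  have : Fact (finrank ℝ E = k + 1) := ⟨hk⟩
  have hW : finrank ℝ ↥((ℝ ∙ e)ᗮ) = k := Submodule.finrank_orthogonal_span_singleton he0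
  refine lt_of_lt_of_le ?_ (hausdorffMeasure_orthogonalProjectionOnto_le ((ℝ ∙ e)ᗮ) (k : ℝ)
    (sphere (0 : E) 1) (Nat.cast_nonneg k))
  have hsub : ball (0 : ↥((ℝ ∙ e)ᗮ)) 1 ⊆
      ((ℝ ∙ e)ᗮ).orthogonalProjectionOnto '' sphere (0 : E) 1 := by
    intro y hy
    have hy1 : ‖(y : E)‖ < 1 := by simpa using hy
    have hye : ⟪e, (y : E)⟫ = 0 := Submodule.mem_orthogonal_singleton_iff_inner_right.1 y.2
    have hs : 0 ≤ 1 - ‖(y : E)‖ ^ 2 := by nlinarith [norm_nonneg (y : E)]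
    refine ⟨(y : E) + √(1 - ‖(y : E)‖ ^ 2) • e, ?_, ?_⟩
    · have h1 : ‖(y : E) + √(1 - ‖(y : E)‖ ^ 2) • e‖ ^ 2 = 1 := by
        rw [norm_add_sq_real, inner_smul_right, real_inner_comm, hye, norm_smul, he1,
          Real.norm_of_nonneg (Real.sqrt_nonneg _), mul_one, Real.sq_sqrt hs]
        ring
      rw [mem_sphere_zero_iff_norm]
      exact (sq_eq_sq₀ (norm_nonneg _) zero_le_one).1 (by rw [h1, one_pow])
    · apply Subtype.ext
      have hee : ⟪e, e⟫ = 1 := by rw [real_inner_self_eq_norm_sq, he1]; norm_num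
      simp only [Submodule.orthogonalProjectionOnto_orthogonal,
        Submodule.starProjection_unit_singleton _ he1, inner_add_right, inner_smul_right, hye,
        hee]
      simp
  refine lt_of_lt_of_le ?_ (measure_mono hsub)
  conv_rhs => rw [← hW]
  exact isOpen_ball.measure_pos _ ⟨0, by simp⟩

lemma integral_indicator_dist_lt_fst {X : Type*} [MetricSpace X] [MeasurableSpace X]
    [BorelSpace X] [SecondCountableTopology X] (μ ν : Measure X) [IsFiniteMeasure μ]
    [IsFiniteMeasure ν] {S : Set X} (hμS : ∀ᵐ x ∂μ, x ∈ S) {x₀ : X} (hx₀ : x₀ ∈ S) {δ : ℝ}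
    (hν : ∀ x ∈ S, ∀ y ∈ S, ν (ball x δ) = ν (ball y δ)) {g : X → ℝ} (hg : Integrable g μ) :
    Integrable ({p : X × X | dist p.1 p.2 < δ}.indicator fun p => g p.1) (μ.prod ν) ∧
    ∫ p, {p : X × X | dist p.1 p.2 < δ}.indicator (fun p => g p.1) p ∂(μ.prod ν) =
      ν.real (ball x₀ δ) * ∫ x, g x ∂μ := by
  have hA : MeasurableSet {p : X × X | dist p.1 p.2 < δ} :=
    (isOpen_lt (by fun_prop) continuous_const).measurableSet
  have hi : Integrable ({p : X × X | dist p.1 p.2 < δ}.indicator fun p => g p.1) (μ.prod ν) :=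
    (hg.comp_fst ν).indicator hA
  refine ⟨hi, ?_⟩
  rw [integral_prod _ hi, ← integral_const_mul]
  refine integral_congr_ae ?_
  filter_upwards [hμS] with x hx
  have : (fun y => {p : X × X | dist p.1 p.2 < δ}.indicator (fun p => g p.1) (x, y)) =
      (ball x δ).indicator fun _ => g x := by
    ext y
    by_cases h : dist x y < δ
    · rw [Set.indicator_of_mem (by exact h), Set.indicator_of_mem (by rwa [mem_ball'])]
    · rw [Set.indicator_of_notMem (by exact h), Set.indicator_of_notMem (by rwa [mem_ball'])]
  simp only [this, integral_indicator_const _ measurableSet_ball, smul_eq_mul]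
  rw [measureReal_def, measureReal_def, hν x hx x₀ hx₀]

lemma integral_indicator_dist_lt_snd {X : Type*} [MetricSpace X] [MeasurableSpace X]
    [BorelSpace X] [SecondCountableTopology X] (μ ν : Measure X) [IsFiniteMeasure μ]
    [IsFiniteMeasure ν] {S : Set X} (hνS : ∀ᵐ x ∂ν, x ∈ S) {x₀ : X} (hx₀ : x₀ ∈ S) {δ : ℝ}
    (hμ : ∀ x ∈ S, ∀ y ∈ S, μ (ball x δ) = μ (ball y δ)) {g : X → ℝ} (hg : Integrable g ν) :
    Integrable ({p : X × X | dist p.1 p.2 < δ}.indicator fun p => g p.2) (μ.prod ν) ∧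
    ∫ p, {p : X × X | dist p.1 p.2 < δ}.indicator (fun p => g p.2) p ∂(μ.prod ν) =
      μ.real (ball x₀ δ) * ∫ x, g x ∂ν := by
  obtain ⟨h1, h2⟩ := integral_indicator_dist_lt_fst ν μ hνS hx₀ hμ hg
  have h : ({p : X × X | dist p.1 p.2 < δ}.indicator fun p => g p.2) =
      ({p : X × X | dist p.1 p.2 < δ}.indicator fun p => g p.1) ∘ Prod.swap := by
    ext p
    simp [Set.indicator_apply, dist_comm]
  refine ⟨by rw [h]; exact h1.swap, ?_⟩
  rw [h, ← h2]
  exact integral_prod_swap ({p : X × X | dist p.1 p.2 < δ}.indicator fun p => g p.1)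

/-- Uniqueness, up to scaling, of measures on a compact set for which all balls of the same
radius have the same measure. -/
lemma measureReal_mul_integral_eq_of_measure_ball_eq {X : Type*} [MetricSpace X]
    [MeasurableSpace X] [BorelSpace X] [SecondCountableTopology X] (μ ν : Measure X)
    [IsFiniteMeasure μ] [IsFiniteMeasure ν] {S : Set X} (hS : IsCompact S)
    (hμS : ∀ᵐ x ∂μ, x ∈ S) (hνS : ∀ᵐ x ∂ν, x ∈ S)
    (hμ : ∀ r, ∀ x ∈ S, ∀ y ∈ S, μ (ball x r) = μ (ball y r))
    (hν : ∀ r, ∀ x ∈ S, ∀ y ∈ S, ν (ball x r) = ν (ball y r)) {g : X → ℝ}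
    (hg : ContinuousOn g S) :
    ν.real Set.univ * ∫ x, g x ∂μ = μ.real Set.univ * ∫ x, g x ∂ν := by
  by_cases hμ0 : μ = 0
  · simp [hμ0]
  have hne : (S : Set X).Nonempty := by
    by_contra hS0
    rw [Set.not_nonempty_iff_eq_empty] at hS0
    apply hμ0
    rw [← Measure.measure_univ_eq_zero]
    simpa [hS0] using (ae_iff.1 hμS)
  obtain ⟨x₀, hx₀⟩ := hne
  have hintg : ∀ (κ : Measure X) [IsFiniteMeasure κ], (∀ᵐ x ∂κ, x ∈ S) → ∀ f : X → ℝ,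
      ContinuousOn f S → Integrable f κ := by
    intro κ _ hκ f hf
    rw [← Measure.restrict_eq_self_of_ae_mem hκ]
    exact hf.integrableOn_compact hS
  have key : ∀ ε > 0, |ν.real Set.univ * ∫ x, g x ∂μ - μ.real Set.univ * ∫ x, g x ∂ν| ≤
      ε * (μ.real Set.univ * ν.real Set.univ) := by
    intro ε hε
    obtain ⟨δ, hδ, hgδ⟩ := Metric.uniformContinuousOn_iff_le.1
      (hS.uniformContinuousOn_of_continuous hg) ε hε
    have hN : 0 < μ.real (ball x₀ δ) := by
      refine lt_of_le_of_ne measureReal_nonneg fun h0 => hμ0 ?_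
      have h0' : μ (ball x₀ δ) = 0 := by
        rwa [eq_comm, measureReal_eq_zero_iff] at h0
      have hS0 : μ S = 0 := hS.measure_zero_of_nhdsWithin fun a ha =>
        ⟨ball a δ, mem_nhdsWithin_of_mem_nhds (ball_mem_nhds a hδ), by
          rw [hμ δ a ha x₀ hx₀, h0']⟩
      rw [← Measure.restrict_eq_self_of_ae_mem hμS, Measure.restrict_eq_zero, hS0]
    obtain ⟨i1, e1⟩ := integral_indicator_dist_lt_fst μ ν hμS hx₀ (hν δ) (hintg μ hμS g hg)
    obtain ⟨i2, e2⟩ := integral_indicator_dist_lt_snd μ ν hνS hx₀ (hμ δ) (hintg ν hνS g hg)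
    obtain ⟨i3, e3⟩ := integral_indicator_dist_lt_fst μ ν hμS hx₀ (hν δ)
      (integrable_const (1 : ℝ))
    obtain ⟨i4, e4⟩ := integral_indicator_dist_lt_snd μ ν hνS hx₀ (hμ δ)
      (integrable_const (1 : ℝ))
    rw [e3] at e4
    simp only [integral_const, smul_eq_mul, mul_one] at e3 e4
    have hle : |ν.real (ball x₀ δ) * ∫ x, g x ∂μ - μ.real (ball x₀ δ) * ∫ x, g x ∂ν| ≤
        ε * (ν.real (ball x₀ δ) * μ.real Set.univ) := by
      rw [← e1, ← e2, ← e3, ← integral_sub i1 i2, ← integral_const_mul]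
      refine (norm_integral_le_integral_norm _).trans
        (integral_mono_ae (i1.sub i2).norm (i3.const_mul ε) ?_)
      have a1 : ∀ᵐ p ∂(μ.prod ν), p.1 ∈ S := Measure.quasiMeasurePreserving_fst.ae hμS
      have a2 : ∀ᵐ p ∂(μ.prod ν), p.2 ∈ S := Measure.quasiMeasurePreserving_snd.ae hνS
      filter_upwards [a1, a2] with p h1 h2
      by_cases hp : dist p.1 p.2 < δ
      · simpa [Set.indicator_apply, hp, Real.dist_eq] using hgδ p.1 h1 p.2 h2 hp.le
      · simp [hp]
    set N := μ.real (ball x₀ δ)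
    set N' := ν.real (ball x₀ δ)
    set U := μ.real Set.univ
    set V := ν.real Set.univ
    have hU : 0 < U := hN.trans_le (measureReal_mono (Set.subset_univ _))
    have h5 : N * (V * (∫ x, g x ∂μ) - U * ∫ x, g x ∂ν) =
        U * (N' * (∫ x, g x ∂μ) - N * ∫ x, g x ∂ν) := by
      linear_combination (-(∫ x, g x ∂μ)) * e4
    have h6 : N * |V * (∫ x, g x ∂μ) - U * ∫ x, g x ∂ν| ≤ N * (ε * (U * V)) := by
      calc N * |V * (∫ x, g x ∂μ) - U * ∫ x, g x ∂ν|
          = U * |N' * (∫ x, g x ∂μ) - N * ∫ x, g x ∂ν| := by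
            rw [← abs_of_pos hN, ← abs_mul, abs_of_pos hN, h5, abs_mul, abs_of_pos hU]
        _ ≤ U * (ε * (N' * U)) := by gcongr
        _ = N * (ε * (U * V)) := by rw [e4]; ring
    exact le_of_mul_le_mul_left h6 hN
  rw [← sub_eq_zero, ← abs_nonpos_iff]
  refine le_of_forall_pos_le_add fun η hη => ?_
  have hW : 0 ≤ μ.real Set.univ * ν.real Set.univ := by positivity
  refine (key (η / (μ.real Set.univ * ν.real Set.univ + 1)) (by positivity)).trans ?_
  rw [zero_add, div_mul_eq_mul_div, div_le_iff₀ (by positivity)]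
  nlinarith

lemma measure_ball_eq_of_isometry_invariant {E : Type*} [NormedAddCommGroup E]
    [InnerProductSpace ℝ E] [FiniteDimensional ℝ E] [MeasurableSpace E] [BorelSpace E]
    {μ : Measure E} (hμ : ∀ T : E ≃ₗᵢ[ℝ] E, ∀ A, MeasurableSet A → μ (T ⁻¹' A) = μ A) (r : ℝ)
    {x y : E} (hxy : ‖x‖ = ‖y‖) : μ (ball x r) = μ (ball y r) := by
  have h : (ℝ ∙ (x - y))ᗮ.reflection x = y := Submodule.reflection_sub hxy
  rw [← hμ (ℝ ∙ (x - y))ᗮ.reflection (ball y r) measurableSet_ball,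
    LinearIsometryEquiv.preimage_ball, (LinearIsometryEquiv.symm_apply_eq _).2 h.symm]

/-- Up to a positive constant, integration against the surface measure of the unit sphere is
integration over the unit ball in polar form. -/
lemma exists_integral_sphere_eq_mul_integral {E : Type*} [NormedAddCommGroup E]
    [InnerProductSpace ℝ E] [FiniteDimensional ℝ E] [MeasurableSpace E] [BorelSpace E]
    {k : ℕ} (hk : finrank ℝ E = k + 1) (j : ℕ) :
    ∃ c : ℝ, 0 < c ∧ ∀ g : E → ℝ, ContinuousOn g (sphere 0 1) →
      ∫ x in sphere (0 : E) 1, g x ∂μH[(k : ℝ)] =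
        c * ∫ x : E, (closedBall (0 : E) 1).indicator (fun x => ‖x‖ ^ j * g (‖x‖⁻¹ • x)) x := by
  have : Nontrivial E := Module.nontrivial_of_finrank_pos (R := ℝ) (by lia)
  let N : E → E := fun x => ‖x‖⁻¹ • x
  have hN : Measurable N := by fun_prop
  let w : E → ENNReal := (closedBall (0 : E) 1).indicator fun x => ENNReal.ofReal (‖x‖ ^ j)
  have hw : Measurable w := Measurable.indicator (by fun_prop) measurableSet_closedBall
  have hw1 : ∀ x, w x ≤ (closedBall (0 : E) 1).indicator 1 x := by
    intro x
    refine Set.indicator_le_indicator' fun hx => ?_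
    have : ‖x‖ ≤ 1 := by simpa using hx
    exact ENNReal.ofReal_le_one.2 (pow_le_one₀ (norm_nonneg x) this)
  have hwlt : ∀ x, w x < ⊤ := fun x => (hw1 x).trans_lt (by
    by_cases hx : x ∈ closedBall (0 : E) 1 <;> simp [Set.indicator, hx])
  have hvol : ∫⁻ x, w x < ⊤ := by
    refine (lintegral_mono hw1).trans_lt ?_
    rw [lintegral_indicator_one measurableSet_closedBall]
    exact measure_closedBall_lt_top
  let ν : Measure E := (volume.withDensity w).map N
  have hfinw : IsFiniteMeasure (volume.withDensity w) := isFiniteMeasure_withDensity hvol.ne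
  have hfinν : IsFiniteMeasure ν := inferInstanceAs (IsFiniteMeasure (Measure.map _ _))
  let μ : Measure E := μH[(k : ℝ)].restrict (sphere (0 : E) 1)
  have hfinμ : IsFiniteMeasure μ :=
    isFiniteMeasure_restrict.2 (hausdorffMeasure_sphere_lt_top_s16 hk).ne
  have hμS : ∀ᵐ x ∂μ, x ∈ sphere (0 : E) 1 := ae_restrict_mem isClosed_sphere.measurableSet
  have hνS : ∀ᵐ x ∂ν, x ∈ sphere (0 : E) 1 := by
    refine (ae_map_iff hN.aemeasurable
      (isClosed_sphere : IsClosed (sphere (0 : E) 1)).measurableSet).2 ?_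
    refine (withDensity_absolutelyContinuous volume w).ae_le ?_
    filter_upwards [Measure.ae_ne volume (0 : E)] with x hx
    simp [N, norm_smul, hx]
  have hμinv : ∀ T : E ≃ₗᵢ[ℝ] E, ∀ A, MeasurableSet A → μ (T ⁻¹' A) = μ A := by
    intro T A hA
    have h1 : (T ⁻¹' A) ∩ sphere (0 : E) 1 = T ⁻¹' (A ∩ sphere (0 : E) 1) := by
      ext x; simp
    rw [Measure.restrict_apply hA, Measure.restrict_apply (T.continuous.measurable hA), h1]
    exact (T.toIsometryEquiv.measurePreserving_hausdorffMeasure (k : ℝ)).measure_preimage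
      (hA.inter isClosed_sphere.measurableSet).nullMeasurableSet
  have hνinv : ∀ T : E ≃ₗᵢ[ℝ] E, ∀ A, MeasurableSet A → ν (T ⁻¹' A) = ν A := by
    intro T A hA
    have hTA : MeasurableSet (T ⁻¹' A) := T.continuous.measurable hA
    rw [Measure.map_apply hN hA, Measure.map_apply hN hTA, withDensity_apply _ (hN hA),
      withDensity_apply _ (hN hTA), ← lintegral_indicator (hN hA),
      ← lintegral_indicator (hN hTA), ← T.measurePreserving.lintegral_comp
        (hw.indicator (hN hA))]
    congr 1
    ext x
    classical
    simp [Set.indicator_apply, N, w]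
  have hν0 : 0 < ν.real Set.univ := by
    rw [measureReal_def, ENNReal.toReal_pos_iff]
    refine ⟨?_, measure_lt_top _ _⟩
    rw [Measure.map_apply hN MeasurableSet.univ, Set.preimage_univ,
      withDensity_apply _ MeasurableSet.univ, Measure.restrict_univ,
      lintegral_pos_iff_support hw]
    refine lt_of_lt_of_le ?_ (measure_mono (s := ball (0 : E) 1 \ {0}) ?_)
    · exact (isOpen_ball.sdiff isClosed_singleton).measure_pos _ (by
        obtain ⟨e, he⟩ := exists_norm_eq E (c := 1 / 2) (by norm_num)
        refine ⟨e, by simp [he]; norm_num, ?_⟩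
        rintro rfl
        norm_num at he)
    · rintro x ⟨hx1, hx2⟩
      have hx3 : 0 < ‖x‖ := norm_pos_iff.2 hx2
      have : x ∈ closedBall (0 : E) 1 := ball_subset_closedBall hx1
      simp only [w, Function.mem_support, Set.indicator_of_mem this]
      simp only [ne_eq, ENNReal.ofReal_eq_zero, not_le]
      positivity
  have hμ0 : 0 < μ.real Set.univ := by
    rw [measureReal_def, ENNReal.toReal_pos_iff]
    refine ⟨?_, measure_lt_top _ _⟩
    rw [Measure.restrict_apply_univ]
    exact hausdorffMeasure_sphere_pos_s16 hk
  refine ⟨μ.real Set.univ / ν.real Set.univ, by positivity, fun g hg => ?_⟩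
  have h := measureReal_mul_integral_eq_of_measure_ball_eq μ ν (isCompact_sphere 0 1) hμS hνS
    (fun r x hx y hy => measure_ball_eq_of_isometry_invariant hμinv r (by simp_all))
    (fun r x hx y hy => measure_ball_eq_of_isometry_invariant hνinv r (by simp_all)) hg
  have h2 : ∫ x, g x ∂ν =
      ∫ x : E, (closedBall (0 : E) 1).indicator (fun x => ‖x‖ ^ j * g (‖x‖⁻¹ • x)) x := by
    have hgν : AEStronglyMeasurable g ν := by
      rw [← Measure.restrict_eq_self_of_ae_mem hνS]
      exact hg.aestronglyMeasurable isClosed_sphere.measurableSet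
    rw [integral_map hN.aemeasurable hgν,
      integral_withDensity_eq_integral_toReal_smul hw (Filter.Eventually.of_forall hwlt)]
    congr 1
    ext x
    by_cases hx : x ∈ closedBall (0 : E) 1
    · simp only [w, Set.indicator_of_mem hx, N, smul_eq_mul]
      rw [ENNReal.toReal_ofReal (by positivity)]
    · simp [w, Set.indicator_of_notMem hx]
  rw [← h2, div_mul_eq_mul_div, eq_div_iff hν0.ne', ← h]
  ring

lemma exists_hausdorffMeasure_inter_eq_mul_volume (E : Type*) [NormedAddCommGroup E]
    [InnerProductSpace ℝ E] [FiniteDimensional ℝ E] [MeasurableSpace E] [BorelSpace E] (d : ℕ) :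
    ∃ C : ℝ, 0 ≤ C ∧ ∀ H : Submodule ℝ E, finrank ℝ H = d → ∀ A : Set E,
      (μH[(d : ℝ)] ((H : Set E) ∩ A)).toReal = C * volume.real ((↑) ⁻¹' A : Set H) := by
  refine ⟨(Measure.addHaarScalarFactor (volume : Measure (EuclideanSpace ℝ (Fin d))) μH[d] : ℝ)⁻¹,
    by positivity, fun H hH A => ?_⟩
  have h0 := Measure.addHaarScalarFactor_volume_hausdorffMeasure_ne_zero d
  have h1 : (μHE[d] : Measure H) = volume := by
    rw [← hH]; exact InnerProductSpace.euclideanHausdorffMeasure_eq_volume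
  rw [Measure.euclideanHausdorffMeasure_def] at h1
  have h2 : μH[(d : ℝ)] ((H : Set E) ∩ A) = μH[(d : ℝ)] ((↑) ⁻¹' A : Set H) := by
    rw [isometry_subtype_coe.hausdorffMeasure_preimage (Or.inl (Nat.cast_nonneg d)),
      Subtype.range_coe, Set.inter_comm]
  rw [h2, ← h1, measureReal_def, Measure.smul_apply, ENNReal.smul_def, smul_eq_mul,
    ENNReal.toReal_mul, ENNReal.coe_toReal, inv_mul_cancel_left₀ (by exact_mod_cast h0)]

/-- The radial function of an intersection body as the volume of an oblique cylinder. -/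
lemma IsIntBodyOfStar.exists_radialFn_eq {n : ℕ} (hn : 1 ≤ n) {K L : Set (Euc n)}
    (hL : IsStarBody L) (hKL : IsIntBodyOfStar n K L) :
    ∃ C : ℝ, 0 ≤ C ∧ ∀ x e : Euc n, ‖e‖ = 1 → ⟪x, e⟫ ≠ 0 →
      volume {z : Euc n | z - (⟪x, z⟫ / ⟪x, e⟫) • e ∈ L ∧ ⟪e, z⟫ ∈ Set.Icc (0 : ℝ) 1} < ⊤ ∧
      radialFn K (‖x‖⁻¹ • x) = C * ((‖x‖ / |⟪x, e⟫|) * volume.real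
        {z : Euc n | z - (⟪x, z⟫ / ⟪x, e⟫) • e ∈ L ∧ ⟪e, z⟫ ∈ Set.Icc (0 : ℝ) 1}) := by
  obtain ⟨C, hC, h⟩ := exists_hausdorffMeasure_inter_eq_mul_volume (Euc n) (n - 1)
  refine ⟨C, hC, fun x e he hxe => ?_⟩
  have hx : x ≠ 0 := by rintro rfl; simp at hxe
  have hx' : 0 < ‖x‖ := norm_pos_iff.2 hx
  set u := ‖x‖⁻¹ • x with hu
  have hu1 : ‖u‖ = 1 := by simp [hu, norm_smul, hx]
  have hu0 : u ≠ 0 := by rintro h; simp [h] at hu1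
  have hue : ⟪u, e⟫ ≠ 0 := by
    rw [hu, real_inner_smul_left]; exact mul_ne_zero (inv_ne_zero hx'.ne') hxe
  have hset : {z : Euc n | z - (⟪x, z⟫ / ⟪x, e⟫) • e ∈ L ∧ ⟪e, z⟫ ∈ Set.Icc (0 : ℝ) 1} =
      {z : Euc n | z - (⟪u, z⟫ / ⟪u, e⟫) • e ∈ L ∧ ⟪e, z⟫ ∈ Set.Icc (0 : ℝ) 1} := by
    have : ∀ z, ⟪u, z⟫ / ⟪u, e⟫ = ⟪x, z⟫ / ⟪x, e⟫ := fun z => by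
      rw [hu, real_inner_smul_left, real_inner_smul_left,
        mul_div_mul_left _ _ (inv_ne_zero hx'.ne')]
    simp_rw [this]
  have hfin : volume ((↑) ⁻¹' L : Set ↥((ℝ ∙ u)ᗮ)) < ⊤ :=
    (((ℝ ∙ u)ᗮ).closed_of_finiteDimensional.isClosedEmbedding_subtypeVal.isCompact_preimage
      hL.1).measure_lt_top
  have hvol := volume_oblique_cylinder u e hu1 he hue L hL.1.measurableSet
  rw [hset]
  refine ⟨by rw [hvol]; exact ENNReal.mul_lt_top ENNReal.ofReal_lt_top hfin, ?_⟩
  have : Fact (finrank ℝ (Euc n) = (n - 1) + 1) := ⟨by simp; lia⟩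
  rw [hKL.2.2 u (by simpa using hu1), h _ (Submodule.finrank_orthogonal_span_singleton hu0) L,
    measureReal_def, measureReal_def, hvol, ENNReal.toReal_mul,
    ENNReal.toReal_ofReal (abs_nonneg _)]
  have h3 : ‖x‖ / |⟪x, e⟫| * |⟪u, e⟫| = 1 := by
    rw [hu, real_inner_smul_left, abs_mul, abs_inv, abs_norm]
    have := abs_pos.2 hxe
    field_simp
  rw [← mul_assoc (‖x‖ / _), h3, one_mul]

lemma integral_radial_pow_nonneg {E : Type*} [NormedAddCommGroup E]
    [InnerProductSpace ℝ E] [FiniteDimensional ℝ E] [MeasurableSpace E] [BorelSpace E]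
    (L : Set E) (hL : MeasurableSet L) (C : ℝ) (hC : 0 ≤ C) (ρ : E → ℝ)
    (hρ : ∀ x e : E, ‖e‖ = 1 → ⟪x, e⟫ ≠ 0 →
      volume {z : E | z - (⟪x, z⟫ / ⟪x, e⟫) • e ∈ L ∧ ⟪e, z⟫ ∈ Set.Icc (0 : ℝ) 1} < ⊤ ∧
      ρ x = C * ((‖x‖ / |⟪x, e⟫|) * volume.real
        {z : E | z - (⟪x, z⟫ / ⟪x, e⟫) • e ∈ L ∧ ⟪e, z⟫ ∈ Set.Icc (0 : ℝ) 1}))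
    (hρm : Measurable ρ) (M : ℝ) (hρM : ∀ x, |ρ x| ≤ M) (g : E → ℝ) (hg : Continuous g)
    (m : ℕ) (hm : m + 1 ≤ finrank ℝ E)
    (h0 : ∀ H : Submodule ℝ E, finrank ℝ H + m = finrank ℝ E →
      0 ≤ ∫ x : H, (closedBall (0 : H) 1).indicator
        (fun x => ‖x‖ ^ m * g (‖x‖⁻¹ • (x : E))) x) :
    0 ≤ ∫ x : E, (closedBall (0 : E) 1).indicator (fun x => g (‖x‖⁻¹ • x) * ρ x ^ m) x := by
  let W : ℕ → ℕ → E → ℝ := fun j i =>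
    (closedBall (0 : E) 1).indicator fun x => ‖x‖ ^ j * g (‖x‖⁻¹ • x) * ρ x ^ i
  have hWm : ∀ j i, Measurable (W j i) := fun j i =>
    Measurable.indicator (by fun_prop) measurableSet_closedBall
  obtain ⟨G, hG⟩ := (isCompact_closedBall (0 : E) 1).exists_bound_of_continuousOn hg.continuousOn
  have hM : 0 ≤ M := (abs_nonneg _).trans (hρM 0)
  have hWb : ∀ j i x, ‖W j i x‖ ≤ G * M ^ i := by
    intro j i x
    have hN : ‖x‖⁻¹ • x ∈ closedBall (0 : E) 1 := by
      rw [mem_closedBall_zero_iff, norm_smul, norm_inv, norm_norm]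
      exact inv_mul_le_one
    have hg1 := hG _ hN
    have hG0 : 0 ≤ G := (norm_nonneg _).trans hg1
    by_cases hx : x ∈ closedBall (0 : E) 1
    · have hx1 : ‖x‖ ≤ 1 := by simpa using hx
      simp only [W, Set.indicator_of_mem hx, norm_mul, norm_pow, norm_norm]
      calc ‖x‖ ^ j * ‖g (‖x‖⁻¹ • x)‖ * ‖ρ x‖ ^ i ≤ 1 * G * M ^ i := by
            gcongr
            · exact pow_le_one₀ (norm_nonneg _) hx1
            · exact hρM x
        _ = G * M ^ i := by ring
    · simp only [W, Set.indicator_of_notMem hx, norm_zero]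
      positivity
  have hWi : ∀ j i (H : Submodule ℝ E), Integrable fun x : H => W j i x := by
    intro j i H
    have h1 : (fun x : H => W j i x) = (closedBall (0 : H) 1).indicator fun x : H => W j i x := by
      ext x
      by_cases hx : x ∈ closedBall (0 : H) 1
      · rw [Set.indicator_of_mem hx]
      · rw [Set.indicator_of_notMem hx]
        exact Set.indicator_of_notMem (by simpa using hx) _
    rw [h1, integrable_indicator_iff measurableSet_closedBall]
    exact IntegrableOn.of_bound measure_closedBall_lt_top
      ((hWm j i).comp measurable_subtype_coe).aestronglyMeasurable (G * M ^ i)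
      (Filter.Eventually.of_forall fun x => hWb j i x)
  have key : ∀ i j, j + i = m → ∀ H : Submodule ℝ E, finrank ℝ H + j = finrank ℝ E →
      0 ≤ ∫ x : H, W j i x := by
    intro i
    induction i with
    | zero =>
      rintro j rfl H hH
      convert h0 H hH using 3 with x
      by_cases hx : x ∈ closedBall (0 : H) 1
      · rw [Set.indicator_of_mem hx]
        simp only [W]
        rw [Set.indicator_of_mem (by simpa using hx)]
        simp
      · rw [Set.indicator_of_notMem hx]
        exact Set.indicator_of_notMem (by simpa using hx) _
    | succ i ih =>
      intro j hj H hH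
      have hmul : ∀ x, W j (i + 1) x = W j i x * ρ x := fun x => by
        simp only [W, ← Set.indicator_mul_left]
        congr 1
        ext y
        ring
      have hnorm : ∀ x, ‖x‖ * W j i x = W (j + 1) i x := fun x => by
        simp only [W, ← Set.indicator_mul_right]
        congr 1
        ext y
        ring
      have hi := hWi j (i + 1) H
      simp only [hmul] at hi ⊢
      refine integral_mul_section_nonneg L hL C hC ρ hρ (W j i) (hWm j i) H (by lia) hi ?_
      intro H' hH'
      simp only [hnorm]
      exact ih (j + 1) (by lia) H' (by lia)
  have h1 := key m 0 (zero_add m) ⊤ (by simp)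
  obtain ⟨c, hc, h2⟩ := exists_integral_eq_mul_integral_comp
    (volume : Measure (⊤ : Submodule ℝ E)) (volume : Measure E) Submodule.topEquiv
  have h3 := h2 (W 0 m)
  simp only [W, pow_zero, one_mul] at h1 h3
  rw [h3]
  exact mul_nonneg hc.le h1

lemma setIntegral_sphere_inter_submodule {E : Type*} [NormedAddCommGroup E]
    [InnerProductSpace ℝ E] [FiniteDimensional ℝ E] [MeasurableSpace E] [BorelSpace E]
    (H : Submodule ℝ E) (k : ℕ) (g : E → ℝ) :
    ∫ x in sphere (0 : E) 1 ∩ (H : Set E), g x ∂μH[(k : ℝ)] =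
      ∫ x in sphere (0 : H) 1, g x ∂μH[(k : ℝ)] := by
  have hemb : MeasurableEmbedding ((↑) : H → E) :=
    MeasurableEmbedding.subtype_coe H.closed_of_finiteDimensional.measurableSet
  have h : (μH[(k : ℝ)] : Measure H).map (↑) = μH[(k : ℝ)].restrict (H : Set E) := by
    have h1 := H.subtypeₗᵢ.isometry.map_hausdorffMeasure (d := (k : ℝ))
      (Or.inl (Nat.cast_nonneg k))
    have h2 : Set.range H.subtypeₗᵢ = (H : Set E) := Subtype.range_coe
    rwa [h2] at h1
  rw [← Measure.restrict_restrict isClosed_sphere.measurableSet, ← h, hemb.setIntegral_map]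
  rfl

lemma sphRadon_eq {n d k : ℕ} (hd : d = k + 1) (g : Euc n → ℝ) (H : Gr n d) :
    sphRadon n d g H = ∫ x in sphere (0 : H.1) 1, g x ∂μH[(k : ℝ)] := by
  have : (d : ℝ) - 1 = k := by rw [hd]; push_cast; ring
  rw [sphRadon, this, setIntegral_sphere_inter_submodule]

lemma IsStarBody.continuousOn_radialFn {n : ℕ} {K : Set (Euc n)} (hK : IsStarBody K) :
    ContinuousOn (radialFn K) (sphere 0 1) :=
  hK.2.2.1.continuousOn.inv₀ fun x hx => hK.2.2.2.1 x (by rintro rfl; simp at hx)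

lemma IsStarBody.integrableOn_radialFn_pow_mul {n : ℕ} (hn : 1 ≤ n) {K : Set (Euc n)}
    (hK : IsStarBody K) (m : ℕ) {g : Euc n → ℝ} (hg : Continuous g) :
    IntegrableOn (fun x => radialFn K x ^ m * g x) (sphere 0 1) μH[(n : ℝ) - 1] := by
  obtain ⟨k, rfl⟩ : ∃ k, n = k + 1 := ⟨n - 1, by lia⟩
  have h1 : (((k + 1 : ℕ) : ℝ) - 1) = k := by push_cast; ring
  rw [h1]
  obtain ⟨M, hM⟩ := (isCompact_sphere (0 : Euc (k + 1)) 1).exists_bound_of_continuousOn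
    ((hK.continuousOn_radialFn.pow m).mul hg.continuousOn)
  exact IntegrableOn.of_bound (hausdorffMeasure_sphere_lt_top_s16 (by simp))
    (((hK.continuousOn_radialFn.pow m).mul hg.continuousOn).aestronglyMeasurable
      isClosed_sphere.measurableSet) M
    ((ae_restrict_mem isClosed_sphere.measurableSet).mono fun x hx => hM x hx)

lemma IsIntBodyOfStar.integral_radialFn_pow_mul_nonneg {n m : ℕ} (hm : m + 1 ≤ n)
    {K L : Set (Euc n)} (hK : IsStarBody K) (hL : IsStarBody L) (hKL : IsIntBodyOfStar n K L)
    {g : Euc n → ℝ} (hg : Continuous g) (h0 : ∀ H, 0 ≤ sphRadon n (n - m) g H) :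
    0 ≤ ∫ x in sphere (0 : Euc n) 1, radialFn K x ^ m * g x ∂μH[(n : ℝ) - 1] := by
  obtain ⟨k, hk⟩ : ∃ k, n = k + 1 := ⟨n - 1, by lia⟩
  have h1 : (n : ℝ) - 1 = k := by rw [hk]; push_cast; ring
  obtain ⟨c, hc, hintg⟩ := exists_integral_sphere_eq_mul_integral (E := Euc n) (k := k)
    (by simp [hk]) 0
  rw [h1, hintg (fun x => radialFn K x ^ m * g x)
    ((hK.continuousOn_radialFn.pow m).mul hg.continuousOn)]
  refine mul_nonneg hc.le ?_
  obtain ⟨C, hC, hρ⟩ := hKL.exists_radialFn_eq (by lia) hL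
  obtain ⟨M, hM⟩ := (isCompact_sphere (0 : Euc n) 1).exists_bound_of_continuousOn
    hK.continuousOn_radialFn
  have hmeas : Measurable fun x : Euc n => radialFn K (‖x‖⁻¹ • x) := by
    have : Measurable (radialFn K) := hK.2.2.1.measurable.inv
    exact this.comp (by fun_prop)
  have hbd : ∀ x : Euc n, |radialFn K (‖x‖⁻¹ • x)| ≤ max M 0 := by
    intro x
    by_cases hx : x = 0
    · simp [hx, radialFn]
    · exact (hM _ (by simp [norm_smul, hx])).trans (le_max_left _ _)
  have := integral_radial_pow_nonneg L hL.1.measurableSet C hC _ hρ hmeas _ hbd g hg m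
    (by simpa using hm) (fun H hH => by
      rw [finrank_euclideanSpace_fin] at hH
      obtain ⟨k', hk'⟩ : ∃ k', n - m = k' + 1 := ⟨n - m - 1, by lia⟩
      have h2 : 0 ≤ ∫ x in sphere (0 : H) 1, g x ∂μH[(k' : ℝ)] :=
        (h0 ⟨H, Nat.eq_sub_of_add_eq hH⟩).trans_eq (sphRadon_eq hk' g _)
      obtain ⟨c', hc', hintg'⟩ := exists_integral_sphere_eq_mul_integral (E := H) (k := k')
        ((Nat.eq_sub_of_add_eq hH).trans hk') m
      rw [hintg' (fun x : H => g x) (by fun_prop)] at h2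
      exact nonneg_of_mul_nonneg_right h2 hc')
  simpa [mul_comm] using this

lemma IsIntersectionBody.integral_radialFn_pow_mul_nonneg {n m : ℕ} (hm : m + 1 ≤ n)
    {K : Set (Euc n)} (hK : IsIntersectionBody n K) {g : Euc n → ℝ} (hg : Continuous g)
    (h0 : ∀ H, 0 ≤ sphRadon n (n - m) g H) :
    0 ≤ ∫ x in sphere (0 : Euc n) 1, radialFn K x ^ m * g x ∂μH[(n : ℝ) - 1] := by
  choose D L hD hL hDL hle using fun k : ℕ =>
    hK.2 (1 / ((k : ℝ) + 1)) (by positivity)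
  refine ge_of_tendsto' (x := Filter.atTop) (f := fun k =>
    ∫ x in sphere (0 : Euc n) 1, radialFn (D k) x ^ m * g x ∂μH[(n : ℝ) - 1]) ?_
    fun k => (hDL k).integral_radialFn_pow_mul_nonneg hm (hD k) (hL k) hg h0
  obtain ⟨M, hM⟩ := (isCompact_sphere (0 : Euc n) 1).exists_bound_of_continuousOn
    hK.1.continuousOn_radialFn
  obtain ⟨G, hG⟩ := (isCompact_sphere (0 : Euc n) 1).exists_bound_of_continuousOn
    hg.continuousOn
  have hbi : IntegrableOn (fun _ : Euc n => (M + 1) ^ m * G) (sphere 0 1) μH[(n : ℝ) - 1] := by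
    simpa using (hK.1.integrableOn_radialFn_pow_mul (by lia) 0
      (continuous_const : Continuous fun _ : Euc n => (M + 1) ^ m * G))
  refine tendsto_integral_of_dominated_convergence _
    (fun k => ((hD k).integrableOn_radialFn_pow_mul (by lia) m hg).1) hbi ?_ ?_
  · intro k
    filter_upwards [ae_restrict_mem isClosed_sphere.measurableSet] with x hx
    have a1 : ‖radialFn (D k) x‖ ≤ M + 1 := by
      have b1 := hle k x hx
      have b2 : 1 / ((k : ℝ) + 1) ≤ 1 := by
        rw [div_le_one (by positivity)]; linarith [(Nat.cast_nonneg k : (0 : ℝ) ≤ k)]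
      have b3 := hM x hx
      rw [Real.norm_eq_abs] at b3 ⊢
      rw [abs_le] at *
      constructor <;> linarith [b1.1, b1.2, b3.1, b3.2]
    rw [norm_mul, norm_pow]
    have a2 := hG x hx
    have a3 : 0 ≤ M + 1 := (norm_nonneg _).trans a1
    gcongr
  · filter_upwards [ae_restrict_mem isClosed_sphere.measurableSet] with x hx
    refine Filter.Tendsto.mul_const _ (Filter.Tendsto.pow ?_ m)
    exact tendsto_iff_dist_tendsto_zero.2 (squeeze_zero (fun _ => dist_nonneg)
      (fun k => by rw [dist_comm, Real.dist_eq]; exact hle k x hx)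
      tendsto_one_div_add_atTop_nhds_zero_nat)

lemma IsIntersectionBody.eq_neg {n : ℕ} {K : Set (Euc n)} (hK : IsIntersectionBody n K) :
    K = -K := by
  have hsphere : ∀ ξ ∈ sphere (0 : Euc n) 1, gauge K (-ξ) = gauge K ξ := by
    intro ξ hξ
    refine inv_injective (eq_of_abs_sub_nonpos (le_of_forall_pos_le_add fun ε hε => ?_))
    obtain ⟨D, L, -, -, hDL, h⟩ := hK.2 (ε / 2) (by positivity)
    have hneg : radialFn D (-ξ) = radialFn D ξ := by
      rw [radialFn, radialFn, gauge_neg fun x hx => ?_]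
      have := hDL.1
      rw [this]
      simpa using hx
    have h1 := h ξ hξ
    have h2 := h (-ξ) (by simpa using hξ)
    rw [hneg] at h2
    change |radialFn K (-ξ) - radialFn K ξ| ≤ 0 + ε
    rw [abs_le] at *
    constructor <;> linarith [h1.1, h1.2, h2.1, h2.2]
  have hgauge : ∀ x : Euc n, gauge K (-x) = gauge K x := by
    intro x
    by_cases hx : x = 0
    · simp [hx]
    have hx' : ‖x‖ ≠ 0 := norm_ne_zero_iff.2 hx
    have h1 : x = ‖x‖ • (‖x‖⁻¹ • x) := by rw [smul_smul, mul_inv_cancel₀ hx', one_smul]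
    rw [h1, ← smul_neg, gauge_smul_of_nonneg (norm_nonneg x), gauge_smul_of_nonneg (norm_nonneg x),
      hsphere _ (by simp [norm_smul, hx'])]
  ext x
  rw [Set.mem_neg, hK.1.2.2.2.2]
  change gauge K x ≤ 1 ↔ gauge K (-x) ≤ 1
  rw [hgauge]

lemma integrableOn_sphere_of_continuous {E : Type*} [NormedAddCommGroup E]
    [InnerProductSpace ℝ E] [FiniteDimensional ℝ E] [MeasurableSpace E] [BorelSpace E]
    {k : ℕ} (hk : finrank ℝ E = k + 1) {g : E → ℝ} (hg : Continuous g) :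
    IntegrableOn g (sphere (0 : E) 1) μH[(k : ℝ)] := by
  obtain ⟨M, hM⟩ := (isCompact_sphere (0 : E) 1).exists_bound_of_continuousOn hg.continuousOn
  exact IntegrableOn.of_bound (hausdorffMeasure_sphere_lt_top_s16 hk)
    (hg.continuousOn.aestronglyMeasurable isClosed_sphere.measurableSet) M
    ((ae_restrict_mem isClosed_sphere.measurableSet).mono fun x hx => hM x hx)

lemma sphRadon_add {n d : ℕ} (hd : 1 ≤ d) {g₁ g₂ : Euc n → ℝ} (h₁ : Continuous g₁)
    (h₂ : Continuous g₂) : sphRadon n d (g₁ + g₂) = sphRadon n d g₁ + sphRadon n d g₂ := by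
  obtain ⟨k, rfl⟩ : ∃ k, d = k + 1 := ⟨d - 1, by lia⟩
  ext H
  rw [Pi.add_apply, sphRadon_eq rfl, sphRadon_eq rfl, sphRadon_eq rfl]
  exact integral_add (integrableOn_sphere_of_continuous H.2 (by fun_prop))
    (integrableOn_sphere_of_continuous H.2 (by fun_prop))

lemma sphRadon_smul {n d : ℕ} (c : ℝ) (g : Euc n → ℝ) :
    sphRadon n d (c • g) = c • sphRadon n d g := by
  ext H
  exact integral_const_mul c _

lemma exists_sphRadon_one_eq (n : ℕ) {d : ℕ} (hd : 1 ≤ d) :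
    ∃ c : ℝ, 0 < c ∧ ∀ H, sphRadon n d 1 H = c := by
  obtain ⟨k, rfl⟩ : ∃ k, d = k + 1 := ⟨d - 1, by lia⟩
  have hk : finrank ℝ (Euc (k + 1)) = k + 1 := by simp
  refine ⟨(μH[(k : ℝ)] (sphere (0 : Euc (k + 1)) 1)).toReal,
    ENNReal.toReal_pos (hausdorffMeasure_sphere_pos_s16 hk).ne'
      (hausdorffMeasure_sphere_lt_top_s16 hk).ne, fun H => ?_⟩
  let T : H.1 ≃ₗᵢ[ℝ] Euc (k + 1) := ((stdOrthonormalBasis ℝ H.1).reindex (finCongr H.2)).repr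
  have h := T.toIsometryEquiv.hausdorffMeasure_preimage (k : ℝ) (sphere (0 : Euc (k + 1)) 1)
  have hT : T.toIsometryEquiv ⁻¹' (sphere (0 : Euc (k + 1)) 1) = sphere 0 1 := by
    ext x; simp
  rw [sphRadon_eq rfl, ← h, hT]
  simp [measureReal_def]

lemma abs_sphRadon_le {n d : ℕ} (hd : 1 ≤ d) {g : Euc n → ℝ} {G : ℝ}
    (hG : ∀ x ∈ sphere (0 : Euc n) 1, |g x| ≤ G) (H : Gr n d) :
    |sphRadon n d g H| ≤ G * sphRadon n d 1 H := by
  obtain ⟨k, rfl⟩ : ∃ k, d = k + 1 := ⟨d - 1, by lia⟩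
  rw [sphRadon_eq rfl, sphRadon_eq rfl]
  have := norm_setIntegral_le_of_norm_le_const
    (hausdorffMeasure_sphere_lt_top_s16 (E := H.1) H.2) (f := fun x : H.1 => g x) (C := G)
    fun x hx => hG x (by simpa using hx)
  simpa using this

/-- **Every intersection body is a generalized m-intersection body, `1 ≤ m ≤ n-1`.** -/
theorem intersectionBody_isGenIntBody (n m : ℕ) (hm : 1 ≤ m) (hmn : m ≤ n - 1)
    (K : Set (Euc n)) (hK : IsIntersectionBody n K) : IsGenIntBody n m K := by
  have hd : 1 ≤ n - m := by lia
  let Λ : (Euc n → ℝ) → ℝ := fun g =>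
    ∫ x in sphere (0 : Euc n) 1, radialFn K x ^ m * g x ∂μH[(n : ℝ) - 1]
  have hadd : ∀ g₁ g₂, Continuous g₁ → Continuous g₂ → Λ (g₁ + g₂) = Λ g₁ + Λ g₂ := by
    intro g₁ g₂ h₁ h₂
    simp only [Λ, Pi.add_apply, mul_add]
    exact integral_add (hK.1.integrableOn_radialFn_pow_mul (by lia) m h₁)
      (hK.1.integrableOn_radialFn_pow_mul (by lia) m h₂)
  have hsmul : ∀ (c : ℝ) g, Λ (c • g) = c * Λ g := by
    intro c g
    simp only [Λ, Pi.smul_apply, smul_eq_mul, mul_left_comm _ c]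
    exact integral_const_mul c _
  have hpos : ∀ g, Continuous g → (∀ H, 0 ≤ sphRadon n (n - m) g H) → 0 ≤ Λ g :=
    fun g hg h => hK.integral_radialFn_pow_mul_nonneg (by lia) hg h
  have hcongr : ∀ g₁ g₂, Continuous g₁ → Continuous g₂ →
      sphRadon n (n - m) g₁ = sphRadon n (n - m) g₂ → Λ g₁ ≤ Λ g₂ := by
    intro g₁ g₂ h₁ h₂ h
    have := hpos (g₂ + (-1 : ℝ) • g₁) (by fun_prop) fun H => by
      rw [sphRadon_add hd h₂ (by fun_prop), sphRadon_smul, h]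
      simp
    rw [hadd _ _ h₂ (by fun_prop), hsmul] at this
    linarith
  classical
  let ν : (Gr n (n - m) → ℝ) → ℝ := fun F =>
    if h : ∃ g, Continuous g ∧ sphRadon n (n - m) g = F then Λ h.choose else 0
  have hν : ∀ g, Continuous g → ν (sphRadon n (n - m) g) = Λ g := by
    intro g hg
    have h : ∃ g', Continuous g' ∧ sphRadon n (n - m) g' = sphRadon n (n - m) g := ⟨g, hg, rfl⟩
    simp only [ν, dif_pos h]
    exact le_antisymm (hcongr _ _ h.choose_spec.1 hg h.choose_spec.2)
      (hcongr _ _ hg h.choose_spec.1 h.choose_spec.2.symm)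
  obtain ⟨c, hc, hone⟩ := exists_sphRadon_one_eq n hd
  refine ⟨hK.1, hK.eq_neg, ν, ?_, ?_, ?_, ⟨Λ 1 / c, ?_⟩, fun g hg => (hν g hg).symm⟩
  · intro g₁ g₂ h₁ h₂
    rw [hν _ (h₁.add h₂), hν _ h₁, hν _ h₂, hadd _ _ h₁ h₂]
  · intro a g hg
    rw [hν _ (hg.const_smul a), hν _ hg, hsmul]
  · intro g hg h
    rw [hν _ hg]
    exact hpos g hg h
  · intro g hg
    rw [hν _ hg]
    obtain ⟨G, hG⟩ := (isCompact_sphere (0 : Euc n) 1).exists_bound_of_continuousOn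
      hg.continuousOn
    have hbdd : BddAbove (Set.range fun H : Gr n (n - m) => |sphRadon n (n - m) g H|) := by
      refine ⟨G * c, ?_⟩
      rintro _ ⟨H, rfl⟩
      exact (abs_sphRadon_le hd hG H).trans_eq (by rw [hone])
    set s := ⨆ H : Gr n (n - m), |sphRadon n (n - m) g H|
    have hs : ∀ H, |sphRadon n (n - m) g H| ≤ s := fun H => le_ciSup hbdd H
    have key : ∀ a : ℝ, |a| = 1 → 0 ≤ s / c * Λ 1 + a * Λ g := by
      intro a ha
      have h1 : Continuous (1 : Euc n → ℝ) := continuous_const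
      have := hpos ((s / c) • (1 : Euc n → ℝ) + a • g)
        ((h1.const_smul _).add (hg.const_smul a)) fun H => by
          rw [sphRadon_add hd (h1.const_smul _) (hg.const_smul a), sphRadon_smul, sphRadon_smul]
          simp only [Pi.add_apply, Pi.smul_apply, hone, smul_eq_mul]
          rw [div_mul_cancel₀ _ hc.ne']
          have h2 := neg_abs_le (a * sphRadon n (n - m) g H)
          rw [abs_mul, ha, one_mul] at h2
          linarith [hs H]
      rwa [hadd _ _ (h1.const_smul _) (hg.const_smul a), hsmul, hsmul] at this
    have h1 := key 1 (by simp)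
    have h2 := key (-1) (by simp)
    rw [show Λ 1 / c * s = s / c * Λ 1 by ring, abs_le]
    constructor <;> linarith

end
end
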